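/- Let d ≥ 2 and let P ∈ ℂ[X_1,…,X_d] be elliptic with P(0) = 0. Let X ⊆ ℝ^d be open, w : X → ℂ continuous such that w does not vanish identically on any connected component of X, and ψ : X → X continuous and locally injective, such that C_{w,ψ} maps C_P^∞(X) into C_P^∞(X). Then the following are equivalent: (i) C_{w,ψ} is m-topologizable on C_P^∞(X), i.e., for every compact K ⊆ X there exist a compact L ⊆ X and γ > 0 with sup_{x∈K}|C_{w,ψ}^m(f)(x)| ≤ γ^m sup_{y∈L}|f(y)| for all m ∈ ℕ and f ∈ C_P^∞(X); (ii) C_{w,ψ} is topologizable on C_P^∞(X), i.e., for every compact K there is a compact L such that for every m there is γ_m > 0 with sup_{x∈K}|C_{w,ψ}^m(f)(x)| ≤ γ_m sup_{y∈L}|f(y)| for all f ∈ C_P^∞(X); (iii) ψ has stable orbits. -/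

import Mathlib

open scoped BigOperators

noncomputable section

/-- Partial derivative in the `i`-th coordinate direction. -/
def pderivE {d : ℕ} {F : Type*} [NormedAddCommGroup F] [NormedSpace ℝ F] (i : Fin d)
    (f : EuclideanSpace ℝ (Fin d) → F) : EuclideanSpace ℝ (Fin d) → F :=
  fun x => fderiv ℝ f x (EuclideanSpace.single i 1)

/-- Iterated partial derivative `∂^α f` for a multi-index `α : Fin d → ℕ`. -/
def mderivE {d : ℕ} {F : Type*} [NormedAddCommGroup F] [NormedSpace ℝ F] (α : Fin d → ℕ)
    (f : EuclideanSpace ℝ (Fin d) → F) : EuclideanSpace ℝ (Fin d) → F :=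
  (List.finRange d).foldr (fun i g => (pderivE i)^[α i] g) f

/-- The constant coefficient linear partial differential operator `P(∂)`. -/
def PDop {d : ℕ} (P : MvPolynomial (Fin d) ℂ) (f : EuclideanSpace ℝ (Fin d) → ℂ) :
    EuclideanSpace ℝ (Fin d) → ℂ :=
  fun x => ∑ α ∈ P.support, P.coeff α * mderivE (fun i => α i) f x

/-- `P` is elliptic: the principal part `P_m` has no nontrivial real zero. -/
def IsElliptic {d : ℕ} (P : MvPolynomial (Fin d) ℂ) : Prop :=
  ∀ ξ : Fin d → ℝ, ξ ≠ 0 →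
    MvPolynomial.eval (fun i => (ξ i : ℂ))
      (MvPolynomial.homogeneousComponent P.totalDegree P) ≠ 0

/-- Membership in `C_P^∞(X) = {f ∈ C^∞(X) : P(∂)f = 0 on X}`. -/
def MemCP {d : ℕ} (P : MvPolynomial (Fin d) ℂ) (X : Set (EuclideanSpace ℝ (Fin d)))
    (f : EuclideanSpace ℝ (Fin d) → ℂ) : Prop :=
  ContDiffOn ℝ (⊤ : ℕ∞) f X ∧ ∀ x ∈ X, PDop P f x = 0

section Module1
open scoped ContDiff Topology
open MeasureTheory Filter Set
noncomputable section

abbrev Eu (d : ℕ) := EuclideanSpace ℝ (Fin d)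

/-- iterated derivative along a word -/
def DW {d : ℕ} (I : List (Fin d)) (f : Eu d → ℂ) : Eu d → ℂ := I.foldr pderivE f

section words
variable {d : ℕ}

@[simp] lemma DW_nil (f : Eu d → ℂ) : DW [] f = f := rfl
@[simp] lemma DW_cons (i : Fin d) (I : List (Fin d)) (f : Eu d → ℂ) :
    DW (i :: I) f = pderivE i (DW I f) := rfl
lemma DW_append (I J : List (Fin d)) (f : Eu d → ℂ) : DW (I ++ J) f = DW I (DW J f) := by
  simp [DW, List.foldr_append]

lemma pderivE_smooth {f : Eu d → ℂ} (hf : ContDiff ℝ ∞ f) (i : Fin d) :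
    ContDiff ℝ ∞ (pderivE i f) := by
  unfold pderivE
  exact (hf.fderiv_right (by simp)).clm_apply contDiff_const

lemma DW_smooth {f : Eu d → ℂ} (hf : ContDiff ℝ ∞ f) (I : List (Fin d)) :
    ContDiff ℝ ∞ (DW I f) := by
  induction I with
  | nil => exact hf
  | cons i I ih => exact pderivE_smooth ih i

lemma pderivE_congr {f g : Eu d → ℂ} {x : Eu d} (h : f =ᶠ[𝓝 x] g) (i : Fin d) :
    pderivE i f =ᶠ[𝓝 x] pderivE i g := by
  filter_upwards [h.fderiv (𝕜 := ℝ)] with y hy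
  simp [pderivE, hy]

lemma DW_congr {f g : Eu d → ℂ} {x : Eu d} (h : f =ᶠ[𝓝 x] g) (I : List (Fin d)) :
    DW I f =ᶠ[𝓝 x] DW I g := by
  induction I with
  | nil => exact h
  | cons i I ih => exact pderivE_congr ih i

lemma pderivE_comm {f : Eu d → ℂ} (hf : ContDiff ℝ ∞ f) (i j : Fin d) :
    pderivE i (pderivE j f) = pderivE j (pderivE i f) := by
  have hd : Differentiable ℝ (fderiv ℝ f) :=
    (hf.fderiv_right (m := ∞) (by simp)).differentiable (by simp)
  have key : ∀ (a b : Fin d) x, pderivE a (pderivE b f) x =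
      fderiv ℝ (fderiv ℝ f) x (EuclideanSpace.single a 1) (EuclideanSpace.single b 1) := by
    intro a b x
    unfold pderivE
    rw [fderiv_clm_apply (hd x) (by fun_prop)]
    simp
  funext x
  rw [key, key]
  exact (hf.contDiffAt.isSymmSndFDerivAt (by simpa using (show ((2:ℕ∞) : WithTop ℕ∞) ≤ ((⊤:ℕ∞) : WithTop ℕ∞) from WithTop.coe_le_coe.2 le_top))).eq _ _

lemma DW_perm {f : Eu d → ℂ} (hf : ContDiff ℝ ∞ f) {I J : List (Fin d)} (h : I.Perm J) :
    DW I f = DW J f := by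
  induction h with
  | nil => rfl
  | cons i _ ih => simp [ih]
  | swap i j l => simpa using pderivE_comm (DW_smooth hf l) j i
  | trans _ _ h1 h2 => exact h1.trans h2

lemma DW_comm {f : Eu d → ℂ} (hf : ContDiff ℝ ∞ f) (I J : List (Fin d)) :
    DW I (DW J f) = DW J (DW I f) := by
  rw [← DW_append, ← DW_append]
  exact DW_perm hf List.perm_append_comm

lemma DW_add {f g : Eu d → ℂ} (hf : ContDiff ℝ ∞ f) (hg : ContDiff ℝ ∞ g) (I : List (Fin d)) :
    DW I (fun x => f x + g x) = fun x => DW I f x + DW I g x := by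
  induction I with
  | nil => rfl
  | cons i I ih =>
    simp only [DW_cons, ih]
    funext x
    unfold pderivE
    rw [fderiv_fun_add ((DW_smooth hf I).differentiable (by simp) x)
      ((DW_smooth hg I).differentiable (by simp) x)]
    rfl

lemma DW_const_mul {f : Eu d → ℂ} (hf : ContDiff ℝ ∞ f) (c : ℂ) (I : List (Fin d)) :
    DW I (fun x => c * f x) = fun x => c * DW I f x := by
  induction I with
  | nil => rfl
  | cons i I ih =>
    simp only [DW_cons, ih]
    funext x
    unfold pderivE
    rw [fderiv_const_mul ((DW_smooth hf I).differentiable (by simp) x)]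
    rfl

lemma DW_zero (I : List (Fin d)) : DW I (fun _ => (0:ℂ)) = fun _ => 0 := by
  have := DW_const_mul (f := fun _ : Eu d => (0:ℂ)) contDiff_const 0 I
  simpa using this

lemma DW_sum {ι : Type*} (s : Finset ι) {f : ι → Eu d → ℂ} (hf : ∀ i ∈ s, ContDiff ℝ ∞ (f i))
    (I : List (Fin d)) :
    DW I (fun x => ∑ i ∈ s, f i x) = fun x => ∑ i ∈ s, DW I (f i) x := by
  classical
  induction s using Finset.induction_on with
  | empty => simpa using DW_zero I
  | insert a s ha ih =>
    have h1 : (fun x => ∑ i ∈ insert a s, f i x) = fun x => f a x + ∑ i ∈ s, f i x := by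
      funext x; rw [Finset.sum_insert ha]
    rw [h1, DW_add (hf a (by simp)) (ContDiff.sum fun i hi => hf i (by simp [hi])),
      ih fun i hi => hf i (by simp [hi])]
    funext x; rw [Finset.sum_insert ha]

lemma DW_sub {f g : Eu d → ℂ} (hf : ContDiff ℝ ∞ f) (hg : ContDiff ℝ ∞ g) (I : List (Fin d)) :
    DW I (fun x => f x - g x) = fun x => DW I f x - DW I g x := by
  have h : (fun x => f x - g x) = fun x => f x + (-1) * g x := by funext x; ring
  rw [h, DW_add hf (contDiff_const.mul hg), DW_const_mul hg]
  funext x; ring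

/-- translation -/
lemma DW_translate (f : Eu d → ℂ) (b : Eu d) (I : List (Fin d)) :
    DW I (fun x => f (x - b)) = fun x => DW I f (x - b) := by
  induction I with
  | nil => rfl
  | cons i I ih =>
    simp only [DW_cons, ih]
    funext x
    unfold pderivE
    rw [fderiv_comp_sub]

/-- word of a multi-index -/
def wordL (l : List (Fin d)) (α : Fin d → ℕ) : List (Fin d) :=
  l.flatMap fun i => List.replicate (α i) i

def word (α : Fin d → ℕ) : List (Fin d) := wordL (List.finRange d) α

lemma DW_replicate (n : ℕ) (i : Fin d) (f : Eu d → ℂ) :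
    DW (List.replicate n i) f = (pderivE i)^[n] f := by
  induction n with
  | zero => rfl
  | succ n ih => rw [List.replicate_succ, DW_cons, ih, Function.iterate_succ_apply']

lemma mderivE_eq (α : Fin d → ℕ) (f : Eu d → ℂ) : mderivE α f = DW (word α) f := by
  unfold mderivE word wordL
  induction List.finRange d with
  | nil => rfl
  | cons i l ih => simp only [List.foldr_cons, ih, List.flatMap_cons, DW_append, DW_replicate]

lemma length_word (α : Fin d → ℕ) : (word α).length = ∑ i, α i := by
  simp [word, wordL, List.length_flatMap, Fin.sum_univ_def]

lemma PDop_eq (P : MvPolynomial (Fin d) ℂ) (f : Eu d → ℂ) (x : Eu d) :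
    PDop P f x = ∑ α ∈ P.support, P.coeff α * DW (word α) f x := by
  simp [PDop, mderivE_eq]

lemma PDop_smooth (P : MvPolynomial (Fin d) ℂ) {f : Eu d → ℂ} (hf : ContDiff ℝ ∞ f) :
    ContDiff ℝ ∞ (PDop P f) := by
  have : PDop P f = fun x => ∑ α ∈ P.support, P.coeff α * DW (word α) f x := by
    funext x; exact PDop_eq P f x
  rw [this]
  exact ContDiff.sum fun α _ => contDiff_const.mul (DW_smooth hf _)

lemma DW_PDop (P : MvPolynomial (Fin d) ℂ) {f : Eu d → ℂ} (hf : ContDiff ℝ ∞ f)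
    (I : List (Fin d)) : DW I (PDop P f) = PDop P (DW I f) := by
  have : PDop P f = fun x => ∑ α ∈ P.support, P.coeff α * DW (word α) f x := by
    funext x; exact PDop_eq P f x
  rw [this, DW_sum _ (fun α _ => contDiff_const.mul (DW_smooth hf _))]
  funext x
  rw [PDop_eq]
  refine Finset.sum_congr rfl fun α _ => ?_
  rw [DW_const_mul (DW_smooth hf _), DW_comm hf]

lemma PDop_congr (P : MvPolynomial (Fin d) ℂ) {f g : Eu d → ℂ} {x : Eu d} (h : f =ᶠ[𝓝 x] g) :
    PDop P f =ᶠ[𝓝 x] PDop P g := by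
  have : ∀ᶠ y in 𝓝 x, ∀ α ∈ P.support, DW (word α) f y = DW (word α) g y := by
    rw [Filter.eventually_all_finset]
    intro α _
    exact DW_congr h _
  filter_upwards [this] with y hy
  rw [PDop_eq, PDop_eq]
  exact Finset.sum_congr rfl fun α hα => by rw [hy α hα]

/-- relation with iteratedFDeriv -/
lemma DW_ofFn {f : Eu d → ℂ} (hf : ContDiff ℝ ∞ f) (n : ℕ) (v : Fin n → Fin d) (x : Eu d) :
    DW (List.ofFn v) f x =
      iteratedFDeriv ℝ n f x (fun k => EuclideanSpace.single (v k) (1:ℝ)) := by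
  induction n generalizing x with
  | zero => simp
  | succ n ih =>
    rw [List.ofFn_succ, DW_cons]
    have h : DW (List.ofFn fun i => v i.succ) f = fun y => iteratedFDeriv ℝ n f y
      (fun k => EuclideanSpace.single (v k.succ) (1:ℝ)) := by
      funext y; exact ih _ y
    rw [h]
    unfold pderivE
    rw [iteratedFDeriv_succ_apply_left]
    have hd : DifferentiableAt ℝ (iteratedFDeriv ℝ n f) x :=
      (hf.differentiable_iteratedFDeriv (m := n) (by exact_mod_cast ENat.natCast_lt_top n)) x
    have := (hd.hasFDerivAt.continuousMultilinear_apply_const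
      (fun k => EuclideanSpace.single (v k.succ) (1:ℝ))).fderiv
    rw [this]
    rfl

lemma norm_DW_le {f : Eu d → ℂ} (hf : ContDiff ℝ ∞ f) (I : List (Fin d)) (x : Eu d) :
    ‖DW I f x‖ ≤ ‖iteratedFDeriv ℝ I.length f x‖ := by
  have := DW_ofFn hf I.length I.get x
  rw [List.ofFn_get] at this
  rw [this]
  refine (ContinuousMultilinearMap.le_opNorm _ _).trans ?_
  simp

lemma norm_iteratedFDeriv_le_sum {f : Eu d → ℂ} (hf : ContDiff ℝ ∞ f) (n : ℕ) (x : Eu d) :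
    ‖iteratedFDeriv ℝ n f x‖ ≤ ∑ v : Fin n → Fin d, ‖DW (List.ofFn v) f x‖ := by
  refine ContinuousMultilinearMap.opNorm_le_bound (Finset.sum_nonneg fun _ _ => norm_nonneg _) ?_
  intro m
  have hm : ∀ k, m k = ∑ i, m k i • EuclideanSpace.single i (1:ℝ) := by
    intro k
    ext j
    simp [Pi.single_apply]
  have h1 : iteratedFDeriv ℝ n f x m = ∑ v : Fin n → Fin d,
      (∏ k, m k (v k)) • iteratedFDeriv ℝ n f x (fun k => EuclideanSpace.single (v k) (1:ℝ)) := by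
    conv_lhs => rw [show m = fun k => ∑ i, m k i • EuclideanSpace.single i (1:ℝ) from funext hm]
    rw [ContinuousMultilinearMap.map_sum]
    refine Finset.sum_congr rfl fun v _ => ?_
    exact ContinuousMultilinearMap.map_smul_univ _ _ _
  rw [h1, Finset.sum_mul]
  refine (norm_sum_le _ _).trans (Finset.sum_le_sum fun v _ => ?_)
  rw [norm_smul, ← DW_ofFn hf, mul_comm]
  gcongr
  rw [norm_prod]
  exact Finset.prod_le_prod (fun _ _ => norm_nonneg _) fun k _ => PiLp.norm_apply_le (m k) (v k)

lemma norm_iteratedFDeriv_le_of_DW {f : Eu d → ℂ} (hf : ContDiff ℝ ∞ f) (n : ℕ) (x : Eu d)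
    {A : ℝ} (h : ∀ I : List (Fin d), I.length = n → ‖DW I f x‖ ≤ A) :
    ‖iteratedFDeriv ℝ n f x‖ ≤ d ^ n * A := by
  refine (norm_iteratedFDeriv_le_sum hf n x).trans ?_
  refine (Finset.sum_le_sum fun v _ => h _ (List.length_ofFn)).trans ?_
  simp

/-- localisation -/
lemma exists_global {X K : Set (Eu d)} (hX : IsOpen X) (hK : IsCompact K) (hKX : K ⊆ X)
    {f : Eu d → ℂ} (hf : ContDiffOn ℝ ∞ f X) :
    ∃ g : Eu d → ℂ, ContDiff ℝ ∞ g ∧ ∃ U, IsOpen U ∧ K ⊆ U ∧ U ⊆ X ∧ EqOn g f U := by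
  obtain ⟨K1, hK1, hKK1, hK1X⟩ := exists_compact_between hK hX hKX
  obtain ⟨K2, hK2, hKK2, hK2X⟩ := exists_compact_between hK1 hX hK1X
  obtain ⟨χ, hχ0, hχ1, -⟩ := exists_contMDiffMap_zero_one_of_isClosed (n := (⊤ : ℕ∞))
    (modelWithCornersSelf ℝ (Eu d)) (s := (interior K2)ᶜ) (t := K1) isOpen_interior.isClosed_compl
    hK1.isClosed (by
      rw [Set.disjoint_left]; intro x hx hx'; exact hx (hKK2 hx'))
  refine ⟨fun x => (χ x : ℂ) * f x, ?_, interior K1, isOpen_interior, hKK1,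
    interior_subset.trans hK1X, ?_⟩
  · have hχs : ContDiff ℝ ∞ (fun x => (χ x : ℂ)) :=
      Complex.ofRealCLM.contDiff.comp (contMDiff_iff_contDiff.1 χ.contMDiff)
    rw [contDiff_iff_contDiffAt]
    intro x
    by_cases hx : x ∈ X
    · exact hχs.contDiffAt.mul (hf.contDiffAt (hX.mem_nhds hx))
    · have : (fun x => (χ x : ℂ) * f x) =ᶠ[𝓝 x] fun _ => 0 := by
        have : K2ᶜ ∈ 𝓝 x := hK2.isClosed.isOpen_compl.mem_nhds fun h => hx (hK2X h)
        filter_upwards [this] with y hy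
        have : χ y = 0 := hχ0 (fun h => hy (interior_subset h))
        simp [this]
      exact (contDiffAt_const (c := (0:ℂ))).congr_of_eventuallyEq this
  · intro x hx
    have : χ x = 1 := hχ1 (interior_subset hx)
    simp [this]
end words
end
end Module1

section Module2
open scoped ContDiff Topology SchwartzMap FourierTransform LineDeriv
open MeasureTheory Filter Set
noncomputable section
section fourier
variable {d : ℕ}

def SDW (I : List (Fin d)) (f : 𝓢(Eu d, ℂ)) : 𝓢(Eu d, ℂ) :=
  I.foldr (fun i g => ∂_{(EuclideanSpace.single i (1:ℝ) : Eu d)} g) f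

lemma SDW_coe (I : List (Fin d)) (f : 𝓢(Eu d, ℂ)) : (SDW I f : Eu d → ℂ) = DW I f := by
  induction I with
  | nil => rfl
  | cons i I ih =>
    funext x
    rw [DW_cons, ← ih]
    rfl

lemma fourier_SDW (I : List (Fin d)) (f : 𝓢(Eu d, ℂ)) (ξ : Eu d) :
    (𝓕 (SDW I f)) ξ = (I.map fun i => (2 * Real.pi * Complex.I * (ξ i : ℂ))).prod * (𝓕 f) ξ := by
  induction I with
  | nil => simp [SDW]
  | cons i I ih =>
    have h : SDW (i :: I) f = ∂_{(EuclideanSpace.single i (1:ℝ) : Eu d)} (SDW I f) := rfl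
    rw [h, SchwartzMap.fourier_lineDerivOp_eq]
    have hg : (fun x : Eu d => inner ℝ x (EuclideanSpace.single i (1:ℝ))).HasTemperateGrowth := by
      fun_prop
    rw [_root_.smul_apply, SchwartzMap.smulLeftCLM_apply_apply hg, ih]
    simp [EuclideanSpace.inner_single_right]
    ring

def SPD (Q : MvPolynomial (Fin d) ℂ) (f : 𝓢(Eu d, ℂ)) : 𝓢(Eu d, ℂ) :=
  ∑ α ∈ Q.support, Q.coeff α • SDW (word α) f

lemma SPD_coe (Q : MvPolynomial (Fin d) ℂ) (f : 𝓢(Eu d, ℂ)) :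
    (SPD Q f : Eu d → ℂ) = PDop Q f := by
  funext x
  rw [PDop_eq, SPD]
  simp [← SDW_coe]

lemma prod_word {R : Type*} [CommMonoid R] (α : Fin d → ℕ) (g : Fin d → R) :
    ((word α).map g).prod = ∏ i, g i ^ α i := by
  rw [Fin.prod_univ_def]
  unfold word wordL
  induction List.finRange d with
  | nil => simp
  | cons i l ih => simp [ih]

lemma fourier_SPD (Q : MvPolynomial (Fin d) ℂ) (f : 𝓢(Eu d, ℂ)) (ξ : Eu d) :
    (𝓕 (SPD Q f)) ξ =
      MvPolynomial.eval (fun i => (2 * Real.pi * Complex.I * (ξ i : ℂ))) Q * (𝓕 f) ξ := by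
  have : 𝓕 (SPD Q f) = ∑ α ∈ Q.support, Q.coeff α • 𝓕 (SDW (word α) f) := by
    unfold SPD
    rw [FourierTransform.fourier_sum]
    exact Finset.sum_congr rfl fun α _ => FourierTransform.fourier_smul _ _
  rw [this]
  simp only [_root_.sum_apply, _root_.smul_apply, fourier_SDW, prod_word, smul_eq_mul]
  rw [MvPolynomial.eval_eq', Finset.sum_mul]
  exact Finset.sum_congr rfl fun α _ => by ring

lemma eval_homog_smul {Q : MvPolynomial (Fin d) ℂ} {m : ℕ} (hQ : Q.IsHomogeneous m) (t : ℂ)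
    (z : Fin d → ℂ) :
    MvPolynomial.eval (fun i => t * z i) Q = t ^ m * MvPolynomial.eval z Q := by
  rw [MvPolynomial.eval_eq', MvPolynomial.eval_eq', Finset.mul_sum]
  refine Finset.sum_congr rfl fun α hα => ?_
  have h : ∑ i, α i = m := by
    have := hQ (MvPolynomial.mem_support_iff.1 hα)
    rw [← this]
    simp [Finsupp.weight_apply, Finsupp.sum_fintype]
  simp only [mul_pow, Finset.prod_mul_distrib]
  rw [Finset.prod_pow_eq_pow_sum, h]
  ring

/-- the principal part -/
def ppart (P : MvPolynomial (Fin d) ℂ) : MvPolynomial (Fin d) ℂ :=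
  MvPolynomial.homogeneousComponent P.totalDegree P

lemma ppart_homog (P : MvPolynomial (Fin d) ℂ) : (ppart P).IsHomogeneous P.totalDegree :=
  MvPolynomial.homogeneousComponent_isHomogeneous _ _

lemma elliptic_lower {P : MvPolynomial (Fin d) ℂ} (hell : IsElliptic P)
    (hm : 1 ≤ P.totalDegree) :
    ∃ C : ℝ, 0 < C ∧ ∀ ξ : Eu d, ‖ξ‖ ^ P.totalDegree ≤
      C * ‖MvPolynomial.eval (fun i => (ξ i : ℂ)) (ppart P)‖ := by
  have hcont : Continuous fun ξ : Eu d =>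
      ‖MvPolynomial.eval (fun i => (ξ i : ℂ)) (ppart P)‖ := by
    refine continuous_norm.comp ?_
    exact (MvPolynomial.continuous_eval (ppart P)).comp (by fun_prop)
  have hpos : ∀ ξ ∈ Metric.sphere (0 : Eu d) 1,
      0 < ‖MvPolynomial.eval (fun i => (ξ i : ℂ)) (ppart P)‖ := by
    intro ξ hξ
    rw [norm_pos_iff]
    refine hell (fun i => ξ i) ?_
    intro h
    have : ξ = 0 := by ext i; simpa using congrFun h i
    simp [this] at hξ
  obtain ⟨c, hc, hcle⟩ : ∃ c : ℝ, 0 < c ∧ ∀ ξ ∈ Metric.sphere (0 : Eu d) 1,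
      c ≤ ‖MvPolynomial.eval (fun i => (ξ i : ℂ)) (ppart P)‖ := by
    rcases (Metric.sphere (0 : Eu d) 1).eq_empty_or_nonempty with he | hne
    · exact ⟨1, one_pos, by simp [he]⟩
    · obtain ⟨ξ0, h0, hmin⟩ := (isCompact_sphere (0 : Eu d) 1).exists_isMinOn hne hcont.continuousOn
      exact ⟨_, hpos ξ0 h0, fun ξ hξ => hmin hξ⟩
  refine ⟨c⁻¹, inv_pos.2 hc, fun ξ => ?_⟩
  rw [inv_mul_eq_div, le_div_iff₀ hc]
  rcases eq_or_ne ξ 0 with rfl | hξ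
  · rw [norm_zero, zero_pow (by omega)]; simp
  have hn : ‖ξ‖ ≠ 0 := by simpa using hξ
  have h1 := hcle (‖ξ‖⁻¹ • ξ) (by simp [norm_smul, hn])
  have h2 : (fun i => (ξ i : ℂ)) = fun i => (‖ξ‖ : ℂ) * (((‖ξ‖⁻¹ • ξ) i : ℝ) : ℂ) := by
    funext i
    have : (‖ξ‖ : ℂ) ≠ 0 := by exact_mod_cast hn
    simp
    field_simp
  rw [h2, eval_homog_smul (ppart_homog P), norm_mul, norm_pow, Complex.norm_real, norm_norm]
  gcongr

lemma norm_prod_word_le (J : List (Fin d)) (ξ : Eu d) :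
    ‖(J.map fun i => (2 * Real.pi * Complex.I * (ξ i : ℂ))).prod‖ ≤
      (2 * Real.pi * ‖ξ‖) ^ J.length := by
  induction J with
  | nil => simp
  | cons i J ih =>
    rw [List.map_cons, List.prod_cons, norm_mul, List.length_cons, pow_succ']
    gcongr
    simp only [norm_mul, Complex.norm_real, Complex.norm_I, Complex.norm_ofNat, mul_one]
    rw [Real.norm_of_nonneg Real.pi_pos.le]
    gcongr
    exact PiLp.norm_apply_le ξ i

lemma schwartz_integrable_sq (f : 𝓢(Eu d, ℂ)) : Integrable fun x => ‖f x‖ ^ 2 := by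
  have := (f.memLp 2 volume).integrable_norm_pow (by norm_num)
  simpa using this

theorem coercive {P : MvPolynomial (Fin d) ℂ} (hell : IsElliptic P)
    (hm : 1 ≤ P.totalDegree) :
    ∃ C : ℝ, 0 < C ∧ ∀ w : Eu d → ℂ, ContDiff ℝ ∞ w → HasCompactSupport w →
      ∀ J : List (Fin d), J.length = P.totalDegree →
      ∫ x, ‖DW J w x‖ ^ 2 ≤ C * ∫ x, ‖PDop (ppart P) w x‖ ^ 2 := by
  obtain ⟨C, hC, hb⟩ := elliptic_lower hell hm
  refine ⟨C ^ 2, by positivity, fun w hw hc J hJ => ?_⟩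
  set f : 𝓢(Eu d, ℂ) := hc.toSchwartzMap hw with hf
  have hfw : (f : Eu d → ℂ) = w := rfl
  have e1 : DW J w = (SDW J f : Eu d → ℂ) := by rw [SDW_coe]; rfl
  have e2 : PDop (ppart P) w = (SPD (ppart P) f : Eu d → ℂ) := by rw [SPD_coe]; rfl
  rw [e1, e2, ← SchwartzMap.integral_norm_sq_fourier (SDW J f),
    ← SchwartzMap.integral_norm_sq_fourier (SPD (ppart P) f), ← integral_const_mul]
  refine integral_mono (schwartz_integrable_sq _) ((schwartz_integrable_sq _).const_mul _) ?_
  intro ξ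
  simp only
  rw [← mul_pow]
  gcongr
  rw [fourier_SDW, fourier_SPD, norm_mul, norm_mul, ← mul_assoc]
  gcongr
  refine (norm_prod_word_le J ξ).trans ?_
  rw [eval_homog_smul (ppart_homog P), norm_mul, norm_pow, hJ, mul_pow]
  have : ‖(2 * Real.pi * Complex.I : ℂ)‖ = 2 * Real.pi := by
    simp [Real.pi_pos.le]
  rw [this]
  have h3 := hb ξ
  have h4 : 0 ≤ (2 * Real.pi) ^ P.totalDegree := by positivity
  nlinarith [mul_le_mul_of_nonneg_left h3 h4]

theorem sobolev (d : ℕ) : ∃ C : ℝ, 0 < C ∧ ∀ w : Eu d → ℂ, ContDiff ℝ ∞ w → HasCompactSupport w →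
    ∀ A : ℝ, (∀ J : List (Fin d), J.length ≤ d + 1 → ∫ x, ‖DW J w x‖ ≤ A) →
    ∀ x, ‖w x‖ ≤ C * A := by
  have hintg : Integrable (fun ξ : Eu d => (1 + ‖ξ‖) ^ (-((d:ℝ) + 1))) :=
    integrable_one_add_norm (by simp)
  set B : ℝ := ∫ ξ : Eu d, (1 + ‖ξ‖) ^ (-((d:ℝ) + 1)) with hB
  have hB0 : 0 ≤ B := integral_nonneg fun ξ => by positivity
  refine ⟨(2 * ((d:ℝ) + 1)) ^ (d + 1) * (B + 1), by positivity, fun w hw hc A hA x => ?_⟩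
  set f : 𝓢(Eu d, ℂ) := hc.toSchwartzMap hw with hf
  have hA0 : 0 ≤ A := (integral_nonneg fun _ => norm_nonneg _).trans (hA [] (by simp))
  have hF : ∀ J : List (Fin d), J.length ≤ d + 1 → ∀ ξ, ‖(𝓕 (SDW J f)) ξ‖ ≤ A := by
    intro J hJ ξ
    refine le_trans ?_ (hA J hJ)
    have e1 : DW J w = (SDW J f : Eu d → ℂ) := by rw [SDW_coe]; rfl
    rw [e1, SchwartzMap.fourier_coe]
    exact VectorFourier.norm_fourierIntegral_le_integral_norm _ _ _ _ _
  have hdec : ∀ ξ, ‖(𝓕 f) ξ‖ ≤ (2 * ((d:ℝ) + 1)) ^ (d + 1) * A * (1 + ‖ξ‖) ^ (-((d:ℝ) + 1)) := by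
    intro ξ
    have hr : (1 + ‖ξ‖) ^ (-((d:ℝ) + 1)) = ((1 + ‖ξ‖) ^ (d + 1))⁻¹ := by
      rw [Real.rpow_neg (by positivity)]
      norm_cast
    rw [hr, ← div_eq_mul_inv, le_div_iff₀ (by positivity)]
    have h0 := hF [] (by simp) ξ
    have h0' : ‖(𝓕 f) ξ‖ ≤ A := h0
    rcases le_total ‖ξ‖ 1 with h1 | h1
    · calc ‖(𝓕 f) ξ‖ * (1 + ‖ξ‖) ^ (d + 1) ≤ A * (2 * ((d:ℝ) + 1)) ^ (d + 1) := by
            gcongr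
            nlinarith [(Nat.cast_nonneg d : (0:ℝ) ≤ d)]
        _ = _ := by ring
    · obtain ⟨i, hi⟩ : ∃ i, ‖ξ‖ ≤ (d + 1) * ‖ξ i‖ := by
        by_contra! hcon
        have h2 : ‖ξ‖ ≤ ∑ i, ‖ξ i‖ := by
          have hx : ξ = ∑ i, ξ i • (EuclideanSpace.single i (1:ℝ) : Eu d) := by
            ext j; simp [Pi.single_apply]
          conv_lhs => rw [hx]
          refine (norm_sum_le _ _).trans (Finset.sum_le_sum fun i _ => ?_)
          simp [norm_smul]
        have h3 : ∑ i, ‖ξ i‖ ≤ ∑ i : Fin d, ‖ξ‖ / (d + 1) := by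
          refine Finset.sum_le_sum fun i _ => ?_
          rw [le_div_iff₀ (by positivity)]
          linarith [hcon i]
        simp at h3
        have h4 : (d:ℝ) * (‖ξ‖ / (d + 1)) < ‖ξ‖ := by
          rw [mul_div_assoc', div_lt_iff₀ (by positivity)]
          nlinarith
        have h2' : ‖ξ‖ ≤ ∑ i, |ξ i| := h2
        linarith
      have h5 := hF (List.replicate (d+1) i) (by simp) ξ
      rw [fourier_SDW, norm_mul, List.map_replicate, List.prod_replicate, norm_pow] at h5
      have h6 : ‖ξ i‖ ≤ ‖(2 * Real.pi * Complex.I * (ξ i : ℂ))‖ := by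
        simp only [norm_mul, Complex.norm_real, Complex.norm_I, Complex.norm_ofNat, mul_one]
        rw [Real.norm_of_nonneg Real.pi_pos.le]
        nlinarith [Real.pi_gt_three, norm_nonneg (ξ i)]
      calc ‖(𝓕 f) ξ‖ * (1 + ‖ξ‖) ^ (d + 1)
          ≤ ‖(𝓕 f) ξ‖ * (2 * ((d + 1) * ‖(2 * Real.pi * Complex.I * (ξ i : ℂ))‖)) ^ (d + 1) := by
            gcongr
            have := mul_le_mul_of_nonneg_left h6 (by positivity : (0:ℝ) ≤ d + 1)
            linarith
        _ = (2 * ((d:ℝ) + 1)) ^ (d + 1) *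
            (‖(2 * Real.pi * Complex.I * (ξ i : ℂ))‖ ^ (d + 1) * ‖(𝓕 f) ξ‖) := by
            rw [← mul_assoc 2, mul_pow]; ring
        _ ≤ _ := by gcongr
  have hx : w x = (𝓕⁻ (𝓕 f)) x := by
    rw [FourierTransform.fourierInv_fourier_eq]; rfl
  rw [hx, SchwartzMap.fourierInv_coe]
  have h7 : ‖𝓕⁻ ((𝓕 f : 𝓢(Eu d, ℂ)) : Eu d → ℂ) x‖ ≤ ∫ ξ, ‖(𝓕 f) ξ‖ :=
    VectorFourier.norm_fourierIntegral_le_integral_norm _ _ _ _ _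
  refine h7.trans ?_
  calc ∫ ξ, ‖(𝓕 f) ξ‖ ≤ ∫ ξ : Eu d, (2 * ((d:ℝ) + 1)) ^ (d + 1) * A * (1 + ‖ξ‖) ^ (-((d:ℝ) + 1)) :=
        integral_mono (𝓕 f).integrable.norm (hintg.const_mul _) hdec
    _ = (2 * ((d:ℝ) + 1)) ^ (d + 1) * A * B := by rw [integral_const_mul]
    _ ≤ (2 * ((d:ℝ) + 1)) ^ (d + 1) * (B + 1) * A := by
      have : 0 ≤ (2 * ((d:ℝ) + 1)) ^ (d + 1) * A := by positivity
      nlinarith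
end fourier
end
end Module2

section Module3
open scoped ContDiff Topology
open MeasureTheory Filter Set
noncomputable section
section onestep
variable {d : ℕ}

/-- closed ball with squared radius `c` -/
def Om (x0 : Eu d) (c : ℝ) : Set (Eu d) := {x | ‖x - x0‖ ^ 2 ≤ c}

lemma Om_closed (x0 : Eu d) (c : ℝ) : IsClosed (Om x0 c) :=
  isClosed_le (by fun_prop) continuous_const

lemma Om_mono (x0 : Eu d) {c c' : ℝ} (h : c ≤ c') : Om x0 c ⊆ Om x0 c' :=
  fun _ hx => le_trans hx h

lemma Om_compact (x0 : Eu d) (c : ℝ) : IsCompact (Om x0 c) := by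
  refine (isCompact_closedBall x0 (|c| + 1)).of_isClosed_subset (Om_closed x0 c) fun x hx => ?_
  rw [mem_closedBall_iff_norm]
  have : ‖x - x0‖ ^ 2 ≤ |c| := le_trans hx (le_abs_self c)
  nlinarith [norm_nonneg (x - x0), abs_nonneg c]

lemma smoothTransition_bound (m : ℕ) : ∃ C : ℝ, 1 ≤ C ∧ ∀ i ≤ m, ∀ t : ℝ,
    ‖iteratedFDeriv ℝ i (fun t : ℝ => ((Real.smoothTransition t : ℝ) : ℂ)) t‖ ≤ C := by
  set θ : ℝ → ℂ := fun t => ((Real.smoothTransition t : ℝ) : ℂ) with hθ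
  have hs : ContDiff ℝ ∞ θ := Complex.ofRealCLM.contDiff.comp Real.smoothTransition.contDiff
  have h1 : ∀ i : ℕ, ∃ C : ℝ, ∀ t, ‖iteratedFDeriv ℝ i θ t‖ ≤ C := by
    intro i
    have hc : Continuous (fun t => ‖iteratedFDeriv ℝ i θ t‖) :=
      (hs.continuous_iteratedFDeriv (by exact_mod_cast le_top)).norm
    obtain ⟨C, hC⟩ := (isCompact_Icc (a := (-1:ℝ)) (b := 2)).exists_bound_of_continuousOn
      hc.continuousOn
    refine ⟨max C 1, fun t => ?_⟩
    by_cases ht : t ∈ Icc (-1:ℝ) 2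
    · have := hC t ht
      rw [norm_norm] at this
      exact this.trans (le_max_left _ _)
    · have hcst : ∃ a : ℂ, ‖a‖ ≤ 1 ∧ θ =ᶠ[𝓝 t] fun _ => a := by
        rcases lt_or_ge t 0 with h | h
        · refine ⟨0, by simp, ?_⟩
          filter_upwards [Iio_mem_nhds h] with s hs
          simp [hθ, Real.smoothTransition.zero_of_nonpos (le_of_lt hs)]
        · have h2 : 1 < t := by
            by_contra hcon
            exact ht ⟨by linarith, by linarith⟩
          refine ⟨1, by simp, ?_⟩
          filter_upwards [Ioi_mem_nhds h2] with s hs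
          simp [hθ, Real.smoothTransition.one_of_one_le (le_of_lt hs)]
      obtain ⟨a, ha, hev⟩ := hcst
      rw [(hev.iteratedFDeriv ℝ i).self_of_nhds]
      refine le_trans ?_ (le_max_right _ _)
      rcases Nat.eq_zero_or_pos i with rfl | hi
      · simpa using ha
      · rw [iteratedFDeriv_const_of_ne (by omega)]; simp
  choose C hC using h1
  refine ⟨1 + ∑ i ∈ Finset.range (m + 1), |C i|, ?_, fun i hi t => ?_⟩
  · have : 0 ≤ ∑ i ∈ Finset.range (m + 1), |C i| := Finset.sum_nonneg fun _ _ => abs_nonneg _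
    linarith
  · have : |C i| ≤ ∑ i ∈ Finset.range (m + 1), |C i| :=
      Finset.single_le_sum (f := fun i => |C i|) (fun _ _ => abs_nonneg _)
        (Finset.mem_range.2 (by omega))
    linarith [hC i t, le_abs_self (C i)]

lemma normsq_bound (x0 : Eu d) (m : ℕ) : ∃ C : ℝ, 1 ≤ C ∧ ∀ i ≤ m, ∀ x ∈ Om x0 1,
    ‖iteratedFDeriv ℝ i (fun x => ‖x - x0‖ ^ 2) x‖ ≤ C := by
  have hs : ContDiff ℝ ∞ (fun x : Eu d => ‖x - x0‖ ^ 2) :=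
    (contDiff_id.sub contDiff_const).norm_sq ℝ
  have h1 : ∀ i : ℕ, ∃ C : ℝ, ∀ x ∈ Om x0 1,
      ‖iteratedFDeriv ℝ i (fun x : Eu d => ‖x - x0‖ ^ 2) x‖ ≤ C := by
    intro i
    exact (Om_compact x0 1).exists_bound_of_continuousOn
      (hs.continuous_iteratedFDeriv (by exact_mod_cast le_top)).continuousOn
  choose C hC using h1
  refine ⟨1 + ∑ i ∈ Finset.range (m + 1), |C i|, ?_, fun i hi t ht => ?_⟩
  · have : 0 ≤ ∑ i ∈ Finset.range (m + 1), |C i| := Finset.sum_nonneg fun _ _ => abs_nonneg _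
    linarith
  · have : |C i| ≤ ∑ i ∈ Finset.range (m + 1), |C i| :=
      Finset.single_le_sum (f := fun i => |C i|) (fun _ _ => abs_nonneg _)
        (Finset.mem_range.2 (by omega))
    linarith [hC i t ht, le_abs_self (C i)]

lemma cutoff (x0 : Eu d) (m : ℕ) : ∃ C : ℝ, 1 ≤ C ∧ ∀ δ c : ℝ, 0 < δ → δ ≤ 1 → c ≤ 1 →
    ∃ χ : Eu d → ℂ, ContDiff ℝ ∞ χ ∧ (∀ x, ‖χ x‖ ≤ 1) ∧ (tsupport χ ⊆ Om x0 c) ∧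
      (∀ x, ‖x - x0‖ ^ 2 < c - δ / 2 → χ x = 1) ∧
      ∀ i, 1 ≤ i → i ≤ m → ∀ x ∈ Om x0 c, ‖iteratedFDeriv ℝ i χ x‖ ≤ C * (δ⁻¹) ^ i := by
  obtain ⟨A, hA1, hA⟩ := smoothTransition_bound m
  obtain ⟨B, hB1, hB⟩ := normsq_bound x0 m
  refine ⟨m.factorial * A * (2 * B) ^ m, ?_, fun δ c hδ hδ1 hc => ?_⟩
  · have h1 : (1:ℝ) ≤ m.factorial := by exact_mod_cast Nat.factorial_pos m
    have h2 : (1:ℝ) ≤ (2 * B) ^ m := one_le_pow₀ (by linarith)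
    nlinarith [mul_le_mul h1 hA1 (by norm_num) (by linarith)]
  set θ : ℝ → ℂ := fun t => ((Real.smoothTransition t : ℝ) : ℂ) with hθ
  have hθs : ContDiff ℝ ∞ θ := Complex.ofRealCLM.contDiff.comp Real.smoothTransition.contDiff
  set q : Eu d → ℝ := fun x => ‖x - x0‖ ^ 2 with hq
  have hqs : ContDiff ℝ ∞ q := (contDiff_id.sub contDiff_const).norm_sq ℝ
  set f : Eu d → ℝ := fun x => (2 * δ⁻¹) • (c - q x) with hf
  have hfs : ContDiff ℝ ∞ f := by
    have h0 : ContDiff ℝ ∞ fun x => c - q x := contDiff_const.sub hqs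
    exact h0.const_smul (2 * δ⁻¹)
  refine ⟨θ ∘ f, hθs.comp hfs, fun x => ?_, ?_, fun x hx => ?_, fun i hi him x hx => ?_⟩
  · simp only [Function.comp, hθ, Complex.norm_real, Real.norm_eq_abs]
    rw [abs_of_nonneg (Real.smoothTransition.nonneg _)]
    exact Real.smoothTransition.le_one _
  · refine closure_minimal ?_ (Om_closed x0 c)
    intro x hx
    by_contra hcon
    simp only [Om, mem_setOf_eq, not_le] at hcon
    apply hx
    simp only [Function.comp, hθ, hf, hq]
    rw [Real.smoothTransition.zero_of_nonpos]
    · simp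
    · rw [smul_eq_mul]
      exact mul_nonpos_of_nonneg_of_nonpos (by positivity) (by linarith)
  · simp only [Function.comp, hθ, hf, hq]
    rw [Real.smoothTransition.one_of_one_le]
    · simp
    · rw [smul_eq_mul]
      have : δ / 2 < c - ‖x - x0‖ ^ 2 := by linarith
      calc (1:ℝ) = 2 * δ⁻¹ * (δ / 2) := by field_simp
        _ ≤ _ := by gcongr
  · have hx1 : x ∈ Om x0 1 := Om_mono x0 hc hx
    have key := norm_iteratedFDeriv_comp_le (g := θ) (f := f) (n := i) (N := ∞) hθs hfs
      (by exact_mod_cast le_top) x (C := A) (D := 2 * B * δ⁻¹)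
      (fun j hj => hA j (hj.trans him) _) (fun j hj1 hj => by
        have h1 : iteratedFDeriv ℝ j f x = (2 * δ⁻¹) • (- iteratedFDeriv ℝ j q x) := by
          have hfe : f = (2 * δ⁻¹) • ((fun _ => c) + (-q)) := by
            funext y; simp [hf, sub_eq_add_neg]
          have hqj : ContDiff ℝ j q := hqs.of_le (by exact_mod_cast le_top)
          rw [hfe, iteratedFDeriv_const_smul_apply, iteratedFDeriv_add_apply,
            iteratedFDeriv_const_of_ne (by omega), iteratedFDeriv_neg_apply]
          · simp
          · exact contDiffAt_const
          · exact hqj.neg.contDiffAt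
          · exact contDiffAt_const.add hqj.neg.contDiffAt
        rw [h1, norm_smul, norm_neg, Real.norm_of_nonneg (by positivity)]
        have h2 := hB j (hj.trans him) x hx1
        have h3 : (1:ℝ) ≤ 2 * B * δ⁻¹ := by
          have : 1 ≤ δ⁻¹ := (one_le_inv₀ hδ).2 hδ1
          nlinarith
        calc 2 * δ⁻¹ * ‖iteratedFDeriv ℝ j q x‖ ≤ 2 * δ⁻¹ * B := by gcongr
          _ = (2 * B * δ⁻¹) ^ 1 := by ring
          _ ≤ _ := pow_le_pow_right₀ h3 hj1)
    refine key.trans ?_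
    rw [mul_pow, ← mul_assoc]
    gcongr
    linarith

end onestep
end
end Module3

section Module4
open scoped ContDiff Topology
open MeasureTheory Filter Set
noncomputable section
section onestep
variable {d : ℕ}

lemma PDop_ppart_eq (P : MvPolynomial (Fin d) ℂ) (f : Eu d → ℂ) (x : Eu d) :
    PDop (ppart P) f x = ∑ α ∈ P.support,
      (if ∑ i, α i = P.totalDegree then P.coeff α else 0) * DW (word α) f x := by
  have hc : ∀ α, (ppart P).coeff α = if ∑ i, α i = P.totalDegree then P.coeff α else 0 := by
    intro α
    unfold ppart
    rw [MvPolynomial.coeff_homogeneousComponent]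
    have : Finsupp.degree α = ∑ i, α i := by
      rw [Finsupp.degree_eq_sum]
    rw [this]
  rw [PDop_eq]
  simp only [← hc]
  refine Finset.sum_subset ?_ ?_
  · intro α hα
    rw [MvPolynomial.mem_support_iff] at hα ⊢
    intro h
    apply hα
    rw [hc, h]; simp
  · intro α _ hα
    rw [MvPolynomial.notMem_support_iff.1 hα]; simp

lemma sum_le_totalDegree {P : MvPolynomial (Fin d) ℂ} {α : Fin d →₀ ℕ} (h : α ∈ P.support) :
    ∑ i, α i ≤ P.totalDegree := by
  have := MvPolynomial.le_totalDegree h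
  simpa [Finsupp.sum_fintype] using this

def coefS (P : MvPolynomial (Fin d) ℂ) : ℝ := ∑ α ∈ P.support, ‖P.coeff α‖

lemma coefS_nonneg (P : MvPolynomial (Fin d) ℂ) : 0 ≤ coefS P :=
  Finset.sum_nonneg fun _ _ => norm_nonneg _

lemma pointwise_comm (P : MvPolynomial (Fin d) ℂ) {χ v : Eu d → ℂ} (hχ : ContDiff ℝ ∞ χ)
    (hv : ContDiff ℝ ∞ v) (x : Eu d) {δ C : ℝ} (hδ : 0 < δ) (hδ1 : δ ≤ 1) (hC : 1 ≤ C)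
    (h1 : ‖χ x‖ ≤ 1) (hD : ∀ i, 1 ≤ i → i ≤ P.totalDegree →
      ‖iteratedFDeriv ℝ i χ x‖ ≤ C * (δ⁻¹) ^ i) :
    δ ^ P.totalDegree * ‖PDop (ppart P) (fun y => χ y * v y) x‖ ≤
      δ ^ P.totalDegree * ‖PDop P v x‖ + coefS P * (1 + 2 ^ P.totalDegree * C) *
        ∑ j ∈ Finset.range P.totalDegree, δ ^ j * ‖iteratedFDeriv ℝ j v x‖ := by
  set m := P.totalDegree with hm
  set S := ∑ j ∈ Finset.range m, δ ^ j * ‖iteratedFDeriv ℝ j v x‖ with hS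
  have hS0 : 0 ≤ S := Finset.sum_nonneg fun _ _ => by positivity
  set η : Eu d → ℂ := fun y => χ y - χ x with hη
  have hηs : ContDiff ℝ ∞ η := hχ.sub contDiff_const
  -- commutator words
  have hcomm : ∀ J : List (Fin d), J.length = m →
      δ ^ m * ‖DW J (fun y => χ y * v y) x - χ x * DW J v x‖ ≤ 2 ^ m * C * S := by
    intro J hJ
    have e : (fun y => v y * η y) = fun y => χ y * v y - χ x * v y := by
      funext y; simp only [hη]; ring
    have e2 : DW J (fun y => v y * η y) x = DW J (fun y => χ y * v y) x - χ x * DW J v x := by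
      rw [e, DW_sub (hχ.mul hv) (contDiff_const.mul hv), DW_const_mul hv]
    rw [← e2]
    have hb := norm_DW_le (hv.mul hηs) J x
    rw [hJ] at hb
    have hb2 := norm_iteratedFDeriv_mul_le (N := ∞) hv hηs x (n := m) (by exact_mod_cast le_top)
    rw [Finset.sum_range_succ] at hb2
    have hz : ‖iteratedFDeriv ℝ (m - m) η x‖ = 0 := by
      rw [Nat.sub_self, norm_iteratedFDeriv_zero]; simp [hη]
    rw [hz, mul_zero, add_zero] at hb2
    calc δ ^ m * ‖DW J (fun y => v y * η y) x‖
        ≤ δ ^ m * ∑ i ∈ Finset.range m, (m.choose i : ℝ) * ‖iteratedFDeriv ℝ i v x‖ *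
          ‖iteratedFDeriv ℝ (m - i) η x‖ := by gcongr; exact hb.trans hb2
      _ ≤ 2 ^ m * C * S := by
        rw [hS, Finset.mul_sum, Finset.mul_sum]
        refine Finset.sum_le_sum fun i hi => ?_
        have hi' := Finset.mem_range.1 hi
        have hηχ : iteratedFDeriv ℝ (m - i) η x = iteratedFDeriv ℝ (m - i) χ x := by
          have : η = χ - fun _ => χ x := rfl
          have hχj : ContDiff ℝ ((m - i : ℕ) : WithTop ℕ∞) χ := contDiff_infty.1 hχ _
          rw [this, iteratedFDeriv_sub_apply hχj.contDiffAt contDiffAt_const,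
            iteratedFDeriv_const_of_ne (by omega)]
          simp
        have hch : (m.choose i : ℝ) ≤ 2 ^ m := by
          exact_mod_cast Nat.choose_le_two_pow m i
        have hDi := hD (m - i) (by omega) (by omega)
        have hpow : δ ^ m * (δ⁻¹) ^ (m - i) = δ ^ i := by
          have : δ ^ m = δ ^ i * δ ^ (m - i) := by rw [← pow_add]; congr 1; omega
          rw [this, inv_pow, mul_assoc, mul_inv_cancel₀ (by positivity), mul_one]
        rw [hηχ]
        calc δ ^ m * ((m.choose i : ℝ) * ‖iteratedFDeriv ℝ i v x‖ *
                ‖iteratedFDeriv ℝ (m - i) χ x‖)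
            ≤ δ ^ m * (2 ^ m * ‖iteratedFDeriv ℝ i v x‖ * (C * (δ⁻¹) ^ (m - i))) := by gcongr
          _ = 2 ^ m * C * ((δ ^ m * (δ⁻¹) ^ (m - i)) * ‖iteratedFDeriv ℝ i v x‖) := by ring
          _ = _ := by rw [hpow]
  -- low order words
  have hlow : ∀ J : List (Fin d), J.length < m → δ ^ m * ‖DW J v x‖ ≤ S := by
    intro J hJ
    calc δ ^ m * ‖DW J v x‖ ≤ δ ^ J.length * ‖iteratedFDeriv ℝ J.length v x‖ := by
          gcongr ?_ * ?_
          · exact pow_le_pow_of_le_one hδ.le hδ1 hJ.le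
          · exact norm_DW_le hv J x
      _ ≤ S := Finset.single_le_sum (f := fun j => δ ^ j * ‖iteratedFDeriv ℝ j v x‖)
          (fun _ _ => by positivity) (Finset.mem_range.2 hJ)
  have hdec : PDop (ppart P) (fun y => χ y * v y) x = χ x * PDop P v x +
      ∑ α ∈ P.support, P.coeff α * (if ∑ i, α i = m then
        (DW (word α) (fun y => χ y * v y) x - χ x * DW (word α) v x) else
        - (χ x * DW (word α) v x)) := by
    rw [PDop_ppart_eq, PDop_eq, Finset.mul_sum, ← Finset.sum_add_distrib]
    refine Finset.sum_congr rfl fun α _ => ?_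
    split_ifs <;> ring
  rw [hdec]
  calc δ ^ m * ‖χ x * PDop P v x + ∑ α ∈ P.support, P.coeff α * (if ∑ i, α i = m then
        (DW (word α) (fun y => χ y * v y) x - χ x * DW (word α) v x) else
        - (χ x * DW (word α) v x))‖
      ≤ δ ^ m * (‖PDop P v x‖ + ∑ α ∈ P.support, ‖P.coeff α‖ * ‖(if ∑ i, α i = m then
        (DW (word α) (fun y => χ y * v y) x - χ x * DW (word α) v x) else
        - (χ x * DW (word α) v x))‖) := by
        gcongr
        refine (norm_add_le _ _).trans ?_
        gcongr ?_ + ?_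
        · rw [norm_mul]
          exact mul_le_of_le_one_left (norm_nonneg _) h1
        · refine (norm_sum_le _ _).trans (le_of_eq ?_)
          simp only [norm_mul]
    _ = δ ^ m * ‖PDop P v x‖ + ∑ α ∈ P.support, ‖P.coeff α‖ * (δ ^ m * ‖(if ∑ i, α i = m then
        (DW (word α) (fun y => χ y * v y) x - χ x * DW (word α) v x) else
        - (χ x * DW (word α) v x))‖) := by
        rw [mul_add, Finset.mul_sum]
        congr 1
        exact Finset.sum_congr rfl fun α _ => by ring
    _ ≤ δ ^ m * ‖PDop P v x‖ + ∑ α ∈ P.support, ‖P.coeff α‖ * ((1 + 2 ^ m * C) * S) := by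
        refine add_le_add le_rfl (Finset.sum_le_sum fun α hα =>
          mul_le_mul_of_nonneg_left ?_ (norm_nonneg _))
        split_ifs with h
        · refine (hcomm (word α) (by rw [length_word, h])).trans ?_
          nlinarith
        · have hlt : ∑ i, α i < m := lt_of_le_of_ne (sum_le_totalDegree hα) h
          rw [norm_neg, norm_mul]
          calc δ ^ m * (‖χ x‖ * ‖DW (word α) v x‖) ≤ δ ^ m * (1 * ‖DW (word α) v x‖) := by gcongr
            _ = δ ^ m * ‖DW (word α) v x‖ := by ring
            _ ≤ S := hlow _ (by rw [length_word]; exact hlt)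
            _ ≤ _ := by
              have : 0 ≤ 2 ^ m * C * S := by positivity
              linarith
    _ = _ := by rw [← Finset.sum_mul, coefS]; ring

lemma integrableOn_Om {f : Eu d → ℝ} (hf : Continuous f) (x0 : Eu d) (c : ℝ) :
    IntegrableOn f (Om x0 c) := hf.continuousOn.integrableOn_compact (Om_compact x0 c)

theorem onestep {P : MvPolynomial (Fin d) ℂ} (hell : IsElliptic P)
    (hm : 1 ≤ P.totalDegree) (x0 : Eu d) :
    ∃ C : ℝ, 1 ≤ C ∧ ∀ u : Eu d → ℂ, ContDiff ℝ ∞ u → ∀ δ c : ℝ, 0 < δ → δ ≤ 1 → c ≤ 1 →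
      ∀ (l : ℕ) (T : ℝ),
      (∀ I : List (Fin d), l ≤ I.length → I.length < l + P.totalDegree →
        δ ^ (2 * (I.length - l)) * ∫ x in Om x0 c, ‖DW I u x‖ ^ 2 ≤ T) →
      (∀ I : List (Fin d), I.length = l →
        δ ^ (2 * P.totalDegree) * ∫ x in Om x0 c, ‖DW I (PDop P u) x‖ ^ 2 ≤ T) →
      ∀ I : List (Fin d), I.length = l + P.totalDegree →
        δ ^ (2 * P.totalDegree) * ∫ x in Om x0 (c - δ), ‖DW I u x‖ ^ 2 ≤ C * T := by
  obtain ⟨C0, hC0, hco⟩ := coercive hell hm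
  obtain ⟨C1, hC1, hcut⟩ := cutoff x0 P.totalDegree
  set m := P.totalDegree with hmdef
  set B := coefS P * (1 + 2 ^ m * C1) with hB
  have hB0 : 0 ≤ B := mul_nonneg (coefS_nonneg P) (by positivity)
  set D : ℝ := C0 * ((m + 1) * (1 + B ^ 2 * ∑ j ∈ Finset.range m, ((d:ℝ) ^ j * d ^ j))) with hD
  have hD0 : 0 ≤ D := by
    rw [hD]
    have : 0 ≤ ∑ j ∈ Finset.range m, ((d:ℝ) ^ j * d ^ j) := Finset.sum_nonneg fun _ _ => by positivity
    positivity
  refine ⟨1 + D, by linarith, fun u hu δ c hδ hδ1 hc l T hlow hPu K hK => ?_⟩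
  obtain ⟨χ, hχs, hχ1, hχsupp, hχone, hχD⟩ := hcut δ c hδ hδ1 hc
  obtain ⟨J, I, rfl, hJ, hI⟩ : ∃ J I : List (Fin d), K = J ++ I ∧ J.length = m ∧ I.length = l :=
    ⟨K.take m, K.drop m, (List.take_append_drop m K).symm, by simp [hK], by simp [hK]⟩
  set v := DW I u with hv
  have hvs : ContDiff ℝ ∞ v := DW_smooth hu I
  set w : Eu d → ℂ := fun y => χ y * v y with hw
  have hws : ContDiff ℝ ∞ w := hχs.mul hvs
  have hwsupp : tsupport w ⊆ Om x0 c := (tsupport_mul_subset_left).trans hχsupp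
  have hwc : HasCompactSupport w := (Om_compact x0 c).of_isClosed_subset (isClosed_tsupport _) hwsupp
  have hT0 : 0 ≤ T := le_trans (by positivity) (hlow I (by omega) (by omega))
  have hz : ∀ J' : List (Fin d), ∀ x ∉ Om x0 c, DW J' w x = 0 := by
    intro J' x hx
    have h0 : w =ᶠ[𝓝 x] fun _ => 0 := notMem_tsupport_iff_eventuallyEq.1 fun h => hx (hwsupp h)
    rw [(DW_congr h0 J').self_of_nhds, DW_zero]
  have hcont : ∀ J' : List (Fin d), Continuous (DW J' w) := fun J' => (DW_smooth hws J').continuous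
  -- step 1
  have s1 : ∫ x in Om x0 (c - δ), ‖DW (J ++ I) u x‖ ^ 2 ≤ ∫ x, ‖DW J w x‖ ^ 2 := by
    have e : ∫ x in Om x0 (c - δ), ‖DW (J ++ I) u x‖ ^ 2 =
        ∫ x in Om x0 (c - δ), ‖DW J w x‖ ^ 2 := by
      refine setIntegral_congr_fun (Om_closed x0 _).measurableSet fun x hx => ?_
      have hx' : ‖x - x0‖ ^ 2 ≤ c - δ := hx
      have hev : w =ᶠ[𝓝 x] v := by
        have ho : IsOpen {y : Eu d | ‖y - x0‖ ^ 2 < c - δ / 2} :=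
          isOpen_lt (by fun_prop) continuous_const
        filter_upwards [ho.mem_nhds (show ‖x - x0‖ ^ 2 < c - δ / 2 by linarith)] with y hy
        simp [hw, hχone y hy]
      rw [(DW_congr hev J).self_of_nhds, DW_append]
    rw [e]
    refine setIntegral_le_integral ?_ (Eventually.of_forall fun x => by positivity)
    refine Continuous.integrable_of_hasCompactSupport (by fun_prop (disch := exact hcont J)) ?_
    refine (Om_compact x0 c).of_isClosed_subset (isClosed_tsupport _)
      (closure_minimal ?_ (Om_closed x0 c))
    intro x hx
    by_contra hcon
    apply hx
    simp [hz J x hcon]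
  have s2 := hco w hws hwc J hJ
  have hPz : ∀ x ∉ Om x0 c, PDop (ppart P) w x = 0 := by
    intro x hx
    rw [PDop_eq]
    exact Finset.sum_eq_zero fun α _ => by rw [hz _ x hx, mul_zero]
  have s3 : ∫ x, ‖PDop (ppart P) w x‖ ^ 2 = ∫ x in Om x0 c, ‖PDop (ppart P) w x‖ ^ 2 := by
    refine (setIntegral_eq_integral_of_forall_compl_eq_zero fun x hx => ?_).symm
    simp [hPz x hx]
  -- pointwise
  have hpt : ∀ x ∈ Om x0 c, δ ^ (2 * m) * ‖PDop (ppart P) w x‖ ^ 2 ≤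
      (m + 1) * (δ ^ (2 * m) * ‖PDop P v x‖ ^ 2 + B ^ 2 * ∑ j ∈ Finset.range m,
        (d:ℝ) ^ j * ∑ s : Fin j → Fin d, δ ^ (2 * j) * ‖DW (List.ofFn s) v x‖ ^ 2) := by
    intro x hx
    have h := pointwise_comm P hχs hvs x hδ hδ1 hC1 (hχ1 x) (fun i hi him => hχD i hi him x hx)
    rw [← hmdef, ← hB] at h
    have h2 : (δ ^ m * ‖PDop (ppart P) w x‖) ^ 2 ≤ (δ ^ m * ‖PDop P v x‖ +
        ∑ j ∈ Finset.range m, B * (δ ^ j * ‖iteratedFDeriv ℝ j v x‖)) ^ 2 := by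
      rw [← Finset.mul_sum]
      gcongr
    have h3 : (δ ^ m * ‖PDop P v x‖ +
        ∑ j ∈ Finset.range m, B * (δ ^ j * ‖iteratedFDeriv ℝ j v x‖)) ^ 2 ≤
        (m + 1) * ((δ ^ m * ‖PDop P v x‖) ^ 2 +
        ∑ j ∈ Finset.range m, (B * (δ ^ j * ‖iteratedFDeriv ℝ j v x‖)) ^ 2) := by
      have := sq_sum_le_card_mul_sum_sq (s := Finset.range (m + 1))
        (f := fun j => if j = m then δ ^ m * ‖PDop P v x‖ else
          B * (δ ^ j * ‖iteratedFDeriv ℝ j v x‖))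
      rw [Finset.sum_range_succ, Finset.sum_range_succ] at this
      have e1 : ∑ j ∈ Finset.range m, (if j = m then δ ^ m * ‖PDop P v x‖ else
          B * (δ ^ j * ‖iteratedFDeriv ℝ j v x‖)) =
          ∑ j ∈ Finset.range m, B * (δ ^ j * ‖iteratedFDeriv ℝ j v x‖) :=
        Finset.sum_congr rfl fun j hj => if_neg (Finset.mem_range.1 hj).ne
      have e2 : ∑ j ∈ Finset.range m, (if j = m then δ ^ m * ‖PDop P v x‖ else
          B * (δ ^ j * ‖iteratedFDeriv ℝ j v x‖)) ^ 2 =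
          ∑ j ∈ Finset.range m, (B * (δ ^ j * ‖iteratedFDeriv ℝ j v x‖)) ^ 2 :=
        Finset.sum_congr rfl fun j hj => by rw [if_neg (Finset.mem_range.1 hj).ne]
      rw [e1, e2] at this
      simp only [if_true, Finset.card_range] at this
      push_cast at this
      linarith
    calc δ ^ (2 * m) * ‖PDop (ppart P) w x‖ ^ 2 = (δ ^ m * ‖PDop (ppart P) w x‖) ^ 2 := by ring
      _ ≤ _ := h2.trans h3
      _ ≤ _ := by
        gcongr
        · exact le_of_eq (by ring)
        · rw [Finset.mul_sum]
          refine Finset.sum_le_sum fun j _ => ?_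
          have h4 := norm_iteratedFDeriv_le_sum hvs j x
          have h5 : ‖iteratedFDeriv ℝ j v x‖ ^ 2 ≤
              (d:ℝ) ^ j * ∑ s : Fin j → Fin d, ‖DW (List.ofFn s) v x‖ ^ 2 := by
            refine (pow_le_pow_left₀ (norm_nonneg _) h4 2).trans ?_
            refine (sq_sum_le_card_mul_sum_sq).trans (le_of_eq ?_)
            simp
          calc (B * (δ ^ j * ‖iteratedFDeriv ℝ j v x‖)) ^ 2
              = B ^ 2 * δ ^ (2 * j) * ‖iteratedFDeriv ℝ j v x‖ ^ 2 := by ring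
            _ ≤ B ^ 2 * δ ^ (2 * j) * ((d:ℝ) ^ j * ∑ s : Fin j → Fin d,
                ‖DW (List.ofFn s) v x‖ ^ 2) := by gcongr
            _ = _ := by rw [← Finset.mul_sum]; ring
  have hcP : Continuous fun x => δ ^ (2 * m) * ‖PDop P v x‖ ^ 2 := by
    have := (PDop_smooth P hvs).continuous
    fun_prop
  have hcs : ∀ j, ∀ s : Fin j → Fin d,
      Continuous fun x => δ ^ (2 * j) * ‖DW (List.ofFn s) v x‖ ^ 2 := by
    intro j s
    have := (DW_smooth hvs (List.ofFn s)).continuous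
    fun_prop
  have hcS : ∀ j, Continuous fun x => (d:ℝ) ^ j * ∑ s : Fin j → Fin d,
      δ ^ (2 * j) * ‖DW (List.ofFn s) v x‖ ^ 2 := by
    intro j
    exact continuous_const.mul (continuous_finsetSum _ fun s _ => hcs j s)
  have hcT : Continuous fun x => B ^ 2 * ∑ j ∈ Finset.range m,
        (d:ℝ) ^ j * ∑ s : Fin j → Fin d, δ ^ (2 * j) * ‖DW (List.ofFn s) v x‖ ^ 2 :=
    continuous_const.mul (continuous_finsetSum _ fun j _ => hcS j)
  have s4 : δ ^ (2 * m) * ∫ x in Om x0 c, ‖PDop (ppart P) w x‖ ^ 2 ≤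
      (m + 1) * (1 + B ^ 2 * ∑ j ∈ Finset.range m, ((d:ℝ) ^ j * d ^ j)) * T := by
    rw [← integral_const_mul]
    have i1 : IntegrableOn (fun x => δ ^ (2 * m) * ‖PDop (ppart P) w x‖ ^ 2) (Om x0 c) := by
      refine integrableOn_Om ?_ x0 c
      have := (PDop_smooth (ppart P) hws).continuous
      fun_prop
    refine (setIntegral_mono_on i1 (integrableOn_Om ?_ x0 c) (Om_closed x0 c).measurableSet
      hpt).trans ?_
    · exact continuous_const.mul (hcP.add hcT)
    rw [integral_const_mul, integral_add (integrableOn_Om hcP x0 c)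
      (integrableOn_Om hcT x0 c), integral_const_mul, integral_const_mul,
      integral_finsetSum _ (fun j _ => integrableOn_Om (hcS j) x0 c), mul_assoc]
    gcongr
    rw [add_mul, one_mul, mul_assoc, Finset.sum_mul]
    gcongr with j hj
    · have := hPu I hI
      rwa [DW_PDop P hu] at this
    · rw [integral_const_mul, integral_finsetSum _ (fun s _ => integrableOn_Om (hcs j s) x0 c),
        mul_assoc]
      gcongr
      have : ∀ s ∈ (Finset.univ : Finset (Fin j → Fin d)),
          ∫ x in Om x0 c, δ ^ (2 * j) * ‖DW (List.ofFn s) v x‖ ^ 2 ≤ T := by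
        intro s _
        rw [integral_const_mul]
        have hj' := Finset.mem_range.1 hj
        have := hlow (List.ofFn s ++ I) (by simp [hI]) (by simp [hI]; omega)
        rw [DW_append] at this
        simpa [hI] using this
      refine (Finset.sum_le_sum this).trans (le_of_eq ?_)
      simp
  calc δ ^ (2 * m) * ∫ x in Om x0 (c - δ), ‖DW (J ++ I) u x‖ ^ 2
      ≤ δ ^ (2 * m) * (C0 * ∫ x in Om x0 c, ‖PDop (ppart P) w x‖ ^ 2) := by
        gcongr
        rw [← s3]
        exact s1.trans s2
    _ = C0 * (δ ^ (2 * m) * ∫ x in Om x0 c, ‖PDop (ppart P) w x‖ ^ 2) := by ring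
    _ ≤ C0 * ((m + 1) * (1 + B ^ 2 * ∑ j ∈ Finset.range m, ((d:ℝ) ^ j * d ^ j)) * T) := by gcongr
    _ = D * T := by rw [hD]; ring
    _ ≤ (1 + D) * T := by linarith
end onestep
end
end Module4

section Module5
open scoped ContDiff Topology
open MeasureTheory Filter Set
noncomputable section
section iterate
variable {d : ℕ}

lemma iterate_bound {P : MvPolynomial (Fin d) ℂ} {x0 : Eu d} {C : ℝ} (hC : 1 ≤ C)
    {u : Eu d → ℂ} {δ c : ℝ} (hδ : 0 < δ) (hδ1 : δ ≤ 1)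
    (hm : 1 ≤ P.totalDegree) (hc : c ≤ 1)
    (hone : ∀ c : ℝ, c ≤ 1 →
      ∀ (l : ℕ) (T : ℝ),
      (∀ I : List (Fin d), l ≤ I.length → I.length < l + P.totalDegree →
        δ ^ (2 * (I.length - l)) * ∫ x in Om x0 c, ‖DW I u x‖ ^ 2 ≤ T) →
      (∀ I : List (Fin d), I.length = l →
        δ ^ (2 * P.totalDegree) * ∫ x in Om x0 c, ‖DW I (PDop P u) x‖ ^ 2 ≤ T) →
      ∀ I : List (Fin d), I.length = l + P.totalDegree →
        δ ^ (2 * P.totalDegree) * ∫ x in Om x0 (c - δ), ‖DW I u x‖ ^ 2 ≤ C * T)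
    (hu : ContDiff ℝ ∞ u) (N : ℕ) {T : ℝ}
    (h1 : ∀ I : List (Fin d), I.length < P.totalDegree → ∫ x in Om x0 c, ‖DW I u x‖ ^ 2 ≤ T)
    (h2 : ∀ I : List (Fin d), I.length + P.totalDegree ≤ N →
      ∫ x in Om x0 c, ‖DW I (PDop P u) x‖ ^ 2 ≤ T) :
    ∀ k ≤ N, ∀ I : List (Fin d), I.length = k →
      δ ^ (2 * k) * ∫ x in Om x0 (c - k * δ), ‖DW I u x‖ ^ 2 ≤ C ^ k * T := by
  set m := P.totalDegree with hmdef
  have hT0 : 0 ≤ T := le_trans (by positivity) (h1 [] (by simp; omega))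
  have hmono : ∀ f : Eu d → ℂ, Continuous f → ∀ c1 c2 : ℝ, c1 ≤ c2 →
      ∫ x in Om x0 c1, ‖f x‖ ^ 2 ≤ ∫ x in Om x0 c2, ‖f x‖ ^ 2 := by
    intro f hf c1 c2 h
    refine setIntegral_mono_set (integrableOn_Om (by fun_prop) x0 c2)
      (Eventually.of_forall fun x => by positivity) (Om_mono x0 h).eventuallyLE
  intro k
  induction k using Nat.strong_induction_on with
  | _ k ih =>
    intro hkN I hI
    rcases lt_or_ge k m with hk | hk
    · calc δ ^ (2 * k) * ∫ x in Om x0 (c - k * δ), ‖DW I u x‖ ^ 2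
          ≤ 1 * ∫ x in Om x0 c, ‖DW I u x‖ ^ 2 := by
            refine mul_le_mul (pow_le_one₀ hδ.le hδ1) ?_ (by positivity) (by positivity)
            · refine hmono _ (DW_smooth hu I).continuous _ _ ?_
              have : 0 ≤ k * δ := by positivity
              linarith
        _ ≤ 1 * T := by gcongr; exact h1 I (by omega)
        _ ≤ C ^ k * T := by gcongr; exact one_le_pow₀ hC
    · obtain ⟨l, rfl⟩ : ∃ l, k = l + m := ⟨k - m, by omega⟩
      set c' : ℝ := c - ((l + m : ℕ) - 1 : ℝ) * δ with hc'
      have hlm : (1:ℝ) ≤ ((l + m : ℕ) : ℝ) := by exact_mod_cast (by omega : 1 ≤ l + m)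
      have hc'1 : c' ≤ c := by
        have : 0 ≤ ((l + m : ℕ) - 1 : ℝ) * δ := mul_nonneg (by linarith) hδ.le
        linarith
      have hpl : 0 < δ ^ (2 * l) := by positivity
      have key := hone c' (hc'1.trans hc) l (C ^ (l + m - 1) * T / δ ^ (2 * l)) ?_ ?_ I hI
      · have e1 : c' - δ = c - ((l + m : ℕ) : ℝ) * δ := by rw [hc']; ring
        rw [e1, mul_div_assoc', le_div_iff₀ hpl] at key
        calc _ = δ ^ (2 * m) * (∫ x in Om x0 (c - ((l + m : ℕ) : ℝ) * δ), ‖DW I u x‖ ^ 2)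
              * δ ^ (2 * l) := by ring
          _ ≤ C * (C ^ (l + m - 1) * T) := key
          _ = _ := by
            rw [← mul_assoc, ← pow_succ']
            congr 2; omega
      · intro J hJ1 hJ2
        rw [le_div_iff₀ hpl]
        have hi := ih J.length hJ2 (by omega) J rfl
        calc δ ^ (2 * (J.length - l)) * (∫ x in Om x0 c', ‖DW J u x‖ ^ 2) * δ ^ (2 * l)
            = δ ^ (2 * J.length) * ∫ x in Om x0 c', ‖DW J u x‖ ^ 2 := by
              have : 2 * J.length = 2 * (J.length - l) + 2 * l := by omega
              rw [this, pow_add]; ring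
          _ ≤ δ ^ (2 * J.length) * ∫ x in Om x0 (c - J.length * δ), ‖DW J u x‖ ^ 2 := by
              refine mul_le_mul_of_nonneg_left ?_ (by positivity)
              refine hmono _ (DW_smooth hu J).continuous _ _ ?_
              rw [hc']
              have : (J.length : ℝ) ≤ ((l + m : ℕ) : ℝ) - 1 := by
                have : J.length + 1 ≤ l + m := hJ2
                have : ((J.length + 1 : ℕ) : ℝ) ≤ ((l + m : ℕ) : ℝ) := by exact_mod_cast this
                push_cast at this ⊢
                linarith
              nlinarith
          _ ≤ C ^ J.length * T := hi
          _ ≤ C ^ (l + m - 1) * T := by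
              refine mul_le_mul_of_nonneg_right ?_ hT0
              exact pow_le_pow_right₀ hC (by omega)
      · intro J hJ
        rw [le_div_iff₀ hpl]
        calc δ ^ (2 * m) * (∫ x in Om x0 c', ‖DW J (PDop P u) x‖ ^ 2) * δ ^ (2 * l)
            ≤ 1 * (∫ x in Om x0 c, ‖DW J (PDop P u) x‖ ^ 2) * 1 := by
              refine mul_le_mul (mul_le_mul (pow_le_one₀ hδ.le hδ1) ?_ (by positivity)
                (by positivity)) (pow_le_one₀ hδ.le hδ1) (by positivity) (by positivity)
              exact hmono _ (DW_smooth (PDop_smooth P hu) J).continuous _ _ hc'1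
          _ ≤ 1 * T * 1 := by gcongr; exact h2 J (by omega)
          _ = 1 * T := by ring
          _ ≤ _ := by gcongr; exact one_le_pow₀ hC

lemma integral_le_of_sq {f : Eu d → ℂ} (hf : Continuous f) (x0 : Eu d) (c : ℝ) {A : ℝ} (hA : 0 < A)
    (h : ∫ x in Om x0 c, ‖f x‖ ^ 2 ≤ A ^ 2) :
    ∫ x in Om x0 c, ‖f x‖ ≤ A * (volume.real (Om x0 c) + 1) := by
  have h1 : ∫ x in Om x0 c, ‖f x‖ ≤ ∫ x in Om x0 c, (A + A⁻¹ * ‖f x‖ ^ 2) := by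
    refine setIntegral_mono_on (integrableOn_Om (by fun_prop) x0 c)
      (integrableOn_Om (by fun_prop) x0 c) (Om_closed x0 c).measurableSet fun x _ => ?_
    have : A * (A + A⁻¹ * ‖f x‖ ^ 2) = A ^ 2 + ‖f x‖ ^ 2 := by field_simp
    nlinarith [sq_nonneg (A - ‖f x‖), norm_nonneg (f x)]
  refine h1.trans ?_
  rw [integral_add (integrableOn_Om (by fun_prop) x0 c) (integrableOn_Om (by fun_prop) x0 c),
    integral_const_mul, setIntegral_const, smul_eq_mul]
  have : A⁻¹ * ∫ x in Om x0 c, ‖f x‖ ^ 2 ≤ A⁻¹ * A ^ 2 := by gcongr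
  have e : A⁻¹ * A ^ 2 = A := by field_simp
  nlinarith

lemma sup_bound (x0 : Eu d) {c0 : ℝ} (h0 : 0 < c0) (h1 : c0 ≤ 1) :
    ∃ C : ℝ, 0 < C ∧ ∀ u : Eu d → ℂ, ContDiff ℝ ∞ u → ∀ A : ℝ, 0 < A →
      (∀ I : List (Fin d), I.length ≤ d + 1 → ∫ x in Om x0 (c0 / 2), ‖DW I u x‖ ^ 2 ≤ A ^ 2) →
      ∀ x ∈ Om x0 (c0 / 4), ‖u x‖ ≤ C * A := by
  obtain ⟨C0, hC0, hsob⟩ := sobolev d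
  obtain ⟨C1, hC1, hcut⟩ := cutoff x0 (d + 1)
  obtain ⟨χ, hχs, hχ1, hχsupp, hχone, hχD⟩ := hcut (c0 / 4) (c0 / 2) (by positivity) (by linarith)
    (by linarith)
  set M : ℝ := C1 * ((c0 / 4)⁻¹) ^ (d + 1) with hM
  have hδi : 1 ≤ (c0 / 4)⁻¹ := (one_le_inv₀ (by positivity)).2 (by linarith)
  have hM1 : 1 ≤ M := by
    rw [hM]
    nlinarith [one_le_pow₀ hδi (n := d + 1)]
  have hχM : ∀ i ≤ d + 1, ∀ x ∈ Om x0 (c0 / 2), ‖iteratedFDeriv ℝ i χ x‖ ≤ M := by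
    intro i hi x hx
    rcases Nat.eq_zero_or_pos i with rfl | hpos
    · rw [norm_iteratedFDeriv_zero]; exact (hχ1 x).trans hM1
    · refine (hχD i hpos hi x hx).trans ?_
      rw [hM]
      gcongr
  set V := volume.real (Om x0 (c0 / 2)) + 1 with hV
  have hV0 : 0 < V := by have := measureReal_nonneg (μ := volume) (s := Om x0 (c0/2)); linarith
  set Q : ℝ := ∑ i ∈ Finset.range (d + 2), 2 ^ (d + 1) * M * ((d:ℝ) ^ i * V) with hQ
  have hQ0 : 0 ≤ Q := Finset.sum_nonneg fun _ _ => by positivity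
  refine ⟨C0 * (Q + 1), by positivity, fun u hu A hA hI x hx => ?_⟩
  set w : Eu d → ℂ := fun y => u y * χ y with hw
  have hws : ContDiff ℝ ∞ w := hu.mul hχs
  have hwsupp : tsupport w ⊆ Om x0 (c0 / 2) := (tsupport_mul_subset_right).trans hχsupp
  have hwc : HasCompactSupport w :=
    (Om_compact x0 _).of_isClosed_subset (isClosed_tsupport _) hwsupp
  have hux : u x = w x := by
    have : ‖x - x0‖ ^ 2 ≤ c0 / 4 := hx
    simp [hw, hχone x (by linarith)]
  rw [hux]
  have key : ∀ J : List (Fin d), J.length ≤ d + 1 → ∫ x, ‖DW J w x‖ ≤ Q * A := by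
    intro J hJ
    have hz : ∀ y ∉ Om x0 (c0 / 2), DW J w y = 0 := by
      intro y hy
      have h0 : w =ᶠ[𝓝 y] fun _ => 0 := notMem_tsupport_iff_eventuallyEq.1 fun h => hy (hwsupp h)
      rw [(DW_congr h0 J).self_of_nhds, DW_zero]
    have e : ∫ x, ‖DW J w x‖ = ∫ x in Om x0 (c0 / 2), ‖DW J w x‖ :=
      (setIntegral_eq_integral_of_forall_compl_eq_zero fun y hy => by simp [hz y hy]).symm
    rw [e]
    have hcs : ∀ j, ∀ s : Fin j → Fin d, Continuous (DW (List.ofFn s) u) :=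
      fun j s => (DW_smooth hu _).continuous
    have hcS : ∀ j, Continuous fun y => 2 ^ (d + 1) * M * ∑ s : Fin j → Fin d,
        ‖DW (List.ofFn s) u y‖ := fun j =>
      continuous_const.mul (continuous_finsetSum _ fun s _ => (hcs j s).norm)
    have hpt : ∀ y ∈ Om x0 (c0 / 2), ‖DW J w y‖ ≤ ∑ i ∈ Finset.range (d + 2),
        2 ^ (d + 1) * M * ∑ s : Fin i → Fin d, ‖DW (List.ofFn s) u y‖ := by
      intro y hy
      refine (norm_DW_le hws J y).trans ?_
      refine (norm_iteratedFDeriv_mul_le (N := ∞) hu hχs y (by exact_mod_cast le_top)).trans ?_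
      refine (Finset.sum_le_sum (g := fun i => 2 ^ (d + 1) * M *
        ∑ s : Fin i → Fin d, ‖DW (List.ofFn s) u y‖) fun i hi => ?_).trans
        (Finset.sum_le_sum_of_subset_of_nonneg (Finset.range_subset_range.2 (by omega))
        fun _ _ _ => mul_nonneg (by positivity) (Finset.sum_nonneg fun _ _ => norm_nonneg _))
      have hch : ((J.length).choose i : ℝ) ≤ 2 ^ (d + 1) := by
        have h1 := Nat.choose_le_two_pow J.length i
        have h2 : 2 ^ J.length ≤ 2 ^ (d + 1) := Nat.pow_le_pow_right (by norm_num) hJ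
        exact_mod_cast h1.trans h2
      calc _ ≤ 2 ^ (d + 1) * (∑ s : Fin i → Fin d, ‖DW (List.ofFn s) u y‖) * M := by
            gcongr
            · exact norm_iteratedFDeriv_le_sum hu i y
            · exact hχM _ (by omega) y hy
        _ = _ := by ring
    have hcd : Continuous (DW J w) := (DW_smooth hws J).continuous
    refine (setIntegral_mono_on (integrableOn_Om hcd.norm x0 _)
      (integrableOn_Om (continuous_finsetSum _ fun i _ => hcS i) x0 _)
      (Om_closed x0 _).measurableSet hpt).trans ?_
    rw [integral_finsetSum _ (fun i _ => integrableOn_Om (hcS i) x0 _), hQ, Finset.sum_mul]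
    refine Finset.sum_le_sum fun i hi => ?_
    rw [integral_const_mul, integral_finsetSum _
      (fun s _ => integrableOn_Om (hcs i s).norm x0 _), mul_assoc (2 ^ (d+1) * M)]
    gcongr
    have hi' := Finset.mem_range.1 hi
    refine (Finset.sum_le_sum fun s _ => integral_le_of_sq (hcs i s) x0 _ hA
      (hI (List.ofFn s) (by simp; omega))).trans (le_of_eq ?_)
    simp
    ring
  have := hsob w hws hwc _ key x
  calc ‖w x‖ ≤ C0 * (Q * A) := this
    _ ≤ C0 * (Q + 1) * A := by nlinarith [mul_pos hC0 hA]

/-- The main interior estimate. -/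
theorem intEst {P : MvPolynomial (Fin d) ℂ} (hell : IsElliptic P)
    (hm : 1 ≤ P.totalDegree) (x0 : Eu d) {c0 : ℝ} (h0 : 0 < c0) (h1 : c0 ≤ 1) :
    ∃ C : ℝ, 1 ≤ C ∧ ∀ u : Eu d → ℂ, ContDiff ℝ ∞ u → ∀ A : ℝ, 0 < A → ∀ N : ℕ, 1 ≤ N →
      (∀ I : List (Fin d), I.length < P.totalDegree → ∀ x ∈ Om x0 c0, ‖DW I u x‖ ≤ A) →
      (∀ I : List (Fin d), I.length + P.totalDegree ≤ N →
        ∀ x ∈ Om x0 c0, ‖DW I (PDop P u) x‖ ≤ A) →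
      ∀ I : List (Fin d), I.length + d + 1 ≤ N → ∀ x ∈ Om x0 (c0 / 4),
        ‖DW I u x‖ ≤ A * (C * N) ^ N := by
  obtain ⟨C5, hC5, hone⟩ := onestep hell hm x0
  obtain ⟨C6, hC6, hsup⟩ := sup_bound x0 h0 h1
  set V := volume.real (Om x0 c0) + 1 with hV
  have hV1 : 1 ≤ V := by have := measureReal_nonneg (μ := volume) (s := Om x0 c0); linarith
  refine ⟨(1 + C6) * V * (C5 * (2 / c0)), ?_, fun u hu A hA N hN hlow hPu I hI x hx => ?_⟩
  · have : 1 ≤ 2 / c0 := by rw [le_div_iff₀ h0]; linarith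
    have h2 : 1 ≤ (1 + C6) * V := by nlinarith
    have h3 : 1 ≤ C5 * (2 / c0) := by nlinarith
    nlinarith
  have hN0 : (0:ℝ) < N := by exact_mod_cast hN
  have hN1 : (1:ℝ) ≤ N := by exact_mod_cast hN
  set δ : ℝ := c0 / (2 * N) with hδ
  have hδ0 : 0 < δ := by positivity
  have hδ1 : δ ≤ 1 := by
    rw [hδ, div_le_one (by positivity)]; linarith
  have hintg : ∀ f : Eu d → ℂ, Continuous f → (∀ y ∈ Om x0 c0, ‖f y‖ ≤ A) →
      ∫ y in Om x0 c0, ‖f y‖ ^ 2 ≤ A ^ 2 * V := by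
    intro f hf hb
    have : ∫ y in Om x0 c0, ‖f y‖ ^ 2 ≤ ∫ y in Om x0 c0, A ^ 2 := by
      refine setIntegral_mono_on (integrableOn_Om (by fun_prop) x0 c0)
        (integrableOn_Om (by fun_prop) x0 c0) (Om_closed x0 c0).measurableSet fun y hy => ?_
      have := hb y hy
      gcongr
    refine this.trans ?_
    rw [setIntegral_const, smul_eq_mul, hV]
    nlinarith [sq_nonneg A]
  have hit := iterate_bound (P := P) (x0 := x0) hC5 (u := u) (c := c0) hδ0 hδ1 hm h1
    (fun c hc l T => hone u hu δ c hδ0 hδ1 hc l T) hu N (T := A ^ 2 * V)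
    (fun I hI => hintg _ (DW_smooth hu I).continuous (hlow I hI))
    (fun I hI => hintg _ (DW_smooth (PDop_smooth P hu) I).continuous (hPu I hI))
  set R : ℝ := C5 * (2 / c0) * N with hR
  have hRδ : R * δ = C5 := by rw [hR, hδ]; field_simp
  have hR1 : 1 ≤ R := by
    have : 1 ≤ 2 / c0 := by rw [le_div_iff₀ h0]; linarith
    have h3 : 1 ≤ C5 * (2 / c0) := by nlinarith
    rw [hR]; nlinarith
  have hL2 : ∀ J : List (Fin d), J.length ≤ N →
      ∫ y in Om x0 (c0 / 2), ‖DW J u y‖ ^ 2 ≤ (A * V * R ^ N) ^ 2 := by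
    intro J hJ
    have h := hit J.length hJ J rfl
    have hsub : Om x0 (c0 / 2) ⊆ Om x0 (c0 - J.length * δ) := by
      refine Om_mono x0 ?_
      have : (J.length : ℝ) * δ ≤ N * δ := by gcongr
      have e : N * δ = c0 / 2 := by rw [hδ]; field_simp
      linarith
    have hc := (DW_smooth hu J).continuous
    have h3 : ∫ y in Om x0 (c0 / 2), ‖DW J u y‖ ^ 2 ≤
        ∫ y in Om x0 (c0 - J.length * δ), ‖DW J u y‖ ^ 2 :=
      setIntegral_mono_set (integrableOn_Om (by fun_prop) x0 _)
        (Eventually.of_forall fun x => by positivity) hsub.eventuallyLE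
    refine h3.trans ?_
    have h4 : δ ^ (2 * J.length) * ∫ y in Om x0 (c0 - J.length * δ), ‖DW J u y‖ ^ 2 ≤
        δ ^ (2 * J.length) * (R ^ (2 * J.length) * (A ^ 2 * V)) := by
      refine h.trans ?_
      have e : δ ^ (2 * J.length) * (R ^ (2 * J.length) * (A ^ 2 * V)) =
          C5 ^ (2 * J.length) * (A ^ 2 * V) := by
        rw [← hRδ]; ring
      rw [e]
      refine mul_le_mul_of_nonneg_right ?_ (by positivity)
      exact pow_le_pow_right₀ hC5 (by omega)
    have h5 := le_of_mul_le_mul_left h4 (by positivity)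
    refine h5.trans ?_
    calc R ^ (2 * J.length) * (A ^ 2 * V) ≤ R ^ (2 * N) * (A ^ 2 * V ^ 2) := by
          refine mul_le_mul (pow_le_pow_right₀ hR1 (by omega)) ?_ (by positivity) (by positivity)
          exact mul_le_mul_of_nonneg_left (by nlinarith) (by positivity)
      _ = _ := by ring
  have hfin := hsup (DW I u) (DW_smooth hu I) (A * V * R ^ N) (by positivity) (by
    intro J hJ
    rw [← DW_append]
    exact hL2 (J ++ I) (by simp; omega)) x hx
  refine hfin.trans ?_
  have hB : 1 ≤ (1 + C6) * V := by nlinarith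
  calc C6 * (A * V * R ^ N) ≤ A * (((1 + C6) * V) * R ^ N) := by
        have : 0 ≤ A * V * R ^ N := by positivity
        nlinarith
    _ ≤ A * (((1 + C6) * V) ^ N * R ^ N) := by
        gcongr
        exact le_self_pow₀ hB (by omega)
    _ = _ := by rw [← mul_pow, hR]; ring_nf
end iterate
end
end Module5

section Module6
open scoped ContDiff Topology
open MeasureTheory Filter Set
noncomputable section
section analytic
variable {d : ℕ}

lemma local_global {X : Set (Eu d)} (hX : IsOpen X) {f : Eu d → ℂ} (hf : ContDiffOn ℝ ∞ f X)
    {x : Eu d} (hx : x ∈ X) : ∃ g, ContDiff ℝ ∞ g ∧ g =ᶠ[𝓝 x] f := by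
  obtain ⟨g, hg, U, hU, hKU, -, he⟩ := exists_global hX (isCompact_singleton (x := x))
    (by simpa using hx) hf
  exact ⟨g, hg, eventually_of_mem (hU.mem_nhds (hKU rfl)) he⟩

lemma DW_contDiffOn {X : Set (Eu d)} (hX : IsOpen X) {f : Eu d → ℂ} (hf : ContDiffOn ℝ ∞ f X)
    (I : List (Fin d)) : ContDiffOn ℝ ∞ (DW I f) X := by
  intro x hx
  obtain ⟨g, hg, he⟩ := local_global hX hf hx
  exact ((DW_smooth hg I).contDiffAt.congr_of_eventuallyEq (DW_congr he I).symm).contDiffWithinAt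

lemma PDop_eventually_zero {P : MvPolynomial (Fin d) ℂ} {X : Set (Eu d)} (hX : IsOpen X)
    {f : Eu d → ℂ} (h : ∀ x ∈ X, PDop P f x = 0) {x : Eu d} (hx : x ∈ X) :
    PDop P f =ᶠ[𝓝 x] fun _ => 0 := eventually_of_mem (hX.mem_nhds hx) h

lemma MemCP_DW {P : MvPolynomial (Fin d) ℂ} {X : Set (Eu d)} (hX : IsOpen X) {f : Eu d → ℂ}
    (hf : MemCP P X f) (I : List (Fin d)) : MemCP P X (DW I f) := by
  refine ⟨DW_contDiffOn hX hf.1 I, fun x hx => ?_⟩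
  obtain ⟨g, hg, he⟩ := local_global hX hf.1 hx
  have h0 : PDop P g =ᶠ[𝓝 x] fun _ => 0 :=
    (PDop_congr P he).trans (PDop_eventually_zero hX hf.2 hx)
  rw [← (PDop_congr P (DW_congr he I)).self_of_nhds, ← DW_PDop P hg I,
    (DW_congr h0 I).self_of_nhds, DW_zero]

lemma norm_iteratedFDeriv_le_of_DW' {X : Set (Eu d)} (hX : IsOpen X) {f : Eu d → ℂ}
    (hf : ContDiffOn ℝ ∞ f X) (n : ℕ) {x : Eu d} (hx : x ∈ X) {A : ℝ}
    (h : ∀ I : List (Fin d), I.length = n → ‖DW I f x‖ ≤ A) :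
    ‖iteratedFDeriv ℝ n f x‖ ≤ d ^ n * A := by
  obtain ⟨g, hg, he⟩ := local_global hX hf hx
  rw [← (he.iteratedFDeriv ℝ n).self_of_nhds]
  refine norm_iteratedFDeriv_le_of_DW hg n x fun I hI => ?_
  rw [(DW_congr he I).self_of_nhds]
  exact h I hI

lemma pow_self_le (N : ℕ) : (N : ℝ) ^ N ≤ Real.exp 1 ^ N * N.factorial := by
  have h := Real.pow_div_factorial_le_exp N (by positivity) N
  rw [div_le_iff₀ (by positivity)] at h
  refine h.trans (le_of_eq ?_)
  rw [← Real.exp_nat_mul, mul_one]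

lemma factorial_add_le (k s : ℕ) :
    ((k + s).factorial : ℝ) ≤ 2 ^ (k + s) * (k.factorial * s.factorial) := by
  have h := Nat.add_choose_mul_factorial_mul_factorial k s
  have h2 := Nat.choose_le_two_pow (k + s) s
  rw [← h]
  push_cast
  rw [mul_assoc]
  gcongr
  exact_mod_cast h2

/-- Fixed-order interior estimate and analytic estimate on one ball. -/
lemma ball_analytic {P : MvPolynomial (Fin d) ℂ} (hell : IsElliptic P)
    (hm : 1 ≤ P.totalDegree) (x0 : Eu d) {c0 : ℝ} (h0 : 0 < c0) (h1 : c0 ≤ 1) :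
    ∃ M a : ℝ, 1 ≤ M ∧ 1 ≤ a ∧ ∀ u : Eu d → ℂ, ContDiff ℝ ∞ u → ∀ A : ℝ, 0 < A →
      (∀ I : List (Fin d), I.length < P.totalDegree → ∀ x ∈ Om x0 c0, ‖DW I u x‖ ≤ A) →
      (∀ I, ∀ x ∈ Om x0 c0, DW I (PDop P u) x = 0) →
      ∀ I : List (Fin d), ∀ x ∈ Om x0 (c0 / 4),
        ‖DW I u x‖ ≤ A * M * a ^ I.length * I.length.factorial := by
  obtain ⟨C, hC, hintg⟩ := intEst hell hm x0 h0 h1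
  set s := d + 1
  set a := 2 * (C * Real.exp 1) with ha
  have he : 1 ≤ Real.exp 1 := Real.one_le_exp (by norm_num)
  have hCe : 1 ≤ C * Real.exp 1 := by nlinarith
  have ha1 : 1 ≤ a := by linarith
  refine ⟨a ^ s * s.factorial, a, ?_, ha1, fun u hu A hA hlow hz I x hx => ?_⟩
  · have h1 : 1 ≤ a ^ s := one_le_pow₀ ha1
    have h2 : (1:ℝ) ≤ s.factorial := by exact_mod_cast s.factorial_pos
    nlinarith
  · have := hintg u hu A hA (I.length + s) (by omega) hlow
      (fun J _ y hy => by rw [hz J y hy]; simpa using hA.le) I (by omega) x hx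
    refine this.trans ?_
    set k := I.length
    calc A * (C * ((k + s : ℕ) : ℝ)) ^ (k + s)
        = A * (C ^ (k + s) * ((k + s : ℕ) : ℝ) ^ (k + s)) := by rw [mul_pow]
      _ ≤ A * (C ^ (k + s) * (Real.exp 1 ^ (k + s) * (2 ^ (k + s) * (k.factorial * s.factorial)))) := by
          gcongr
          refine (pow_self_le _).trans ?_
          gcongr
          exact factorial_add_le k s
      _ = _ := by rw [ha]; ring

lemma low_bound {X : Set (Eu d)} (hX : IsOpen X) {f : Eu d → ℂ} (hf : ContDiffOn ℝ ∞ f X)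
    {K : Set (Eu d)} (hK : IsCompact K) (hKX : K ⊆ X) (n : ℕ) :
    ∃ A : ℝ, 0 < A ∧ ∀ I : List (Fin d), I.length < n → ∀ x ∈ K, ‖DW I f x‖ ≤ A := by
  have hb : ∀ I : List (Fin d), ∃ A : ℝ, 0 < A ∧ ∀ x ∈ K, ‖DW I f x‖ ≤ A := by
    intro I
    obtain ⟨A, hA⟩ := hK.exists_bound_of_continuousOn ((DW_contDiffOn hX hf I).continuousOn.mono hKX)
    exact ⟨max A 1, by positivity, fun x hx => (hA x hx).trans (le_max_left _ _)⟩
  choose A hA0 hA using hb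
  have hfin : {I : List (Fin d) | I.length < n}.Finite := List.finite_length_lt (Fin d) n
  refine ⟨1 + ∑ I ∈ hfin.toFinset, A I, ?_, fun I hI x hx => ?_⟩
  · have : 0 ≤ ∑ I ∈ hfin.toFinset, A I := Finset.sum_nonneg fun I _ => (hA0 I).le
    linarith
  · have : A I ≤ ∑ I ∈ hfin.toFinset, A I :=
      Finset.single_le_sum (f := A) (fun I _ => (hA0 I).le) (by simpa using hI)
    linarith [hA I x hx]

lemma Om_sub_ball (x0 : Eu d) {r : ℝ} (hr : 0 < r) : Om x0 (r ^ 2 / 4) ⊆ Metric.ball x0 r := by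
  intro x hx
  have hx' : ‖x - x0‖ ^ 2 ≤ r ^ 2 / 4 := hx
  rw [Metric.mem_ball, dist_eq_norm]
  nlinarith [norm_nonneg (x - x0)]

lemma Om_mem_nhds (x0 : Eu d) {c : ℝ} (hc : 0 < c) : Om x0 c ∈ 𝓝 x0 := by
  have : Continuous fun x : Eu d => ‖x - x0‖ ^ 2 := by fun_prop
  have h2 : {x : Eu d | ‖x - x0‖ ^ 2 < c} ∈ 𝓝 x0 :=
    (isOpen_lt this continuous_const).mem_nhds (by simpa using hc)
  exact mem_of_superset h2 fun x (hx : ‖x - x0‖ ^ 2 < c) => show ‖x - x0‖ ^ 2 ≤ c from hx.le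

/-- Choose `c0` with `Om x0 c0 ⊆ X`. -/
lemma exists_Om_sub {X : Set (Eu d)} (hX : IsOpen X) {x0 : Eu d} (hx : x0 ∈ X) :
    ∃ c0 : ℝ, 0 < c0 ∧ c0 ≤ 1 ∧ Om x0 c0 ⊆ X := by
  obtain ⟨r, hr, hrX⟩ := Metric.isOpen_iff.1 hX x0 hx
  refine ⟨min (r ^ 2 / 4) 1, by positivity, min_le_right _ _, ?_⟩
  exact (Om_mono x0 (min_le_left _ _)).trans ((Om_sub_ball x0 hr).trans hrX)

theorem compact_analytic {P : MvPolynomial (Fin d) ℂ} (hell : IsElliptic P)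
    (hm : 1 ≤ P.totalDegree) {X : Set (Eu d)} (hX : IsOpen X) {f : Eu d → ℂ} (hf : MemCP P X f)
    {K : Set (Eu d)} (hK : IsCompact K) (hKX : K ⊆ X) :
    ∃ M a : ℝ, 1 ≤ M ∧ 1 ≤ a ∧ ∀ I : List (Fin d), ∀ x ∈ K,
      ‖DW I f x‖ ≤ M * a ^ I.length * I.length.factorial := by
  refine hK.induction_on (p := fun s => ∃ M a : ℝ, 1 ≤ M ∧ 1 ≤ a ∧ ∀ I : List (Fin d), ∀ x ∈ s,
      ‖DW I f x‖ ≤ M * a ^ I.length * I.length.factorial) ⟨1, 1, le_rfl, le_rfl, by simp⟩ ?_ ?_ ?_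
  · rintro s t hst ⟨M, a, hM, ha, h⟩
    exact ⟨M, a, hM, ha, fun I x hx => h I x (hst hx)⟩
  · rintro s t ⟨M, a, hM, ha, h⟩ ⟨M', a', hM', ha', h'⟩
    refine ⟨max M M', max a a', le_max_of_le_left hM, le_max_of_le_left ha, ?_⟩
    rintro I x (hx | hx)
    · refine (h I x hx).trans ?_
      gcongr
      · exact le_max_left _ _
      · exact le_max_left _ _
    · refine (h' I x hx).trans ?_
      gcongr
      · exact le_max_right _ _
      · exact le_max_right _ _
  · intro x0 hx0
    obtain ⟨c0, h0, h1, hsub⟩ := exists_Om_sub hX (hKX hx0)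
    obtain ⟨M, a, hM, ha, hb⟩ := ball_analytic hell hm x0 h0 h1
    obtain ⟨g, hg, U, hU, hKU, hUX, he⟩ := exists_global hX (Om_compact x0 c0) hsub hf.1
    have hev : ∀ x ∈ Om x0 c0, g =ᶠ[𝓝 x] f := fun x hx =>
      eventually_of_mem (hU.mem_nhds (hKU hx)) he
    obtain ⟨A, hA, hlow⟩ := low_bound hX hf.1 (Om_compact x0 c0) hsub P.totalDegree
    have hA' : 0 < max A 1 := by positivity
    refine ⟨Om x0 (c0 / 4), mem_nhdsWithin_of_mem_nhds (Om_mem_nhds x0 (by positivity)),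
      max A 1 * M, a, ?_, ha, fun I x hx => ?_⟩
    · nlinarith [le_max_right A 1]
    · have hxc : x ∈ Om x0 c0 := Om_mono x0 (by linarith) hx
      rw [← (DW_congr (hev x hxc) I).self_of_nhds]
      refine hb g hg (max A 1) hA' (fun J hJ y hy => ?_) (fun J y hy => ?_) I x hx
      · rw [(DW_congr (hev y hy) J).self_of_nhds]
        exact (hlow J hJ y hy).trans (le_max_left _ _)
      · have hz : PDop P g =ᶠ[𝓝 y] fun _ => 0 :=
          (PDop_congr P (hev y hy)).trans (PDop_eventually_zero hX hf.2 (hsub hy))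
        rw [(DW_congr hz J).self_of_nhds, DW_zero]

/-- Taylor series. -/
def taylorSer (f : Eu d → ℂ) (p : Eu d) : FormalMultilinearSeries ℝ (Eu d) ℂ :=
  fun n => ((n.factorial : ℝ)⁻¹) • iteratedFDeriv ℝ n f p

lemma norm_taylorSer_le {f : Eu d → ℂ} {p : Eu d} {M b : ℝ}
    (h : ∀ n, ‖iteratedFDeriv ℝ n f p‖ ≤ M * b ^ n * n.factorial) (n : ℕ) :
    ‖taylorSer f p n‖ ≤ M * b ^ n := by
  rw [taylorSer, norm_smul, norm_inv, Real.norm_natCast, inv_mul_le_iff₀ (by positivity)]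
  linarith [h n]

lemma taylorSer_radius {f : Eu d → ℂ} {p : Eu d} {M b : ℝ} (hb : 0 < b)
    (h : ∀ n, ‖iteratedFDeriv ℝ n f p‖ ≤ M * b ^ n * n.factorial) :
    ENNReal.ofReal b⁻¹ ≤ (taylorSer f p).radius := by
  refine FormalMultilinearSeries.le_radius_of_bound _ M (r := b⁻¹.toNNReal) fun n => ?_
  rw [Real.coe_toNNReal _ (by positivity)]
  calc _ ≤ M * b ^ n * b⁻¹ ^ n := by gcongr; exact norm_taylorSer_le h n
    _ = M := by rw [mul_assoc, ← mul_pow, mul_inv_cancel₀ hb.ne', one_pow, mul_one]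

lemma hasFPowerSeries_taylor {f : Eu d → ℂ} {p : Eu d} {M b ρ : ℝ} (hb : 0 < b) (hρ : 0 < ρ)
    (hM : 0 ≤ M) (hf : ∀ x ∈ Metric.ball p ρ, ContDiffAt ℝ ∞ f x)
    (h : ∀ n, ∀ x ∈ Metric.ball p ρ, ‖iteratedFDeriv ℝ n f x‖ ≤ M * b ^ n * n.factorial) :
    HasFPowerSeriesAt f (taylorSer f p) p := by
  set r := min ρ (2 * b)⁻¹ with hr
  have hr0 : 0 < r := by positivity
  have hpt := fun n => h n p (Metric.mem_ball_self hρ)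
  refine ⟨ENNReal.ofReal r, ⟨?_, by simpa using hr0, fun {y} hy => ?_⟩⟩
  · refine le_trans (ENNReal.ofReal_le_ofReal ?_) (taylorSer_radius hb hpt)
    refine (min_le_right _ _).trans ?_
    gcongr; linarith
  have hy' : ‖y‖ < r := by
    rw [Metric.eball_ofReal] at hy
    simpa using hy
  have hyρ : ‖y‖ < ρ := hy'.trans_le (min_le_left _ _)
  have hby : b * ‖y‖ ≤ 1 / 2 := by
    have : ‖y‖ ≤ (2 * b)⁻¹ := hy'.le.trans (min_le_right _ _)
    calc b * ‖y‖ ≤ b * (2 * b)⁻¹ := by gcongr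
      _ = 1 / 2 := by field_simp
  have hterm : ∀ n, ‖taylorSer f p n fun _ => y‖ ≤ M * (1 / 2) ^ n := by
    intro n
    refine ((taylorSer f p n).le_opNorm _).trans ?_
    rw [Finset.prod_const, Finset.card_univ, Fintype.card_fin]
    calc _ ≤ M * b ^ n * ‖y‖ ^ n := by gcongr; exact norm_taylorSer_le hpt n
      _ = M * (b * ‖y‖) ^ n := by rw [mul_pow]; ring
      _ ≤ _ := by gcongr
  have hsum : Summable fun n => taylorSer f p n fun _ => y :=
    Summable.of_norm_bounded ((summable_geometric_two).mul_left M) hterm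
  rw [hsum.hasSum_iff_tendsto_nat, ← tendsto_add_atTop_iff_nat 1, tendsto_iff_norm_sub_tendsto_zero]
  have hseg : ∀ t ∈ Set.Icc (0:ℝ) 1, p + t • y ∈ Metric.ball p ρ := by
    intro t ht
    rw [Metric.mem_ball, dist_eq_norm, add_sub_cancel_left, norm_smul, Real.norm_of_nonneg ht.1]
    nlinarith [norm_nonneg y, ht.1, ht.2]
  have hlim : Tendsto (fun n : ℕ => M * (((n + 1 : ℕ) : ℝ) * (1 / 2) ^ (n + 1))) atTop (𝓝 0) := by
    have := (tendsto_self_mul_const_pow_of_lt_one (r := (1/2:ℝ)) (by norm_num) (by norm_num))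
    have := ((tendsto_add_atTop_iff_nat 1).2 this).const_mul M
    simpa using this
  refine squeeze_zero (fun _ => norm_nonneg _) (fun n => ?_) hlim
  have hT := map_add_eq_sum_add_integral_iteratedFDeriv (n := n) (f := f) (x := p) (y := y)
    (fun t ht => (hf _ (hseg t ht)).of_le (by exact_mod_cast le_top))
  rw [hT, norm_sub_rev]
  have e : ∑ k ∈ Finset.range (n + 1), (taylorSer f p k fun _ => y) =
    ∑ k ∈ Finset.range (n + 1), (k.factorial : ℝ)⁻¹ • (iteratedFDeriv ℝ k f p (fun _ ↦ y)) := rfl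
  rw [e, add_sub_cancel_left, norm_smul, norm_inv, Real.norm_natCast,
    inv_mul_le_iff₀ (by positivity)]
  have := intervalIntegral.norm_integral_le_of_norm_le_const (a := (0:ℝ)) (b := 1)
    (f := fun t => (1 - t)^n • iteratedFDeriv ℝ (n + 1) f (p + t • y) (fun _ ↦ y))
    (C := M * b ^ (n + 1) * (n + 1).factorial * ‖y‖ ^ (n + 1)) (fun t ht => ?_)
  · refine this.trans ?_
    rw [sub_zero, abs_one, mul_one, Nat.factorial_succ]
    push_cast
    calc _ = (n.factorial : ℝ) * (M * ((n + 1) * (b * ‖y‖) ^ (n + 1))) := by rw [mul_pow]; ring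
      _ ≤ _ := by gcongr
  · rw [uIoc_of_le zero_le_one] at ht
    rw [norm_smul, norm_pow]
    have h1 : ‖1 - t‖ ^ n ≤ 1 := by
      refine pow_le_one₀ (norm_nonneg _) ?_
      rw [Real.norm_of_nonneg (by linarith [ht.2])]
      linarith [ht.1]
    have h2 : ‖iteratedFDeriv ℝ (n + 1) f (p + t • y) (fun _ ↦ y)‖ ≤
        M * b ^ (n + 1) * (n + 1).factorial * ‖y‖ ^ (n + 1) := by
      refine (ContinuousMultilinearMap.le_opNorm _ _).trans ?_
      rw [Finset.prod_const, Finset.card_univ, Fintype.card_fin]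
      gcongr
      exact h (n + 1) _ (hseg t ⟨ht.1.le, ht.2⟩)
    calc _ ≤ 1 * (M * b ^ (n + 1) * (n + 1).factorial * ‖y‖ ^ (n + 1)) := by gcongr
      _ = _ := one_mul _

theorem CP_hasFPowerSeriesAt {P : MvPolynomial (Fin d) ℂ} (hell : IsElliptic P)
    (hm : 1 ≤ P.totalDegree) {X : Set (Eu d)} (hX : IsOpen X) {f : Eu d → ℂ} (hf : MemCP P X f)
    {p : Eu d} (hp : p ∈ X) : HasFPowerSeriesAt f (taylorSer f p) p := by
  obtain ⟨r, hr, hrX⟩ := Metric.isOpen_iff.1 hX p hp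
  have hsub : Metric.closedBall p (r / 2) ⊆ X :=
    (Metric.closedBall_subset_ball (by linarith)).trans hrX
  obtain ⟨M, a, hM, ha, h⟩ := compact_analytic hell hm hX hf (isCompact_closedBall p (r / 2)) hsub
  refine hasFPowerSeries_taylor (M := M) (b := (d + 1) * a) (ρ := r / 2) (by positivity)
    (by positivity) (by positivity) (fun x hx => ?_) (fun n x hx => ?_)
  · exact hf.1.contDiffAt (hX.mem_nhds (hsub (Metric.ball_subset_closedBall hx)))
  · have hx' := Metric.ball_subset_closedBall hx
    refine (norm_iteratedFDeriv_le_of_DW' hX hf.1 n (hsub hx')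
      (A := M * a ^ n * n.factorial) fun I hI => ?_).trans ?_
    · have := h I x hx'
      rwa [hI] at this
    · rw [mul_pow]
      calc _ ≤ ((d:ℝ) + 1) ^ n * (M * a ^ n * n.factorial) := by gcongr; linarith
        _ = _ := by ring

theorem CP_analytic {P : MvPolynomial (Fin d) ℂ} (hell : IsElliptic P)
    (hm : 1 ≤ P.totalDegree) {X : Set (Eu d)} (hX : IsOpen X) {f : Eu d → ℂ} (hf : MemCP P X f) :
    AnalyticOnNhd ℝ f X := fun _ hp => (CP_hasFPowerSeriesAt hell hm hX hf hp).analyticAt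
end analytic
end
end Module6

section Module7
open scoped ContDiff Topology
open MeasureTheory Filter Set
noncomputable section
section gauss
variable {d : ℕ}

lemma gauss_poly (n p : ℕ) (hp : n ≤ 2 * p) {t ε : ℝ} (ht : 0 ≤ t) (hε : 0 < ε) (hε1 : ε ≤ 1) :
    (1 + t) ^ n * Real.exp (-(ε * t ^ 2)) ≤ 2 ^ p * p.factorial * Real.exp 1 * (ε⁻¹) ^ p := by
  have h1 : (1 + t) ^ n ≤ (2 * (1 + t ^ 2)) ^ p := by
    calc (1 + t) ^ n ≤ (1 + t) ^ (2 * p) := pow_le_pow_right₀ (by linarith) hp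
      _ = ((1 + t) ^ 2) ^ p := by rw [pow_mul]
      _ ≤ _ := by gcongr; nlinarith [sq_nonneg (1 - t)]
  have h2 : (1 + t ^ 2) ≤ ε⁻¹ * (1 + ε * t ^ 2) := by
    rw [mul_add, mul_one, ← mul_assoc, inv_mul_cancel₀ hε.ne', one_mul]
    have : 1 ≤ ε⁻¹ := (one_le_inv₀ hε).2 hε1
    linarith
  have h3 : (1 + ε * t ^ 2) ^ p ≤ Real.exp (1 + ε * t ^ 2) * p.factorial := by
    have := Real.pow_div_factorial_le_exp (1 + ε * t ^ 2) (by positivity) p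
    rwa [div_le_iff₀ (by positivity)] at this
  calc (1 + t) ^ n * Real.exp (-(ε * t ^ 2))
      ≤ (2 * (ε⁻¹ * (1 + ε * t ^ 2))) ^ p * Real.exp (-(ε * t ^ 2)) := by
        gcongr
        refine h1.trans ?_
        gcongr
    _ = 2 ^ p * ε⁻¹ ^ p * ((1 + ε * t ^ 2) ^ p * Real.exp (-(ε * t ^ 2))) := by
        rw [mul_pow, mul_pow]; ring
    _ ≤ 2 ^ p * ε⁻¹ ^ p * ((Real.exp (1 + ε * t ^ 2) * p.factorial) * Real.exp (-(ε * t ^ 2))) := by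
        gcongr
    _ = 2 ^ p * ε⁻¹ ^ p * (p.factorial * (Real.exp (1 + ε * t ^ 2 + -(ε * t ^ 2)))) := by
        rw [Real.exp_add (1 + ε * t ^ 2)]; ring
    _ = _ := by rw [add_neg_cancel_right]; ring

/-- Complex frequency. -/
def zz (i0 : Fin d) (j : ℕ) (ξ : Eu d) (k : Fin d) : ℂ :=
  Complex.I * (ξ k : ℂ) + (if k = i0 then (j : ℂ) else 0)

def ph (i0 : Fin d) (j : ℕ) (x : Eu d) (ε : ℝ) (ξ : Eu d) : ℂ :=
  ∑ k, (x k : ℂ) * zz i0 j ξ k + ε * ∑ k, (zz i0 j ξ k) ^ 2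

def gI (i0 : Fin d) (j : ℕ) (Mf : Eu d → ℂ) (Q : MvPolynomial (Fin d) ℂ) (x : Eu d) (ε : ℝ)
    (ξ : Eu d) : ℂ :=
  Mf ξ * MvPolynomial.eval (zz i0 j ξ) Q * Complex.exp (ph i0 j x ε ξ)

def GG (i0 : Fin d) (j : ℕ) (Mf : Eu d → ℂ) (Q : MvPolynomial (Fin d) ℂ) (ε : ℝ) (x : Eu d) : ℂ :=
  ∫ ξ, gI i0 j Mf Q x ε ξ

lemma zz_cont (i0 : Fin d) (j : ℕ) (k : Fin d) : Continuous fun ξ : Eu d => zz i0 j ξ k := by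
  unfold zz
  fun_prop

lemma zz_cont' (i0 : Fin d) (j : ℕ) : Continuous fun ξ : Eu d => zz i0 j ξ :=
  continuous_pi fun k => zz_cont i0 j k

lemma norm_zz (i0 : Fin d) (j : ℕ) (ξ : Eu d) (k : Fin d) :
    ‖zz i0 j ξ k‖ ≤ (1 + j) * (1 + ‖ξ‖) := by
  have h1 : ‖ξ k‖ ≤ ‖ξ‖ := PiLp.norm_apply_le ξ k
  have h2 : ‖(if k = i0 then (j : ℂ) else 0)‖ ≤ j := by split_ifs <;> simp
  have h3 : ‖Complex.I * (ξ k : ℂ)‖ = ‖ξ k‖ := by simp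
  have := norm_add_le (Complex.I * (ξ k : ℂ)) (if k = i0 then (j : ℂ) else 0)
  unfold zz
  have hj : (0:ℝ) ≤ j := by positivity
  nlinarith [norm_nonneg ξ]

lemma norm_eval_zz (i0 : Fin d) (j : ℕ) (Q : MvPolynomial (Fin d) ℂ) :
    ∃ C : ℝ, 0 < C ∧ ∃ n : ℕ, ∀ ξ : Eu d, ‖MvPolynomial.eval (zz i0 j ξ) Q‖ ≤ C * (1 + ‖ξ‖) ^ n := by
  induction Q using MvPolynomial.induction_on with
  | C a => exact ⟨1 + ‖a‖, by positivity, 0, fun ξ => by simp⟩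
  | add p q hp hq =>
    obtain ⟨C, hC, n, h⟩ := hp
    obtain ⟨C', hC', n', h'⟩ := hq
    refine ⟨C + C', by positivity, n + n', fun ξ => ?_⟩
    rw [map_add, add_mul]
    have h1 : 1 ≤ 1 + ‖ξ‖ := by linarith [norm_nonneg ξ]
    refine (norm_add_le _ _).trans (add_le_add ((h ξ).trans ?_) ((h' ξ).trans ?_))
    · exact mul_le_mul_of_nonneg_left (pow_le_pow_right₀ h1 (by omega)) hC.le
    · exact mul_le_mul_of_nonneg_left (pow_le_pow_right₀ h1 (by omega)) hC'.le
  | mul_X p k hp =>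
    obtain ⟨C, hC, n, h⟩ := hp
    refine ⟨C * (1 + j), by positivity, n + 1, fun ξ => ?_⟩
    rw [map_mul, MvPolynomial.eval_X, norm_mul]
    calc _ ≤ (C * (1 + ‖ξ‖) ^ n) * ((1 + j) * (1 + ‖ξ‖)) := by
          gcongr
          · exact h ξ
          · exact norm_zz i0 j ξ k
      _ = _ := by ring

lemma ph_re (i0 : Fin d) (j : ℕ) (x : Eu d) (ε : ℝ) (ξ : Eu d) :
    (ph i0 j x ε ξ).re = j * x i0 + ε * (j ^ 2 - ‖ξ‖ ^ 2) := by
  have h1 : (∑ k, (x k : ℂ) * zz i0 j ξ k).re = j * x i0 := by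
    rw [Complex.re_sum]
    have : ∀ k, ((x k : ℂ) * zz i0 j ξ k).re = if k = i0 then j * x k else 0 := by
      intro k
      unfold zz
      split_ifs <;> simp [mul_comm]
    simp [this]
  have h2 : (∑ k, (zz i0 j ξ k) ^ 2).re = j ^ 2 - ‖ξ‖ ^ 2 := by
    rw [Complex.re_sum, EuclideanSpace.norm_sq_eq]
    have : ∀ k, ((zz i0 j ξ k) ^ 2).re = (if k = i0 then (j:ℝ) ^ 2 else 0) - ‖ξ k‖ ^ 2 := by
      intro k
      unfold zz
      split_ifs <;> simp [pow_two]
    simp [this]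
  unfold ph
  rw [Complex.add_re, h1, Complex.re_ofReal_mul, h2]

/-- Domination. -/
lemma gI_bound (i0 : Fin d) (j : ℕ) (Q : MvPolynomial (Fin d) ℂ) (R : ℝ) :
    ∃ C : ℝ, 0 < C ∧ ∃ p : ℕ, ∀ Mf : Eu d → ℂ, (∀ ξ, ‖Mf ξ‖ ≤ 1) → ∀ ε0 : ℝ, 0 < ε0 → ε0 ≤ 1 →
      ∀ ε : ℝ, ε0 ≤ ε → ε ≤ 2 → ∀ x : Eu d, ‖x‖ ≤ R → ∀ ξ : Eu d,
      ‖gI i0 j Mf Q x ε ξ‖ ≤ C * (ε0⁻¹) ^ p * (1 + ‖ξ‖) ^ (-((d:ℝ) + 1)) := by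
  obtain ⟨C, hC, n, h⟩ := norm_eval_zz i0 j Q
  set p := n + d + 1
  refine ⟨C * Real.exp (j * R + 2 * j ^ 2) * (2 ^ p * p.factorial * Real.exp 1), by positivity, p,
    fun Mf hM ε0 h0 h1 ε hε hε2 x hx ξ => ?_⟩
  have hξ : 0 < 1 + ‖ξ‖ := by positivity
  have e1 : (1 + ‖ξ‖) ^ (-((d:ℝ) + 1)) = ((1 + ‖ξ‖) ^ (d + 1))⁻¹ := by
    rw [Real.rpow_neg hξ.le, ← Real.rpow_natCast]; push_cast; rfl
  rw [e1, ← div_eq_mul_inv, le_div_iff₀ (by positivity)]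
  unfold gI
  rw [norm_mul, norm_mul, Complex.norm_exp, ph_re]
  have hxi : |x i0| ≤ R := le_trans (PiLp.norm_apply_le x i0) hx
  have hx0 : x i0 ≤ R := (le_abs_self _).trans hxi
  have hexp : Real.exp (j * x i0 + ε * (j ^ 2 - ‖ξ‖ ^ 2)) ≤
      Real.exp (j * R + 2 * j ^ 2) * Real.exp (-(ε0 * ‖ξ‖ ^ 2)) := by
    rw [← Real.exp_add]
    apply Real.exp_le_exp.2
    have hj : (0:ℝ) ≤ j := by positivity
    have a1 : j * x i0 ≤ j * R := by gcongr
    have a2 : ε * (j:ℝ) ^ 2 ≤ 2 * j ^ 2 := by gcongr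
    have a3 : ε0 * ‖ξ‖ ^ 2 ≤ ε * ‖ξ‖ ^ 2 := by gcongr
    linarith
  have hg := gauss_poly (n + (d + 1)) p (by omega) (norm_nonneg ξ) h0 h1
  calc _ ≤ 1 * (C * (1 + ‖ξ‖) ^ n) *
        (Real.exp (j * R + 2 * j ^ 2) * Real.exp (-(ε0 * ‖ξ‖ ^ 2))) * (1 + ‖ξ‖) ^ (d + 1) := by
        gcongr
        · exact hM ξ
        · exact h ξ
    _ = C * Real.exp (j * R + 2 * j ^ 2) * ((1 + ‖ξ‖) ^ (n + (d + 1)) *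
        Real.exp (-(ε0 * ‖ξ‖ ^ 2))) := by rw [pow_add]; ring
    _ ≤ C * Real.exp (j * R + 2 * j ^ 2) * (2 ^ p * p.factorial * Real.exp 1 * (ε0⁻¹) ^ p) := by
        gcongr
    _ = _ := by ring

lemma integrable_wt : Integrable fun ξ : Eu d => (1 + ‖ξ‖) ^ (-((d:ℝ) + 1)) :=
  integrable_one_add_norm (by simp)

variable {i0 : Fin d} {j : ℕ} {Mf : Eu d → ℂ}

lemma gI_meas (hMm : AEStronglyMeasurable Mf volume) (Q : MvPolynomial (Fin d) ℂ) (x : Eu d) (ε : ℝ) :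
    AEStronglyMeasurable (gI i0 j Mf Q x ε) volume := by
  unfold gI
  have h1 : Continuous fun ξ : Eu d => MvPolynomial.eval (zz i0 j ξ) Q :=
    (MvPolynomial.continuous_eval Q).comp (zz_cont' i0 j)
  have h2 : Continuous fun ξ : Eu d => Complex.exp (ph i0 j x ε ξ) := by
    unfold ph
    have := fun k => zz_cont i0 j k
    fun_prop
  exact (hMm.mul h1.aestronglyMeasurable).mul h2.aestronglyMeasurable

lemma gI_integrable (hMm : AEStronglyMeasurable Mf volume) (hM : ∀ ξ, ‖Mf ξ‖ ≤ 1)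
    (Q : MvPolynomial (Fin d) ℂ) (x : Eu d) {ε : ℝ} (h0 : 0 < ε) (h1 : ε ≤ 1) :
    Integrable (gI i0 j Mf Q x ε) := by
  obtain ⟨C, hC, p, h⟩ := gI_bound i0 j Q ‖x‖
  exact (integrable_wt.const_mul _).mono' (gI_meas hMm Q x ε)
    (Eventually.of_forall fun ξ => h Mf hM ε h0 h1 ε le_rfl (by linarith) x le_rfl ξ)

lemma GG_bound (i0 : Fin d) (j : ℕ) (Q : MvPolynomial (Fin d) ℂ) (R : ℝ) :
    ∃ C : ℝ, 0 < C ∧ ∃ p : ℕ, ∀ Mf : Eu d → ℂ, (∀ ξ, ‖Mf ξ‖ ≤ 1) →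
      ∀ ε : ℝ, 0 < ε → ε ≤ 1 → ∀ x : Eu d, ‖x‖ ≤ R → ‖GG i0 j Mf Q ε x‖ ≤ C * (ε⁻¹) ^ p := by
  obtain ⟨C, hC, p, h⟩ := gI_bound i0 j Q R
  set W := ∫ ξ : Eu d, (1 + ‖ξ‖) ^ (-((d:ℝ) + 1))
  have hW : 0 ≤ W := integral_nonneg fun ξ => by positivity
  refine ⟨C * (W + 1), by positivity, p, fun Mf hM ε h0 h1 x hx => ?_⟩
  have := norm_integral_le_of_norm_le (integrable_wt.const_mul (C * (ε⁻¹) ^ p))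
    (Eventually.of_forall fun ξ => h Mf hM ε h0 h1 ε le_rfl (by linarith) x hx ξ)
  refine this.trans ?_
  rw [integral_const_mul]
  have h3 : 0 < C * ε⁻¹ ^ p := by positivity
  show C * ε⁻¹ ^ p * W ≤ _
  nlinarith

/-- the coordinate functional with values in `ℂ` -/
def cproj (k : Fin d) : Eu d →L[ℝ] ℂ := Complex.ofRealCLM.comp (EuclideanSpace.proj k)

lemma cproj_apply (k : Fin d) (x : Eu d) : cproj k x = (x k : ℂ) := rfl

lemma norm_cproj_le (k : Fin d) : ‖cproj k‖ ≤ 1 := by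
  refine ContinuousLinearMap.opNorm_le_bound _ zero_le_one fun x => ?_
  rw [cproj_apply, one_mul, Complex.norm_real]
  exact PiLp.norm_apply_le x k

lemma gI_mul_X (Q : MvPolynomial (Fin d) ℂ) (k : Fin d) (x : Eu d) (ε : ℝ) (ξ : Eu d) :
    gI i0 j Mf (Q * MvPolynomial.X k) x ε ξ = gI i0 j Mf Q x ε ξ * zz i0 j ξ k := by
  unfold gI
  rw [map_mul, MvPolynomial.eval_X]
  ring

lemma GG_hasFDerivAt (hMm : AEStronglyMeasurable Mf volume) (hM : ∀ ξ, ‖Mf ξ‖ ≤ 1)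
    (Q : MvPolynomial (Fin d) ℂ) {ε : ℝ} (h0 : 0 < ε) (h1 : ε ≤ 1) (x : Eu d) :
    HasFDerivAt (GG i0 j Mf Q ε)
      (∑ k, GG i0 j Mf (Q * MvPolynomial.X k) ε x • cproj k) x := by
  have hb := fun k : Fin d => gI_bound i0 j (Q * MvPolynomial.X k) (‖x‖ + 1)
  choose C hC p hbd using hb
  have hder := hasFDerivAt_integral_of_dominated_of_fderiv_le (μ := volume)
    (F := fun x ξ => gI i0 j Mf Q x ε ξ)
    (F' := fun x ξ => ∑ k, gI i0 j Mf (Q * MvPolynomial.X k) x ε ξ • cproj k)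
    (x₀ := x) (s := Metric.ball x 1)
    (bound := fun ξ => ∑ k, C k * (ε⁻¹) ^ (p k) * (1 + ‖ξ‖) ^ (-((d:ℝ) + 1)))
    (Metric.ball_mem_nhds x one_pos)
    (Eventually.of_forall fun y => gI_meas hMm Q y ε)
    (gI_integrable hMm hM Q x h0 h1) ?_ ?_ ?_ ?_
  · have e : ∫ ξ, (∑ k, gI i0 j Mf (Q * MvPolynomial.X k) x ε ξ • cproj k) =
        ∑ k, GG i0 j Mf (Q * MvPolynomial.X k) ε x • cproj k := by
      rw [integral_finsetSum]
      · refine Finset.sum_congr rfl fun k _ => ?_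
        rw [integral_smul_const]; rfl
      · intro k _
        exact (gI_integrable hMm hM _ x h0 h1).smul_const _
    rw [← e]
    exact hder
  · have : AEStronglyMeasurable (∑ k, fun ξ => gI i0 j Mf (Q * MvPolynomial.X k) x ε ξ • cproj k)
        volume := Finset.aestronglyMeasurable_sum _ fun k _ =>
          (gI_meas hMm (Q * MvPolynomial.X k) x ε).smul_const (cproj k)
    refine this.congr (Eventually.of_forall fun ξ => ?_)
    simp only [Finset.sum_apply]
  · refine Eventually.of_forall fun ξ y hy => ?_
    refine (norm_sum_le _ _).trans (Finset.sum_le_sum fun k _ => ?_)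
    rw [norm_smul]
    have hy' : ‖y‖ ≤ ‖x‖ + 1 := by
      have : ‖y - x‖ < 1 := by simpa [dist_eq_norm] using hy
      have := norm_le_norm_add_norm_sub' y x
      linarith
    have := hbd k Mf hM ε h0 h1 ε le_rfl (by linarith) y hy' ξ
    calc _ ≤ (C k * (ε⁻¹) ^ (p k) * (1 + ‖ξ‖) ^ (-((d:ℝ) + 1))) * 1 := by
          refine mul_le_mul this (norm_cproj_le k) (norm_nonneg _) ?_
          exact (norm_nonneg _).trans this
      _ = _ := mul_one _
  · exact integrable_finsetSum _ fun k _ => integrable_wt.const_mul _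
  · refine Eventually.of_forall fun ξ y _ => ?_
    have hph : HasFDerivAt (fun y => ph i0 j y ε ξ) (∑ k, zz i0 j ξ k • cproj k) y := by
      unfold ph
      refine HasFDerivAt.add_const _ ?_
      refine HasFDerivAt.fun_sum fun k _ => ?_
      have := ((cproj k).hasFDerivAt (x := y)).mul_const (zz i0 j ξ k)
      simpa [cproj_apply] using this
    have h3 := (hph.cexp).const_mul (Mf ξ * MvPolynomial.eval (zz i0 j ξ) Q)
    refine h3.congr_fderiv ?_
    rw [smul_smul, Finset.smul_sum]
    refine Finset.sum_congr rfl fun k _ => ?_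
    rw [smul_smul, gI_mul_X]
    rfl

lemma GG_contDiff (hMm : AEStronglyMeasurable Mf volume) (hM : ∀ ξ, ‖Mf ξ‖ ≤ 1)
    (Q : MvPolynomial (Fin d) ℂ) {ε : ℝ} (h0 : 0 < ε) (h1 : ε ≤ 1) :
    ContDiff ℝ ∞ (GG i0 j Mf Q ε) := by
  rw [contDiff_infty]
  intro n
  induction n generalizing Q with
  | zero =>
    exact contDiff_zero.2 (continuous_iff_continuousAt.2 fun x =>
      (GG_hasFDerivAt hMm hM Q h0 h1 x).continuousAt)
  | succ n ih =>
    push_cast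
    rw [contDiff_succ_iff_hasFDerivAt]
    exact ⟨_, ContDiff.sum fun k _ => (ih (Q * MvPolynomial.X k)).smul contDiff_const,
      GG_hasFDerivAt hMm hM Q h0 h1⟩

lemma pderivE_GG (hMm : AEStronglyMeasurable Mf volume) (hM : ∀ ξ, ‖Mf ξ‖ ≤ 1)
    (Q : MvPolynomial (Fin d) ℂ) {ε : ℝ} (h0 : 0 < ε) (h1 : ε ≤ 1) (k : Fin d) :
    pderivE k (GG i0 j Mf Q ε) = GG i0 j Mf (Q * MvPolynomial.X k) ε := by
  funext x
  unfold pderivE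
  rw [(GG_hasFDerivAt hMm hM Q h0 h1 x).fderiv]
  have : ∀ i : Fin d, ((if i = k then (1:ℝ) else 0 : ℝ) : ℂ) = if i = k then (1:ℂ) else 0 := by
    intro i; split_ifs <;> simp
  simp [cproj_apply, this]

lemma GG_hasDerivAt_aux (hMm : AEStronglyMeasurable Mf volume) (hM : ∀ ξ, ‖Mf ξ‖ ≤ 1)
    (Q S : MvPolynomial (Fin d) ℂ)
    (hS : ∀ ξ, MvPolynomial.eval (zz i0 j ξ) S = ∑ k, (zz i0 j ξ k) ^ 2)
    {ε : ℝ} (h0 : 0 < ε) (h1 : ε ≤ 1) (x : Eu d) :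
    HasDerivAt (fun e => GG i0 j Mf Q e x) (GG i0 j Mf (Q * S) ε x) ε := by
  obtain ⟨C, hC, p, hbd⟩ := gI_bound i0 j (Q * S) ‖x‖
  have hder : ∀ ξ, ∀ e : ℝ, HasDerivAt (fun e => gI i0 j Mf Q x e ξ) (gI i0 j Mf (Q * S) x e ξ) e := by
    intro ξ e
    have hph : HasDerivAt (fun e : ℝ => ph i0 j x e ξ) (∑ k, (zz i0 j ξ k) ^ 2) e := by
      unfold ph
      refine HasDerivAt.const_add _ ?_
      have := ((Complex.ofRealCLM.hasDerivAt (x := e))).mul_const (∑ k, (zz i0 j ξ k) ^ 2)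
      simpa using this
    have h3 := (hph.cexp).const_mul (Mf ξ * MvPolynomial.eval (zz i0 j ξ) Q)
    refine h3.congr_deriv ?_
    unfold gI
    rw [map_mul, hS]
    ring
  have hs : Ioo (ε / 2) 2 ∈ 𝓝 ε := Ioo_mem_nhds (by linarith) (by linarith)
  exact (hasDerivAt_integral_of_dominated_loc_of_deriv_le (μ := volume) hs
    (Eventually.of_forall fun y => gI_meas hMm Q x y)
    (gI_integrable hMm hM Q x h0 h1) (gI_meas hMm (Q * S) x ε)
    (Eventually.of_forall fun ξ e he =>
      hbd Mf hM (ε / 2) (by positivity) (by linarith) e he.1.le he.2.le x le_rfl ξ)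
    (integrable_wt.const_mul _)
    (Eventually.of_forall fun ξ e _ => hder ξ e)).2

lemma GG_hasDerivAt (hMm : AEStronglyMeasurable Mf volume) (hM : ∀ ξ, ‖Mf ξ‖ ≤ 1)
    (Q : MvPolynomial (Fin d) ℂ) {ε : ℝ} (h0 : 0 < ε) (h1 : ε ≤ 1) (x : Eu d) :
    HasDerivAt (fun e => GG i0 j Mf Q e x)
      (GG i0 j Mf (Q * ∑ k, MvPolynomial.X k ^ 2) ε x) ε :=
  GG_hasDerivAt_aux hMm hM Q _ (fun ξ => by simp [map_sum]) h0 h1 x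
end gauss
end
end Module7

section Module8
open scoped ContDiff Topology
open MeasureTheory Filter Set
noncomputable section
section alg
variable {d : ℕ}

def aj (m j : ℕ) : ℂ := (-1) ^ (m - j) * (m.choose j : ℂ)

lemma findiff_poly (p : Polynomial ℂ) {m : ℕ} (hp : p.natDegree ≤ m) :
    ∑ j ∈ Finset.range (m + 1), aj m j * p.eval (j : ℂ) = m.factorial * p.coeff m := by
  have h := fwdDiff_iter_eq_sum_shift (1:ℂ) (fun x => Polynomial.eval x p) m 0
  have e : ∑ j ∈ Finset.range (m + 1), aj m j * p.eval (j : ℂ) =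
      (fwdDiff (1:ℂ))^[m] (fun x => Polynomial.eval x p) 0 := by
    rw [h]
    refine Finset.sum_congr rfl fun j _ => ?_
    simp [aj, zsmul_eq_mul]
  rw [e]
  rcases hp.lt_or_eq with hlt | heq
  · rw [Polynomial.fwdDiff_iter_eq_zero_of_degree_lt hlt, Polynomial.coeff_eq_zero_of_natDegree_lt hlt]
    simp
  · subst heq
    rw [Polynomial.fwdDiff_iter_degree_eq_factorial]
    simp [mul_comm]

lemma findiff_mono (α : Fin d → ℕ) (b ζ : Fin d → ℂ) {m : ℕ} (hα : ∑ i, α i ≤ m) :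
    ∑ j ∈ Finset.range (m + 1), aj m j * ∏ i, ((j:ℂ) * b i - ζ i) ^ α i =
      if ∑ i, α i = m then m.factorial * ∏ i, b i ^ α i else 0 := by
  set l : List (Polynomial ℂ) :=
    (word α).map fun i => Polynomial.C (b i) * Polynomial.X - Polynomial.C (ζ i) with hl
  have hll : l.length = ∑ i, α i := by rw [hl, List.length_map, length_word]
  have hdeg1 : ∀ p ∈ l, p.natDegree ≤ 1 := by
    intro p hp
    obtain ⟨i, -, rfl⟩ := List.mem_map.1 hp
    compute_degree
  have hdeg : l.prod.natDegree ≤ ∑ i, α i := by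
    refine (Polynomial.natDegree_list_prod_le l).trans ?_
    rw [← hll]
    have := List.sum_le_card_nsmul (l.map Polynomial.natDegree) 1 (by
      intro x hx
      obtain ⟨p, hp, rfl⟩ := List.mem_map.1 hx
      exact hdeg1 p hp)
    simpa using this
  have hev : ∀ j : ℕ, l.prod.eval (j:ℂ) = ∏ i, ((j:ℂ) * b i - ζ i) ^ α i := by
    intro j
    rw [Polynomial.eval_list_prod, hl, List.map_map, ← prod_word α (fun i => (j:ℂ) * b i - ζ i)]
    congr 2
    funext i
    simp only [Function.comp, Polynomial.eval_sub, Polynomial.eval_mul, Polynomial.eval_C, Polynomial.eval_X]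
    ring
  have h := findiff_poly l.prod (hdeg.trans hα)
  simp_rw [hev] at h
  rw [h]
  split_ifs with hm
  · have hc := Polynomial.coeff_list_prod_of_natDegree_le l 1 hdeg1
    rw [mul_one, hll, hm] at hc
    rw [hc, hl, List.map_map, ← prod_word α b]
    congr 3
    funext i
    simp [Polynomial.coeff_C]
  · rw [Polynomial.coeff_eq_zero_of_natDegree_lt (by omega), mul_zero]

def bb (i0 : Fin d) (k : Fin d) : ℂ := if k = i0 then 2 else 0

/-- The polynomial `P̄(2 j η - X)`. -/
def qj (P : MvPolynomial (Fin d) ℂ) (i0 : Fin d) (j : ℕ) : MvPolynomial (Fin d) ℂ :=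
  ∑ α ∈ P.support, MvPolynomial.C ((starRingEnd ℂ) (P.coeff α)) *
    ∏ i, (MvPolynomial.C ((j:ℂ) * bb i0 i) - MvPolynomial.X i) ^ α i

lemma eval_qj (P : MvPolynomial (Fin d) ℂ) (i0 : Fin d) (j : ℕ) (ζ : Fin d → ℂ) :
    MvPolynomial.eval ζ (qj P i0 j) = ∑ α ∈ P.support, (starRingEnd ℂ) (P.coeff α) *
      ∏ i, ((j:ℂ) * bb i0 i - ζ i) ^ α i := by
  simp [qj, map_sum, map_prod]

lemma conj_zz (i0 : Fin d) (j : ℕ) (ξ : Eu d) (k : Fin d) :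
    (starRingEnd ℂ) (zz i0 j ξ k) = (j:ℂ) * bb i0 k - zz i0 j ξ k := by
  unfold zz bb
  split_ifs <;> simp <;> ring

lemma eval_qj_zz (P : MvPolynomial (Fin d) ℂ) (i0 : Fin d) (j : ℕ) (ξ : Eu d) :
    MvPolynomial.eval (zz i0 j ξ) (qj P i0 j) =
      (starRingEnd ℂ) (MvPolynomial.eval (zz i0 j ξ) P) := by
  rw [eval_qj, MvPolynomial.eval_eq', map_sum]
  refine Finset.sum_congr rfl fun α _ => ?_
  rw [map_mul, map_prod]
  simp_rw [map_pow, conj_zz]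

def cst (P : MvPolynomial (Fin d) ℂ) (i0 : Fin d) : ℂ :=
  P.totalDegree.factorial * (starRingEnd ℂ) (MvPolynomial.eval (bb i0) (ppart P))

lemma cst_ne {P : MvPolynomial (Fin d) ℂ} (hell : IsElliptic P) (i0 : Fin d) : cst P i0 ≠ 0 := by
  unfold cst
  refine mul_ne_zero (by exact_mod_cast Nat.factorial_ne_zero _) ?_
  rw [Ne, map_eq_zero]
  have := hell (fun k => if k = i0 then 2 else 0) (fun h => by
    have := congrFun h i0
    simp at this)
  have hb : bb i0 = fun k => (((if k = i0 then 2 else 0 : ℝ)) : ℂ) := by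
    funext k
    unfold bb
    split_ifs <;> simp
  rw [hb]
  exact this

lemma sum_qj (P : MvPolynomial (Fin d) ℂ) (i0 : Fin d) (ζ : Fin d → ℂ) :
    ∑ j ∈ Finset.range (P.totalDegree + 1), aj P.totalDegree j * MvPolynomial.eval ζ (qj P i0 j) =
      cst P i0 := by
  simp_rw [eval_qj, Finset.mul_sum]
  rw [Finset.sum_comm]
  have : ∀ α ∈ P.support, ∑ j ∈ Finset.range (P.totalDegree + 1), aj P.totalDegree j *
      ((starRingEnd ℂ) (P.coeff α) * ∏ i, ((j:ℂ) * bb i0 i - ζ i) ^ α i) =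
      (starRingEnd ℂ) (P.coeff α) * (if ∑ i, α i = P.totalDegree then
        P.totalDegree.factorial * ∏ i, bb i0 i ^ α i else 0) := by
    intro α hα
    rw [← findiff_mono (fun i => α i) (bb i0) ζ (sum_le_totalDegree hα), Finset.mul_sum]
    refine Finset.sum_congr rfl fun j _ => ?_
    ring
  rw [Finset.sum_congr rfl this, cst, ppart, MvPolynomial.homogeneousComponent_apply, map_sum,
    map_sum, Finset.mul_sum, Finset.sum_filter]
  refine Finset.sum_congr rfl fun α _ => ?_
  have hdeg : Finsupp.degree α = ∑ i, α i := by
    rw [Finsupp.degree_eq_sum]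
  rw [hdeg]
  split_ifs with h
  · rw [MvPolynomial.eval_monomial, map_mul, Finsupp.prod_fintype _ _ (fun i => pow_zero _), map_prod]
    have hb : ∀ i, (starRingEnd ℂ) (bb i0 i) = bb i0 i := by
      intro i; unfold bb; split_ifs
      · exact Complex.conj_ofNat 2
      · exact map_zero _
    simp_rw [map_pow, hb]
    ring
  · simp

lemma GG_add {i0 : Fin d} {j : ℕ} {Mf : Eu d → ℂ} (hMm : AEStronglyMeasurable Mf volume)
    (hM : ∀ ξ, ‖Mf ξ‖ ≤ 1) (Q Q' : MvPolynomial (Fin d) ℂ) {ε : ℝ} (h0 : 0 < ε) (h1 : ε ≤ 1)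
    (x : Eu d) : GG i0 j Mf (Q + Q') ε x = GG i0 j Mf Q ε x + GG i0 j Mf Q' ε x := by
  unfold GG
  rw [← integral_add (gI_integrable hMm hM Q x h0 h1) (gI_integrable hMm hM Q' x h0 h1)]
  congr 1
  funext ξ
  unfold gI
  rw [map_add]; ring

lemma GG_C_mul {i0 : Fin d} {j : ℕ} {Mf : Eu d → ℂ} (Q : MvPolynomial (Fin d) ℂ) (c : ℂ) (ε : ℝ)
    (x : Eu d) : GG i0 j Mf (MvPolynomial.C c * Q) ε x = c * GG i0 j Mf Q ε x := by
  unfold GG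
  rw [← integral_const_mul]
  congr 1
  funext ξ
  unfold gI
  rw [map_mul, MvPolynomial.eval_C]; ring

lemma GG_sum {i0 : Fin d} {j : ℕ} {Mf : Eu d → ℂ} (hMm : AEStronglyMeasurable Mf volume)
    (hM : ∀ ξ, ‖Mf ξ‖ ≤ 1) {ι : Type*} (s : Finset ι) (Q : ι → MvPolynomial (Fin d) ℂ) {ε : ℝ}
    (h0 : 0 < ε) (h1 : ε ≤ 1) (x : Eu d) :
    GG i0 j Mf (∑ i ∈ s, Q i) ε x = ∑ i ∈ s, GG i0 j Mf (Q i) ε x := by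
  unfold GG
  rw [← integral_finsetSum _ fun i _ => gI_integrable hMm hM (Q i) x h0 h1]
  congr 1
  funext ξ
  unfold gI
  rw [map_sum, Finset.mul_sum, Finset.sum_mul]

def heat (ε : ℝ) (x : Eu d) : ℂ :=
  ((Real.pi / ε : ℝ) : ℂ) ^ ((d:ℂ) / 2) * Complex.exp (-(‖x‖ ^ 2 / (4 * ε) : ℝ))

lemma GG_one (i0 : Fin d) (j : ℕ) {ε : ℝ} (h0 : 0 < ε) (x : Eu d) :
    GG i0 j (fun _ => 1) 1 ε x = heat ε x := by
  set w : Eu d := x + EuclideanSpace.single i0 (2 * ε * j) with hw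
  have h := GaussianFourier.integral_cexp_neg_mul_sq_norm_add_of_euclideanSpace (b := (ε:ℂ))
    (by simpa using h0) Complex.I w
  have hε : (ε:ℂ) ≠ 0 := by exact_mod_cast h0.ne'
  have hin : ∀ ξ : Eu d, (inner ℝ w ξ : ℝ) = ∑ k, x k * ξ k + 2 * ε * j * ξ i0 := by
    intro ξ
    rw [hw, inner_add_left, EuclideanSpace.inner_single_left]
    simp [PiLp.inner_apply, mul_comm]
  have hnorm : ‖w‖ ^ 2 = ‖x‖ ^ 2 + 4 * ε * j * x i0 + 4 * ε ^ 2 * j ^ 2 := by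
    rw [hw, norm_add_sq_real, EuclideanSpace.inner_single_right, EuclideanSpace.norm_single]
    simp [mul_pow]
    ring
  have hph : ∀ ξ : Eu d, ph i0 j x ε ξ =
      (-(ε:ℂ) * ‖ξ‖ ^ 2 + Complex.I * (inner ℝ w ξ : ℝ)) + (j * x i0 + ε * j ^ 2 : ℝ) := by
    intro ξ
    have s1 : ∑ k, (x k : ℂ) * zz i0 j ξ k = Complex.I * ∑ k, (x k : ℂ) * (ξ k : ℂ) + x i0 * j := by
      unfold zz
      simp_rw [mul_add]
      rw [Finset.sum_add_distrib, Finset.mul_sum]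
      congr 1
      · exact Finset.sum_congr rfl fun k _ => by ring
      · simp
    have s2 : ∑ k, (zz i0 j ξ k) ^ 2 = -(‖ξ‖ ^ 2 : ℝ) + 2 * Complex.I * ξ i0 * j + j ^ 2 := by
      have : ∀ k, (zz i0 j ξ k) ^ 2 = -((ξ k : ℂ) ^ 2) +
          if k = i0 then (2 * Complex.I * ξ k * j + (j:ℂ) ^ 2) else 0 := by
        intro k
        unfold zz
        have hI : Complex.I ^ 2 = -1 := Complex.I_sq
        split_ifs
        · linear_combination (ξ k : ℂ) ^ 2 * hI
        · linear_combination (ξ k : ℂ) ^ 2 * hI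
      simp_rw [this]
      rw [Finset.sum_add_distrib, EuclideanSpace.norm_sq_eq]
      simp
      ring
    unfold ph
    rw [s1, s2, hin]
    push_cast
    ring
  have : GG i0 j (fun _ => 1) 1 ε x = (∫ ξ : Eu d, Complex.exp
      (-(ε:ℂ) * ‖ξ‖ ^ 2 + Complex.I * (inner ℝ w ξ : ℝ))) *
        Complex.exp ((j * x i0 + ε * j ^ 2 : ℝ)) := by
    unfold GG
    rw [← integral_mul_const]
    congr 1
    funext ξ
    unfold gI
    rw [map_one, one_mul, one_mul, hph, Complex.exp_add]
  rw [this, h, mul_assoc, ← Complex.exp_add, heat]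
  congr 1
  · push_cast
    rw [Fintype.card_fin]
  · congr 1
    have : ((‖w‖ : ℂ)) ^ 2 = ‖x‖ ^ 2 + 4 * ε * j * x i0 + 4 * ε ^ 2 * j ^ 2 := by exact_mod_cast hnorm
    rw [this, Complex.I_sq]
    push_cast
    field_simp
    ring

lemma one_meas : AEStronglyMeasurable (fun _ : Eu d => (1:ℂ)) volume := aestronglyMeasurable_const

lemma GG_indep (i0 : Fin d) (j : ℕ) (Q : MvPolynomial (Fin d) ℂ) {ε : ℝ} (h0 : 0 < ε) (h1 : ε ≤ 1) :
    GG i0 j (fun _ => 1) Q ε = GG i0 0 (fun _ => 1) Q ε := by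
  have hM : ∀ ξ : Eu d, ‖(fun _ => (1:ℂ)) ξ‖ ≤ 1 := by simp
  induction Q using MvPolynomial.induction_on with
  | C a =>
    funext x
    rw [← mul_one (MvPolynomial.C a), GG_C_mul, GG_C_mul, GG_one i0 j h0, GG_one i0 0 h0]
  | add p q hp hq =>
    funext x
    rw [GG_add one_meas hM _ _ h0 h1, GG_add one_meas hM _ _ h0 h1, hp, hq]
  | mul_X p k hp =>
    rw [← pderivE_GG one_meas hM p h0 h1 k, ← pderivE_GG one_meas hM p h0 h1 k, hp]

def Mq (P : MvPolynomial (Fin d) ℂ) (i0 : Fin d) (j : ℕ) (ξ : Eu d) : ℂ :=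
  (starRingEnd ℂ) (MvPolynomial.eval (zz i0 j ξ) P) / MvPolynomial.eval (zz i0 j ξ) P

lemma Mq_bound (P : MvPolynomial (Fin d) ℂ) (i0 : Fin d) (j : ℕ) (ξ : Eu d) : ‖Mq P i0 j ξ‖ ≤ 1 := by
  unfold Mq
  rw [norm_div, RCLike.norm_conj]
  exact div_self_le_one _

lemma Mq_meas (P : MvPolynomial (Fin d) ℂ) (i0 : Fin d) (j : ℕ) :
    AEStronglyMeasurable (Mq P i0 j) volume := by
  have h1 : Continuous fun ξ : Eu d => MvPolynomial.eval (zz i0 j ξ) P :=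
    (MvPolynomial.continuous_eval P).comp (zz_cont' i0 j)
  have h2 : Measurable fun ξ : Eu d => MvPolynomial.eval (zz i0 j ξ) P := h1.measurable
  have h3 : Measurable fun ξ : Eu d => (starRingEnd ℂ) (MvPolynomial.eval (zz i0 j ξ) P) :=
    (Complex.continuous_conj.comp h1).measurable
  exact (h3.div h2).aestronglyMeasurable

/-- regularised fundamental solution with polynomial factor `Q` -/
def UU (P : MvPolynomial (Fin d) ℂ) (i0 : Fin d) (Q : MvPolynomial (Fin d) ℂ) (ε : ℝ) (x : Eu d) : ℂ :=
  ∑ j ∈ Finset.range (P.totalDegree + 1), aj P.totalDegree j * GG i0 j (Mq P i0 j) Q ε x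

variable (P : MvPolynomial (Fin d) ℂ) (i0 : Fin d)

lemma UU_smooth (Q : MvPolynomial (Fin d) ℂ) {ε : ℝ} (h0 : 0 < ε) (h1 : ε ≤ 1) :
    ContDiff ℝ ∞ (UU P i0 Q ε) :=
  ContDiff.sum fun j _ => contDiff_const.mul
    (GG_contDiff (Mq_meas P i0 j) (Mq_bound P i0 j) Q h0 h1)

lemma DW_GG {j : ℕ} {Mf : Eu d → ℂ} (hMm : AEStronglyMeasurable Mf volume)
    (hM : ∀ ξ, ‖Mf ξ‖ ≤ 1) (Q : MvPolynomial (Fin d) ℂ) {ε : ℝ} (h0 : 0 < ε) (h1 : ε ≤ 1)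
    (I : List (Fin d)) :
    DW I (GG i0 j Mf Q ε) = GG i0 j Mf (Q * (I.map MvPolynomial.X).prod) ε := by
  induction I with
  | nil => simp
  | cons i I ih =>
    rw [DW_cons, ih, pderivE_GG hMm hM _ h0 h1]
    congr 1
    simp; ring

lemma DW_UU (Q : MvPolynomial (Fin d) ℂ) {ε : ℝ} (h0 : 0 < ε) (h1 : ε ≤ 1) (I : List (Fin d)) :
    DW I (UU P i0 Q ε) = UU P i0 (Q * (I.map MvPolynomial.X).prod) ε := by
  have hs := fun j => GG_contDiff (i0 := i0) (j := j) (Mq_meas P i0 j) (Mq_bound P i0 j) Q h0 h1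
  have e : UU P i0 Q ε = fun x => ∑ j ∈ Finset.range (P.totalDegree + 1),
      aj P.totalDegree j * GG i0 j (Mq P i0 j) Q ε x := rfl
  rw [e, DW_sum _ (fun j _ => contDiff_const.mul (hs j))]
  funext x
  unfold UU
  refine Finset.sum_congr rfl fun j _ => ?_
  rw [DW_const_mul (hs j), DW_GG i0 (Mq_meas P i0 j) (Mq_bound P i0 j) Q h0 h1]

lemma UU_hasDerivAt (Q : MvPolynomial (Fin d) ℂ) {ε : ℝ} (h0 : 0 < ε) (h1 : ε ≤ 1) (x : Eu d) :
    HasDerivAt (fun e => UU P i0 Q e x) (UU P i0 (Q * ∑ k, MvPolynomial.X k ^ 2) ε x) ε := by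
  unfold UU
  exact HasDerivAt.fun_sum fun j _ =>
    (GG_hasDerivAt (Mq_meas P i0 j) (Mq_bound P i0 j) Q h0 h1 x).const_mul _

lemma UU_bound (Q : MvPolynomial (Fin d) ℂ) (R : ℝ) : ∃ C : ℝ, 0 < C ∧ ∃ p : ℕ,
    ∀ ε : ℝ, 0 < ε → ε ≤ 1 → ∀ x : Eu d, ‖x‖ ≤ R → ‖UU P i0 Q ε x‖ ≤ C * (ε⁻¹) ^ p := by
  choose C hC p h using fun j => GG_bound i0 j Q R
  set S := ∑ j ∈ Finset.range (P.totalDegree + 1), ‖aj P.totalDegree j‖ * C j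
  have hS : 0 ≤ S := Finset.sum_nonneg fun j _ => mul_nonneg (norm_nonneg _) (hC j).le
  refine ⟨S + 1, by positivity,
    ∑ j ∈ Finset.range (P.totalDegree + 1), p j, fun ε h0 h1 x hx => ?_⟩
  have hei : 1 ≤ ε⁻¹ := (one_le_inv₀ h0).2 h1
  unfold UU
  refine (norm_sum_le _ _).trans ?_
  have : S * ε⁻¹ ^ (∑ j ∈ Finset.range (P.totalDegree + 1), p j) ≤
      (S + 1) * ε⁻¹ ^ (∑ j ∈ Finset.range (P.totalDegree + 1), p j) := by gcongr; linarith
  refine le_trans ?_ this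
  rw [Finset.sum_mul]
  refine Finset.sum_le_sum fun j hj => ?_
  rw [norm_mul, mul_assoc]
  refine mul_le_mul_of_nonneg_left ?_ (norm_nonneg _)
  refine (h j _ (Mq_bound P i0 j) ε h0 h1 x hx).trans ?_
  refine mul_le_mul_of_nonneg_left ?_ (hC j).le
  exact pow_le_pow_right₀ hei (Finset.single_le_sum (f := p) (fun _ _ => Nat.zero_le _) hj)

lemma UU_linear_sum {ι : Type*} (s : Finset ι) (c : ι → ℂ) (Q : ι → MvPolynomial (Fin d) ℂ) {ε : ℝ}
    (h0 : 0 < ε) (h1 : ε ≤ 1) (x : Eu d) :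
    UU P i0 (∑ i ∈ s, MvPolynomial.C (c i) * Q i) ε x = ∑ i ∈ s, c i * UU P i0 (Q i) ε x := by
  unfold UU
  simp_rw [GG_sum (Mq_meas P i0 _) (Mq_bound P i0 _) s _ h0 h1, GG_C_mul, Finset.mul_sum]
  rw [Finset.sum_comm]
  refine Finset.sum_congr rfl fun i _ => Finset.sum_congr rfl fun j _ => ?_
  ring

lemma PDop_UU {ε : ℝ} (h0 : 0 < ε) (h1 : ε ≤ 1) (x : Eu d) :
    PDop P (UU P i0 1 ε) x = cst P i0 * heat ε x := by
  have hM : ∀ ξ : Eu d, ‖(fun _ => (1:ℂ)) ξ‖ ≤ 1 := by simp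
  have e1 : PDop P (UU P i0 1 ε) x = UU P i0 P ε x := by
    rw [PDop_eq]
    have : ∀ α ∈ P.support, P.coeff α * DW (word fun i => α i) (UU P i0 1 ε) x =
        P.coeff α * UU P i0 (∏ i, MvPolynomial.X i ^ α i) ε x := by
      intro α _
      rw [DW_UU P i0 1 h0 h1, one_mul, prod_word]
    rw [Finset.sum_congr rfl this, ← UU_linear_sum P i0 _ _ _ h0 h1]
    congr 1
    conv_rhs => rw [MvPolynomial.as_sum P]
    refine Finset.sum_congr rfl fun α _ => ?_
    rw [MvPolynomial.monomial_eq, Finsupp.prod_fintype _ _ (fun i => pow_zero _)]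
  rw [e1]
  have e2 : ∀ j, GG i0 j (Mq P i0 j) P ε x = GG i0 0 (fun _ => 1) (qj P i0 j) ε x := by
    intro j
    rw [← GG_indep i0 j _ h0 h1]
    unfold GG
    congr 1
    funext ξ
    unfold gI
    rw [eval_qj_zz, one_mul]
    congr 1
    unfold Mq
    by_cases hz : MvPolynomial.eval (zz i0 j ξ) P = 0
    · simp [hz]
    · field_simp
  unfold UU
  simp_rw [e2, ← GG_C_mul]
  rw [← GG_sum one_meas hM _ _ h0 h1, ← GG_one i0 0 h0, ← GG_C_mul]
  unfold GG
  congr 1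
  funext ξ
  unfold gI
  congr 2
  rw [map_sum, mul_one, MvPolynomial.eval_C, ← sum_qj P i0 (zz i0 0 ξ)]
  simp
end alg
end
end Module8

section Module9
open scoped ContDiff Topology
open MeasureTheory Filter Set
noncomputable section
section sing
variable {d : ℕ}

def gau (ε : ℝ) (x : Eu d) : ℂ := Complex.exp (-(‖x‖ ^ 2 / (4 * ε) : ℝ))

lemma gau_smooth (ε : ℝ) : ContDiff ℝ ∞ (gau ε : Eu d → ℂ) := by
  unfold gau
  refine ContDiff.cexp (ContDiff.neg (Complex.ofRealCLM.contDiff.comp ?_))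
  exact ((contDiff_id).norm_sq ℝ).div_const _

lemma cx_smooth (i : Fin d) : ContDiff ℝ ∞ (fun x : Eu d => ((x i : ℝ) : ℂ)) := by
  refine Complex.ofRealCLM.contDiff.comp ?_
  exact (EuclideanSpace.proj (𝕜 := ℝ) i : Eu d →L[ℝ] ℝ).contDiff

lemma pderivE_mul_gau {q : Eu d → ℂ} (hq : ContDiff ℝ ∞ q) (ε : ℝ) (i : Fin d) :
    pderivE i (fun x => q x * gau ε x) = fun x => pderivE i q x * gau ε x +
      (ε⁻¹ : ℂ) * ((-(x i / 2 : ℂ) * q x) * gau ε x) := by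
  funext x
  have hn : HasFDerivAt (fun x : Eu d => ‖x‖ ^ 2) (2 • innerSL ℝ x) x := by
    exact (hasStrictFDerivAt_norm_sq x).hasFDerivAt
  have h1 : HasFDerivAt (fun x : Eu d => (-(‖x‖ ^ 2 / (4 * ε)) : ℝ))
    (-((4 * ε)⁻¹ • (2 • innerSL ℝ x : Eu d →L[ℝ] ℝ))) x := by
    refine ((hn.const_mul (4 * ε)⁻¹).neg).congr_of_eventuallyEq (Eventually.of_forall fun y => ?_)
    show -(‖y‖ ^ 2 / (4 * ε)) = -((4 * ε)⁻¹ * ‖y‖ ^ 2)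
    rw [div_eq_inv_mul]
  have h2 := (Complex.ofRealCLM.hasFDerivAt.comp x h1).cexp
  have h3 := ((hq.differentiable (by simp)) x).hasFDerivAt.mul h2
  have e : (fun x => q x * gau ε x) = fun x => q x * Complex.exp ((Complex.ofRealCLM ∘ fun x : Eu d => (-(‖x‖ ^ 2 / (4 * ε)) : ℝ)) x) := by
    funext y
    simp [gau]
  unfold pderivE
  rw [e]
  erw [h3.fderiv]
  simp [gau, EuclideanSpace.inner_single_right]
  ring

lemma gau_bound {K : Set (Eu d)} (hK : IsCompact K) (h0 : (0 : Eu d) ∉ K) (N : ℕ) :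
    ∃ C : ℝ, 0 ≤ C ∧ ∀ ε : ℝ, 0 < ε → ε ≤ 1 → ∀ x ∈ K, ‖gau ε x‖ ≤ C * ε ^ N := by
  have hpos : ∃ r : ℝ, 0 < r ∧ ∀ x ∈ K, r ≤ ‖x‖ := by
    have : Kᶜ ∈ 𝓝 (0 : Eu d) := hK.isClosed.isOpen_compl.mem_nhds h0
    obtain ⟨r, hr, h⟩ := Metric.mem_nhds_iff.1 this
    refine ⟨r, hr, fun x hx => ?_⟩
    by_contra hlt
    exact h (by simpa using hlt) hx
  obtain ⟨r, hr, h⟩ := hpos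
  refine ⟨N.factorial * (4 / r ^ 2) ^ N, by positivity, fun ε he he1 x hx => ?_⟩
  have e1 : ‖gau ε x‖ = Real.exp (-(‖x‖ ^ 2 / (4 * ε))) := by
    unfold gau
    rw [← Complex.ofReal_neg, Complex.norm_exp_ofReal]
  have hr2 : r ^ 2 / (4 * ε) ≤ ‖x‖ ^ 2 / (4 * ε) := by
    have := h x hx
    gcongr
  have ht : 0 < r ^ 2 / (4 * ε) := by positivity
  have h4 := Real.pow_div_factorial_le_exp _ ht.le N
  rw [e1]
  calc Real.exp (-(‖x‖ ^ 2 / (4 * ε))) ≤ Real.exp (-(r ^ 2 / (4 * ε))) := Real.exp_le_exp.2 (by linarith)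
    _ = (Real.exp (r ^ 2 / (4 * ε)))⁻¹ := Real.exp_neg _
    _ ≤ ((r ^ 2 / (4 * ε)) ^ N / N.factorial)⁻¹ := by
        apply inv_anti₀ _ h4
        positivity
    _ = _ := by
        have hN : (N.factorial : ℝ) ≠ 0 := by positivity
        rw [div_pow, div_pow, mul_pow]
        field_simp

lemma DW_gau_bound {K : Set (Eu d)} (hK : IsCompact K) (h0 : (0 : Eu d) ∉ K) (I : List (Fin d)) :
    ∀ q : Eu d → ℂ, ContDiff ℝ ∞ q → ∀ N : ℕ,
    ∃ C : ℝ, 0 ≤ C ∧ ∀ ε : ℝ, 0 < ε → ε ≤ 1 → ∀ x ∈ K,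
      ‖DW I (fun x => q x * gau ε x) x‖ ≤ C * ε ^ N := by
  induction I using List.reverseRecOn with
  | nil =>
    intro q hq N
    obtain ⟨C, hC, h⟩ := gau_bound hK h0 N
    obtain ⟨M, hM⟩ := hK.exists_bound_of_continuousOn hq.continuous.continuousOn
    refine ⟨|M| * C, by positivity, fun ε he he1 x hx => ?_⟩
    rw [DW_nil, norm_mul, mul_assoc]
    exact mul_le_mul ((hM x hx).trans (le_abs_self _)) (h ε he he1 x hx) (norm_nonneg _) (abs_nonneg _)
  | append_singleton I i ih =>
    intro q hq N
    have s2 : ContDiff ℝ ∞ (fun x : Eu d => -(x i / 2 : ℂ) * q x) :=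
      (((cx_smooth i).div_const _).neg).mul hq
    obtain ⟨C1, hC1, h1⟩ := ih (pderivE i q) (pderivE_smooth hq i) N
    obtain ⟨C2, hC2, h2⟩ := ih _ s2 (N+1)
    refine ⟨C1 + C2, by positivity, fun ε he he1 x hx => ?_⟩
    rw [DW_append, DW_cons, DW_nil, pderivE_mul_gau hq,
      DW_add ((pderivE_smooth hq i).mul (gau_smooth ε)) (contDiff_const.mul (s2.mul (gau_smooth ε)))]
    refine (norm_add_le _ _).trans ?_
    rw [add_mul]
    refine add_le_add (h1 ε he he1 x hx) ?_
    rw [DW_const_mul (s2.mul (gau_smooth ε)), norm_mul]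
    have := h2 ε he he1 x hx
    rw [norm_inv, Complex.norm_real, Real.norm_of_nonneg he.le]
    calc ε⁻¹ * _ ≤ ε⁻¹ * (C2 * ε ^ (N+1)) := mul_le_mul_of_nonneg_left this (by positivity)
      _ = C2 * ε ^ N := by rw [pow_succ]; field_simp

lemma heat_bound {K : Set (Eu d)} (hK : IsCompact K) (h0 : (0 : Eu d) ∉ K) (I : List (Fin d)) :
    ∃ C : ℝ, 0 ≤ C ∧ ∀ ε : ℝ, 0 < ε → ε ≤ 1 → ∀ x ∈ K, ‖DW I (heat ε) x‖ ≤ C * ε := by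
  obtain ⟨C, hC, h⟩ := DW_gau_bound hK h0 I (fun _ => 1) contDiff_const (d + 1)
  refine ⟨Real.pi ^ d * C, by positivity, fun ε he he1 x hx => ?_⟩
  have e : (heat ε : Eu d → ℂ) = fun x => ((Real.pi / ε : ℝ) : ℂ) ^ ((d:ℂ) / 2) * (1 * gau ε x) := by
    funext x
    rw [one_mul]; rfl
  rw [e, DW_const_mul (contDiff_const.mul (gau_smooth ε)), norm_mul]
  have hpi : 1 ≤ Real.pi / ε := by
    rw [le_div_iff₀ he]; linarith [Real.pi_gt_three]
  have hn : ‖((Real.pi / ε : ℝ) : ℂ) ^ ((d:ℂ) / 2)‖ ≤ (Real.pi / ε) ^ d := by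
    rw [Complex.norm_cpow_eq_rpow_re_of_pos (by linarith), ← Real.rpow_natCast]
    apply Real.rpow_le_rpow_of_exponent_le hpi
    have : ((d:ℂ)/2).re = (d:ℝ)/2 := by
      rw [show (d:ℂ)/2 = ((d/2 : ℝ) : ℂ) by push_cast; ring, Complex.ofReal_re]
    rw [this]
    have : (0:ℝ) ≤ d := by positivity
    linarith
  calc _ ≤ (Real.pi / ε) ^ d * (C * ε ^ (d+1)) :=
        mul_le_mul hn (h ε he he1 x hx) (norm_nonneg _) (by positivity)
    _ = _ := by rw [div_pow, pow_succ]; field_simp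

lemma ode_bound {f f' : ℝ → ℂ} {κ M a b : ℝ} (ha : 0 < a) (hab : a ≤ b) (hκ : κ ≠ 1)
    (hf : ∀ s ∈ Icc a b, HasDerivAt f (f' s) s) (hM : ∀ s ∈ Icc a b, ‖f' s‖ ≤ M * s ^ (-κ)) :
    ‖f b - f a‖ ≤ M * (b ^ (1 - κ) - a ^ (1 - κ)) / (1 - κ) := by
  have hk : 1 - κ ≠ 0 := by intro h; apply hκ; linarith
  have hB : ∀ s ∈ Icc a b, HasDerivAt (fun s : ℝ => M * (s ^ (1 - κ) - a ^ (1 - κ)) / (1 - κ))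
      (M * s ^ (-κ)) s := by
    intro s hs
    have h1 := (((Real.hasDerivAt_rpow_const (x := s) (p := 1 - κ)
      (Or.inl (ha.trans_le hs.1).ne')).sub_const
        (a ^ (1-κ))).const_mul M).div_const (1-κ)
    refine h1.congr_deriv ?_
    rw [show (1 - κ - 1) = -κ by ring]
    field_simp
  have := image_norm_le_of_norm_deriv_right_le_deriv_boundary' (f := fun s => f s - f a) (f' := f')
    (a := a) (b := b) (B := fun s : ℝ => M * (s ^ (1 - κ) - a ^ (1 - κ)) / (1 - κ))
    (B' := fun s => M * s ^ (-κ))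
    (fun s hs => ((hf s hs).sub_const _).continuousAt.continuousWithinAt)
    (fun s hs => ((hf s ⟨hs.1, hs.2.le⟩).sub_const _).hasDerivWithinAt)
    (by simp)
    (fun s hs => (hB s hs).continuousAt.continuousWithinAt)
    (fun s hs => (hB s ⟨hs.1, hs.2.le⟩).hasDerivWithinAt)
    (fun s hs => hM s ⟨hs.1, hs.2.le⟩)
  exact this (right_mem_Icc.2 hab)

variable (P : MvPolynomial (Fin d) ℂ) (i0 : Fin d)

def VV (I : List (Fin d)) (ε : ℝ) : Eu d → ℂ := UU P i0 ((I.map MvPolynomial.X).prod) ε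

lemma DW_VV (I : List (Fin d)) {ε : ℝ} (h0 : 0 < ε) (h1 : ε ≤ 1) :
    DW I (UU P i0 1 ε) = VV P i0 I ε := by
  rw [DW_UU P i0 1 h0 h1, one_mul]; rfl

lemma VV_smooth (I : List (Fin d)) {ε : ℝ} (h0 : 0 < ε) (h1 : ε ≤ 1) : ContDiff ℝ ∞ (VV P i0 I ε) :=
  UU_smooth P i0 _ h0 h1

lemma VV_hasDerivAt (I : List (Fin d)) {ε : ℝ} (h0 : 0 < ε) (h1 : ε ≤ 1) (x : Eu d) :
    HasDerivAt (fun e => VV P i0 I e x) (∑ k, VV P i0 (k :: k :: I) ε x) ε := by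
  refine (UU_hasDerivAt P i0 _ h0 h1 x).congr_deriv ?_
  have := UU_linear_sum P i0 Finset.univ (fun _ => 1) (fun k => ((k :: k :: I).map MvPolynomial.X).prod) h0 h1 x
  simp only [one_mul, map_one] at this
  unfold VV
  rw [← this]
  congr 1
  rw [Finset.mul_sum]
  refine Finset.sum_congr rfl fun k _ => ?_
  simp; ring

variable {P}

lemma VV_bound0 (hell : IsElliptic P) (hm : 1 ≤ P.totalDegree) {x0 : Eu d} {c0 : ℝ} (h0 : 0 < c0)
    (h1 : c0 ≤ 1) (hO : (0 : Eu d) ∉ Om x0 c0) :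
    ∃ K : ℕ, ∀ I : List (Fin d), ∃ C : ℝ, 0 ≤ C ∧ ∀ ε : ℝ, 0 < ε → ε ≤ 1 → ∀ x ∈ Om x0 (c0 / 4),
      ‖VV P i0 I ε x‖ ≤ C * (ε⁻¹) ^ K := by
  obtain ⟨R, hR⟩ := (Om_compact x0 c0).exists_bound_of_continuousOn (f := fun x => x) continuousOn_id
  have hb : ∀ I : List (Fin d), ∃ C : ℝ, 0 < C ∧ ∃ p : ℕ, ∀ ε : ℝ, 0 < ε → ε ≤ 1 →
      ∀ x ∈ Om x0 c0, ‖VV P i0 I ε x‖ ≤ C * (ε⁻¹) ^ p := by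
    intro I
    obtain ⟨C, hC, p, h⟩ := UU_bound P i0 ((I.map MvPolynomial.X).prod) R
    exact ⟨C, hC, p, fun ε e0 e1 x hx => h ε e0 e1 x (hR x hx)⟩
  choose C hC p hCp using hb
  choose H hH hHb using fun I => heat_bound (Om_compact x0 c0) hO I
  obtain ⟨D, hD, hintg⟩ := intEst hell hm x0 h0 h1
  have hfin : ∀ n, {I : List (Fin d) | I.length < n}.Finite := fun n => List.finite_length_lt (Fin d) n
  set S := (hfin P.totalDegree).toFinset
  refine ⟨∑ I ∈ S, p I, fun J => ?_⟩
  set N := J.length + d + 1 with hN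
  set T := (hfin (N+1)).toFinset
  set A0 := ∑ I ∈ S, C I + ∑ I ∈ T, ‖cst P i0‖ * H I + 1 with hA0
  have hCs : 0 ≤ ∑ I ∈ S, C I := Finset.sum_nonneg fun I _ => (hC I).le
  have hHs : 0 ≤ ∑ I ∈ T, ‖cst P i0‖ * H I :=
    Finset.sum_nonneg fun I _ => mul_nonneg (norm_nonneg _) (hH I)
  refine ⟨A0 * (D * N) ^ N, by positivity, fun ε e0 e1 x hx => ?_⟩
  have hei : 1 ≤ ε⁻¹ := (one_le_inv₀ e0).2 e1
  set E := (ε⁻¹) ^ (∑ I ∈ S, p I) with hE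
  have hE1 : 1 ≤ E := one_le_pow₀ hei
  have := hintg (UU P i0 1 ε) (UU_smooth P i0 1 e0 e1) (A0 * E) (by positivity) N (by omega) ?_ ?_ J
    le_rfl x hx
  · rw [DW_VV P i0 J e0 e1] at this
    linarith
  · intro I hI x hx
    have hIS : I ∈ S := by simpa [S] using hI
    rw [DW_VV P i0 I e0 e1]
    refine (hCp I ε e0 e1 x hx).trans (mul_le_mul ?_ ?_ (by positivity) (by positivity))
    · have := Finset.single_le_sum (f := C) (fun I _ => (hC I).le) hIS
      linarith
    · exact pow_le_pow_right₀ hei (Finset.single_le_sum (f := p) (fun _ _ => Nat.zero_le _) hIS)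
  · intro I hI x hx
    have hIT : I ∈ T := by simp [T]; omega
    have e : PDop P (UU P i0 1 ε) = fun x => cst P i0 * heat ε x := funext (PDop_UU P i0 e0 e1)
    have hs : ContDiff ℝ ∞ (heat ε : Eu d → ℂ) := contDiff_const.mul (gau_smooth ε)
    rw [e, DW_const_mul hs, norm_mul]
    have h2 := hHb I ε e0 e1 x hx
    have h3 := Finset.single_le_sum (f := fun I => ‖cst P i0‖ * H I)
      (fun I _ => mul_nonneg (norm_nonneg _) (hH I)) hIT
    have h4 : H I * ε ≤ H I := mul_le_of_le_one_right (hH I) e1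
    calc ‖cst P i0‖ * ‖DW I (heat ε) x‖ ≤ ‖cst P i0‖ * H I :=
          mul_le_mul_of_nonneg_left (h2.trans h4) (norm_nonneg _)
      _ ≤ A0 := by rw [hA0]; linarith
      _ ≤ A0 * E := le_mul_of_one_le_right (by positivity) hE1

lemma VV_improve {Ω : Set (Eu d)} {κ : ℝ} (hκ : 1 < κ)
    (h : ∀ I : List (Fin d), ∃ C : ℝ, 0 ≤ C ∧ ∀ ε : ℝ, 0 < ε → ε ≤ 1 → ∀ x ∈ Ω,
      ‖VV P i0 I ε x‖ ≤ C * ε ^ (-κ)) :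
    ∀ I : List (Fin d), ∃ C : ℝ, 0 ≤ C ∧ ∀ ε : ℝ, 0 < ε → ε ≤ 1 → ∀ x ∈ Ω,
      ‖VV P i0 I ε x‖ ≤ C * ε ^ (-(κ - 1)) := by
  intro I
  choose C hC hb using h
  have hS : 0 ≤ ∑ k, C (k :: k :: I) := Finset.sum_nonneg fun k _ => hC _
  refine ⟨C I + (∑ k, C (k :: k :: I)) / (κ - 1), add_nonneg (hC I) (div_nonneg hS (by linarith)),
    fun ε e0 e1 x hx => ?_⟩
  have h1 := ode_bound (f := fun e => VV P i0 I e x) (κ := κ) (M := ∑ k, C (k :: k :: I)) e0 e1 hκ.ne'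
    (fun s hs => VV_hasDerivAt P i0 I (e0.trans_le hs.1) hs.2 x) (fun s hs => by
      refine (norm_sum_le _ _).trans ?_
      rw [Finset.sum_mul]
      exact Finset.sum_le_sum fun k _ => hb _ s (e0.trans_le hs.1) hs.2 x hx)
  have h2 := hb I 1 one_pos le_rfl x hx
  rw [Real.one_rpow] at h1 h2
  have h3 : 1 ≤ ε ^ (-(κ - 1)) := Real.one_le_rpow_of_pos_of_le_one_of_nonpos e0 e1 (by linarith)
  have h4 : (∑ k, C (k :: k :: I)) * (1 - ε ^ (1 - κ)) / (1 - κ) ≤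
      (∑ k, C (k :: k :: I)) / (κ - 1) * ε ^ (-(κ - 1)) := by
    rw [show -(κ - 1) = 1 - κ by ring]
    have hk : κ - 1 ≠ 0 := by linarith
    have hk' : 1 - κ ≠ 0 := by intro hh; apply hk; linarith
    have : (∑ k, C (k :: k :: I)) * (1 - ε ^ (1 - κ)) / (1 - κ) =
      (∑ k, C (k :: k :: I)) / (κ - 1) * (ε ^ (1 - κ) - 1) := by
      field_simp; ring
    rw [this]
    refine mul_le_mul_of_nonneg_left (by linarith) (div_nonneg hS (by linarith))
  have h5 : ‖VV P i0 I ε x‖ ≤ ‖VV P i0 I 1 x‖ + ‖VV P i0 I 1 x - VV P i0 I ε x‖ := by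
    have := norm_sub_le (VV P i0 I 1 x) (VV P i0 I 1 x - VV P i0 I ε x)
    simpa using this
  rw [add_mul]
  have h6 : C I * 1 ≤ C I * ε ^ (-(κ - 1)) := mul_le_mul_of_nonneg_left h3 (hC I)
  linarith

lemma VV_cauchy (hell : IsElliptic P) (hm : 1 ≤ P.totalDegree) {x0 : Eu d} (hx0 : x0 ≠ 0) :
    ∃ c : ℝ, 0 < c ∧ ∀ I : List (Fin d), ∃ C : ℝ, 0 ≤ C ∧ ∀ a b : ℝ, 0 < a → a ≤ b → b ≤ 1 →
      ∀ x ∈ Om x0 c, ‖VV P i0 I b x - VV P i0 I a x‖ ≤ C * b ^ (1/2 : ℝ) := by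
  obtain ⟨c0, h0, h1, hO⟩ := exists_Om_sub (isOpen_compl_singleton (x := (0 : Eu d))) hx0
  obtain ⟨K, hK⟩ := VV_bound0 i0 hell hm h0 h1 (fun h => hO h rfl)
  refine ⟨c0 / 4, by positivity, ?_⟩
  have key : ∀ n : ℕ, n ≤ K → ∀ I : List (Fin d), ∃ C : ℝ, 0 ≤ C ∧ ∀ ε : ℝ, 0 < ε → ε ≤ 1 →
      ∀ x ∈ Om x0 (c0 / 4), ‖VV P i0 I ε x‖ ≤ C * ε ^ (-((K - n : ℕ) + 1/2 : ℝ)) := by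
    intro n
    induction n with
    | zero =>
      intro _ I
      obtain ⟨C, hC, h⟩ := hK I
      refine ⟨C, hC, fun ε e0 e1 x hx => (h ε e0 e1 x hx).trans (mul_le_mul_of_nonneg_left ?_ hC)⟩
      rw [inv_pow, ← Real.rpow_natCast, ← Real.rpow_neg e0.le]
      exact Real.rpow_le_rpow_of_exponent_ge e0 e1 (by simp)
    | succ n ih =>
      intro hn
      have := VV_improve i0 (Ω := Om x0 (c0/4)) (κ := ((K - n : ℕ) + 1/2 : ℝ)) (by
        have : (1:ℝ) ≤ (K - n : ℕ) := by exact_mod_cast (by omega : 1 ≤ K - n)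
        linarith) (ih (by omega))
      have e : (((K - n : ℕ) : ℝ) + 1/2) - 1 = ((K - (n+1) : ℕ) : ℝ) + 1/2 := by
        have : K - n = (K - (n+1)) + 1 := by omega
        rw [this]; push_cast; ring
      rwa [e] at this
  have key := key K le_rfl
  simp only [Nat.sub_self, Nat.cast_zero, zero_add] at key
  choose C hC hb using key
  intro I
  have hS : 0 ≤ ∑ k, C (k :: k :: I) := Finset.sum_nonneg fun k _ => hC _
  refine ⟨2 * ∑ k, C (k :: k :: I), by positivity, fun a b ha hab hb1 x hx => ?_⟩
  have h1 := ode_bound (f := fun e => VV P i0 I e x) (κ := 1/2) (M := ∑ k, C (k :: k :: I)) ha hab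
    (by norm_num)
    (fun s hs => VV_hasDerivAt P i0 I (ha.trans_le hs.1) (hs.2.trans hb1) x) (fun s hs => by
      refine (norm_sum_le _ _).trans ?_
      rw [Finset.sum_mul]
      exact Finset.sum_le_sum fun k _ => hb _ s (ha.trans_le hs.1) (hs.2.trans hb1) x hx)
  refine h1.trans ?_
  have h3 : 0 ≤ a ^ (1/2:ℝ) := Real.rpow_nonneg ha.le _
  rw [show (1 - 1/2 : ℝ) = 1/2 by norm_num]
  nlinarith

end sing
end
end Module9

section Module10
open scoped ContDiff Topology
open MeasureTheory Filter Set
noncomputable section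
section lim
variable {d : ℕ}

def Lk (a : Fin d → ℂ) : Eu d →L[ℝ] ℂ :=
  ∑ k, (EuclideanSpace.proj (𝕜 := ℝ) k : Eu d →L[ℝ] ℝ).smulRight (a k)

lemma Lk_apply (a : Fin d → ℂ) (x : Eu d) : Lk a x = ∑ k, (x k : ℂ) * a k := by
  simp [Lk]

lemma fderiv_eq_Lk (f : Eu d → ℂ) (x : Eu d) : fderiv ℝ f x = Lk (fun k => pderivE k f x) := by
  ext y
  have hy : y = ∑ k, y k • EuclideanSpace.single k (1:ℝ) := by
    ext i
    simp [Pi.single_apply]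
  rw [Lk_apply]
  conv_lhs => rw [hy]
  rw [map_sum]
  refine Finset.sum_congr rfl fun k _ => ?_
  rw [map_smul]
  simp [pderivE]

lemma norm_Lk_sub_le (a b : Fin d → ℂ) : ‖Lk a - Lk b‖ ≤ ∑ k, ‖a k - b k‖ := by
  refine ContinuousLinearMap.opNorm_le_bound _ (Finset.sum_nonneg fun _ _ => norm_nonneg _) fun x => ?_
  rw [sub_apply, Lk_apply, Lk_apply, ← Finset.sum_sub_distrib, Finset.sum_mul]
  refine (norm_sum_le _ _).trans (Finset.sum_le_sum fun k _ => ?_)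
  rw [← mul_sub, norm_mul, mul_comm, Complex.norm_real]
  exact mul_le_mul_of_nonneg_left (PiLp.norm_apply_le x k) (norm_nonneg _)

lemma Lk_contDiffOn {n : WithTop ℕ∞} {a : Fin d → Eu d → ℂ} {s : Set (Eu d)}
    (h : ∀ k, ContDiffOn ℝ n (a k) s) : ContDiffOn ℝ n (fun x => Lk (fun k => a k x)) s := by
  unfold Lk
  refine ContDiffOn.sum fun k _ => ?_
  exact ((ContinuousLinearMap.smulRightL ℝ (Eu d) ℂ
    (EuclideanSpace.proj (𝕜 := ℝ) k : Eu d →L[ℝ] ℝ)).contDiff).comp_contDiffOn (h k)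

def es (n : ℕ) : ℝ := 1 / ((n:ℝ) + 1)

lemma es_pos (n : ℕ) : 0 < es n := Nat.one_div_pos_of_nat
lemma es_le (n : ℕ) : es n ≤ 1 := by
  unfold es
  rw [div_le_one (by positivity)]
  linarith [(Nat.cast_nonneg n : (0:ℝ) ≤ n)]
lemma es_anti {n m : ℕ} (h : n ≤ m) : es m ≤ es n := Nat.one_div_le_one_div h
lemma es_tendsto : Tendsto es atTop (𝓝 0) := tendsto_one_div_add_atTop_nhds_zero_nat
lemma es_sqrt : Tendsto (fun n => es n ^ (1/2:ℝ)) atTop (𝓝 0) := by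
  have := es_tendsto.rpow_const (p := 1/2) (Or.inr (by norm_num))
  simpa [Real.zero_rpow] using this

variable {P : MvPolynomial (Fin d) ℂ}

theorem exists_F (hell : IsElliptic P) (hm : 1 ≤ P.totalDegree) (i0 : Fin d) :
    ∃ F : Eu d → ℂ, ∃ u : ℕ → Eu d → ℂ, (∀ n, ContDiff ℝ ∞ (u n)) ∧ MemCP P {0}ᶜ F ∧
      TendstoLocallyUniformlyOn u F atTop {0}ᶜ ∧
      ∀ n x, PDop P (u n) x = cst P i0 * heat (es n) x := by
  have hc : ∀ x : Eu d, ∀ I : List (Fin d), ∃ l : ℂ, x ≠ 0 →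
      Tendsto (fun n => VV P i0 I (es n) x) atTop (𝓝 l) := by
    intro x I
    by_cases hx : x = 0
    · exact ⟨0, fun h => absurd hx h⟩
    obtain ⟨c, hc, h⟩ := VV_cauchy i0 hell hm hx
    obtain ⟨C, hC, h⟩ := h I
    have hcau : CauchySeq (fun n => VV P i0 I (es n) x) := by
      refine cauchySeq_of_le_tendsto_0 (fun n => 2 * (C * es n ^ (1/2:ℝ))) ?_ ?_
      · intro n m N hn hm'
        have hxm : x ∈ Om x c := mem_of_mem_nhds (Om_mem_nhds x hc)
        have h1 := h (es n) (es N) (es_pos n) (es_anti hn) (es_le N) x hxm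
        have h2 := h (es m) (es N) (es_pos m) (es_anti hm') (es_le N) x hxm
        rw [← dist_eq_norm] at h1 h2
        have := dist_triangle_left (VV P i0 I (es n) x) (VV P i0 I (es m) x) (VV P i0 I (es N) x)
        linarith
      · simpa using (es_sqrt.const_mul C).const_mul 2
    obtain ⟨l, hl⟩ := cauchySeq_tendsto_of_complete hcau
    exact ⟨l, fun _ => hl⟩
  choose F0 hF using hc
  set F : List (Fin d) → Eu d → ℂ := fun I x => F0 x I with hFdef
  have hF : ∀ I x, x ≠ 0 → Tendsto (fun n => VV P i0 I (es n) x) atTop (𝓝 (F I x)) :=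
    fun I x hx => hF x I hx
  -- local uniform bounds
  have hunif : ∀ x0 : Eu d, x0 ≠ 0 → ∃ t ∈ 𝓝 x0, ∀ I, ∃ C : ℝ, ∀ n, ∀ x ∈ t,
      ‖F I x - VV P i0 I (es n) x‖ ≤ C * es n ^ (1/2:ℝ) := by
    intro x0 hx0
    obtain ⟨c, hc, h⟩ := VV_cauchy i0 hell hm hx0
    refine ⟨Om x0 c ∩ {0}ᶜ, inter_mem (Om_mem_nhds x0 hc) (isOpen_compl_singleton.mem_nhds hx0), ?_⟩
    intro I
    obtain ⟨C, hC, h⟩ := h I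
    refine ⟨C, fun n x hx => ?_⟩
    have ht := ((hF I x hx.2).sub_const (VV P i0 I (es n) x)).norm
    refine le_of_tendsto ht ?_
    filter_upwards [eventually_ge_atTop n] with m hm'
    rw [norm_sub_rev]
    exact h (es m) (es n) (es_pos m) (es_anti hm') (es_le n) x hx.1
  have hloc : ∀ I, TendstoLocallyUniformlyOn (fun n => VV P i0 I (es n)) (F I) atTop {0}ᶜ := by
    intro I
    rw [Metric.tendstoLocallyUniformlyOn_iff]
    intro δ hδ x hx
    obtain ⟨t, ht, h⟩ := hunif x hx
    obtain ⟨C, h⟩ := h I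
    refine ⟨t, mem_nhdsWithin_of_mem_nhds ht, ?_⟩
    have h1 : Tendsto (fun n => C * es n ^ (1/2:ℝ)) atTop (𝓝 0) := by simpa using es_sqrt.const_mul C
    filter_upwards [h1.eventually (gt_mem_nhds hδ)] with n hn y hy
    rw [dist_eq_norm]
    exact (h n y hy).trans_lt hn
  have hloc' : ∀ I, TendstoLocallyUniformlyOn (fun n x => Lk fun k => VV P i0 (k :: I) (es n) x)
      (fun x => Lk fun k => F (k :: I) x) atTop {0}ᶜ := by
    intro I
    rw [Metric.tendstoLocallyUniformlyOn_iff]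
    intro δ hδ x hx
    obtain ⟨t, ht, h⟩ := hunif x hx
    choose C h using h
    refine ⟨t, mem_nhdsWithin_of_mem_nhds ht, ?_⟩
    have h1 : Tendsto (fun n => ∑ k, C (k :: I) * es n ^ (1/2:ℝ)) atTop (𝓝 0) := by
      have := tendsto_finsetSum Finset.univ (fun k _ => es_sqrt.const_mul (C (k :: I)))
      simpa using this
    filter_upwards [h1.eventually (gt_mem_nhds hδ)] with n hn y hy
    rw [dist_eq_norm]
    refine (norm_Lk_sub_le _ _).trans_lt (lt_of_le_of_lt ?_ hn)
    exact Finset.sum_le_sum fun k _ => h _ n y hy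
  have hder : ∀ I x, x ≠ 0 → HasFDerivAt (F I) (Lk fun k => F (k :: I) x) x := by
    intro I x hx
    refine hasFDerivAt_of_tendstoLocallyUniformlyOn isOpen_compl_singleton (hloc' I)
      (fun n y _ => ?_) (fun y hy => hF I y hy) hx
    have h1 := ((VV_smooth P i0 I (es_pos n) (es_le n)).differentiable (by simp) y).hasFDerivAt
    rw [fderiv_eq_Lk] at h1
    refine h1.congr_fderiv ?_
    congr 1
    funext k
    rw [← DW_VV P i0 I (es_pos n) (es_le n), ← DW_VV P i0 (k :: I) (es_pos n) (es_le n), DW_cons]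
  have hcd : ∀ n : ℕ, ∀ I, ContDiffOn ℝ n (F I) {0}ᶜ := by
    intro n
    induction n with
    | zero =>
      intro I
      rw [show ((0:ℕ) : WithTop ℕ∞) = 0 from rfl, contDiffOn_zero]
      exact fun x hx => (hder I x hx).continuousAt.continuousWithinAt
    | succ n ih =>
      intro I
      rw [show ((n+1:ℕ) : WithTop ℕ∞) = (n : WithTop ℕ∞) + 1 by push_cast; rfl,
        contDiffOn_succ_iff_fderiv_of_isOpen isOpen_compl_singleton]
      refine ⟨fun x hx => (hder I x hx).differentiableAt.differentiableWithinAt, by simp, ?_⟩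
      refine (Lk_contDiffOn (fun k => ih (k :: I))).congr fun x hx => ?_
      exact (hder I x hx).fderiv
  have hDW : ∀ I x, x ≠ 0 → DW I (F []) x = F I x := by
    intro I
    induction I with
    | nil => intro x hx; rfl
    | cons k I ih =>
      intro x hx
      have hev : DW I (F []) =ᶠ[𝓝 x] F I := by
        filter_upwards [isOpen_compl_singleton.mem_nhds hx] with y hy using ih y hy
      rw [DW_cons]
      unfold pderivE
      rw [hev.fderiv_eq, (hder I x hx).fderiv, Lk_apply]
      rw [Finset.sum_eq_single k (fun b _ hb => by simp [hb]) (by simp)]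
      simp
  refine ⟨F [], fun n => UU P i0 1 (es n), fun n => UU_smooth P i0 1 (es_pos n) (es_le n),
    ⟨?_, ?_⟩, ?_, fun n x => PDop_UU P i0 (es_pos n) (es_le n) x⟩
  · exact contDiffOn_infty.2 fun n => hcd n []
  · intro x hx
    have h1 : Tendsto (fun n => PDop P (UU P i0 1 (es n)) x) atTop (𝓝 (PDop P (F []) x)) := by
      simp_rw [PDop_eq]
      refine tendsto_finsetSum _ fun α _ => Tendsto.const_mul _ ?_
      rw [hDW _ x hx]
      refine (hF _ x hx).congr fun n => ?_
      rw [DW_VV P i0 _ (es_pos n) (es_le n)]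
    have h2 : Tendsto (fun n => PDop P (UU P i0 1 (es n)) x) atTop (𝓝 0) := by
      obtain ⟨C, hC, h⟩ := heat_bound (K := {x}) isCompact_singleton (fun h => hx h.symm) []
      rw [tendsto_zero_iff_norm_tendsto_zero]
      refine squeeze_zero (fun _ => norm_nonneg _) (g := fun n => ‖cst P i0‖ * (C * es n)) (fun n => ?_) ?_
      · rw [PDop_UU P i0 (es_pos n) (es_le n), norm_mul]
        exact mul_le_mul_of_nonneg_left (h _ (es_pos n) (es_le n) x rfl) (norm_nonneg _)
      · simpa using (es_tendsto.const_mul C).const_mul ‖cst P i0‖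
    exact tendsto_nhds_unique h1 h2
  · have := hloc []
    simpa [VV] using this

end lim
end
end Module10

section Module11
open scoped ContDiff Topology
open MeasureTheory Filter Set
noncomputable section
section ext
variable {d : ℕ}

lemma hcs_pderivE {χ : Eu d → ℂ} (h : HasCompactSupport χ) (k : Fin d) :
    HasCompactSupport (pderivE k χ) := h.fderiv_apply (𝕜 := ℝ) _

lemma hcs_DW {χ : Eu d → ℂ} (h : HasCompactSupport χ) (I : List (Fin d)) :
    HasCompactSupport (DW I χ) := by
  induction I with
  | nil => exact h
  | cons k I ih => exact hcs_pderivE ih k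

lemma int_mul {u χ : Eu d → ℂ} (hu : Continuous u) (hχ : Continuous χ) (hc : HasCompactSupport χ) :
    Integrable (fun x => u x * χ x) := by
  exact (hu.mul hχ).integrable_of_hasCompactSupport hc.mul_left

lemma ibp1 {u χ : Eu d → ℂ} (hu : ContDiff ℝ ∞ u) (hχ : ContDiff ℝ ∞ χ) (hc : HasCompactSupport χ)
    (k : Fin d) : ∫ x, pderivE k u x * χ x = -∫ x, u x * pderivE k χ x := by
  have h := integral_mul_fderiv_eq_neg_fderiv_mul_of_integrable (μ := (volume : Measure (Eu d)))
    (f := u) (g := χ) (v := EuclideanSpace.single k 1)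
    (int_mul (pderivE_smooth hu k).continuous hχ.continuous hc)
    (int_mul hu.continuous (pderivE_smooth hχ k).continuous (hcs_pderivE hc k))
    (int_mul hu.continuous hχ.continuous hc)
    (fun x _ => hu.differentiable (by simp) x) (fun x _ => hχ.differentiable (by simp) x)
  unfold pderivE
  rw [h, neg_neg]

lemma ibp {u : Eu d → ℂ} (hu : ContDiff ℝ ∞ u) (I : List (Fin d)) :
    ∀ χ : Eu d → ℂ, ContDiff ℝ ∞ χ → HasCompactSupport χ →
    ∫ x, DW I u x * χ x = (-1) ^ I.length * ∫ x, u x * DW I χ x := by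
  induction I with
  | nil => intro χ _ _; simp
  | cons k I ih =>
    intro χ hχ hc
    rw [DW_cons, ibp1 (DW_smooth hu I) hχ hc, ih _ (pderivE_smooth hχ k) (hcs_pderivE hc k)]
    have : DW I (pderivE k χ) = DW (k :: I) χ := DW_comm hχ I [k]
    rw [this, List.length_cons, pow_succ]
    ring

/-- transposed operator -/
def PT (P : MvPolynomial (Fin d) ℂ) (χ : Eu d → ℂ) (x : Eu d) : ℂ :=
  ∑ α ∈ P.support, P.coeff α * ((-1) ^ (word fun i => α i).length * DW (word fun i => α i) χ x)

variable (P : MvPolynomial (Fin d) ℂ)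

lemma PT_smooth {χ : Eu d → ℂ} (hχ : ContDiff ℝ ∞ χ) : ContDiff ℝ ∞ (PT P χ) :=
  ContDiff.sum fun α _ => contDiff_const.mul (contDiff_const.mul (DW_smooth hχ _))

lemma ibp_PD {u χ : Eu d → ℂ} (hu : ContDiff ℝ ∞ u) (hχ : ContDiff ℝ ∞ χ) (hc : HasCompactSupport χ) :
    ∫ x, PDop P u x * χ x = ∫ x, u x * PT P χ x := by
  have e1 : ∀ x, PDop P u x * χ x = ∑ α ∈ P.support, P.coeff α * (DW (word fun i => α i) u x * χ x) := by
    intro x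
    rw [PDop_eq, Finset.sum_mul]
    exact Finset.sum_congr rfl fun α _ => by ring
  have e2 : ∀ x, u x * PT P χ x = ∑ α ∈ P.support, P.coeff α * ((-1) ^ (word fun i => α i).length *
      (u x * DW (word fun i => α i) χ x)) := by
    intro x
    rw [PT, Finset.mul_sum]
    exact Finset.sum_congr rfl fun α _ => by ring
  simp_rw [e1, e2]
  rw [integral_finsetSum _ (fun α _ => (int_mul (DW_smooth hu _).continuous hχ.continuous hc).const_mul _),
    integral_finsetSum _ (fun α _ => ((int_mul hu.continuous (DW_smooth hχ _).continuous
      (hcs_DW hc _)).const_mul _).const_mul _)]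
  refine Finset.sum_congr rfl fun α _ => ?_
  rw [integral_const_mul, integral_const_mul, integral_const_mul, ibp hu _ χ hχ hc]

lemma PT_hcs {χ : Eu d → ℂ} (hc : HasCompactSupport χ) : HasCompactSupport (PT P χ) := by
  refine hc.of_isClosed_subset (isClosed_tsupport _) (closure_minimal ?_ (isClosed_tsupport _))
  intro x hx
  by_contra hxn
  apply hx
  have hev : χ =ᶠ[𝓝 x] fun _ => 0 := notMem_tsupport_iff_eventuallyEq.1 hxn
  unfold PT
  refine Finset.sum_eq_zero fun α _ => ?_
  have := DW_congr hev (word fun i => α i)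
  rw [this.eq_of_nhds, DW_zero]
  simp

lemma DW_const {c : ℂ} {I : List (Fin d)} (hI : I ≠ []) : DW I (fun _ => c) = fun _ => 0 := by
  obtain ⟨J, k, rfl⟩ : ∃ J k, I = J ++ [k] := ⟨_, _, (List.dropLast_append_getLast hI).symm⟩
  rw [DW_append, DW_cons, DW_nil]
  have : pderivE k (fun _ : Eu d => c) = fun _ => 0 := by
    funext x; simp [pderivE]
  rw [this]
  exact DW_zero J

variable {P}

lemma coeff_zero_of_eval (hP0 : MvPolynomial.eval (fun _ => (0 : ℂ)) P = 0) : P.coeff 0 = 0 := by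
  have : MvPolynomial.eval (fun _ => (0 : ℂ)) P = MvPolynomial.constantCoeff P := by
    rw [MvPolynomial.constantCoeff_eq]
    exact congrFun (congrArg DFunLike.coe MvPolynomial.eval_zero') P |>.trans (by simp [MvPolynomial.constantCoeff_eq])
  rw [← MvPolynomial.constantCoeff_eq, ← this, hP0]

lemma word_ne_nil {α : Fin d →₀ ℕ} (h : α ≠ 0) : (word fun i => α i) ≠ [] := by
  intro hn
  apply h
  have := length_word (fun i => α i)
  rw [hn, List.length_nil] at this
  ext i
  exact (Finset.sum_eq_zero_iff.1 this.symm) i (Finset.mem_univ i)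

lemma PDop_const (hP0 : MvPolynomial.eval (fun _ => (0 : ℂ)) P = 0) (c : ℂ) (x : Eu d) :
    PDop P (fun _ => c) x = 0 := by
  rw [PDop_eq]
  refine Finset.sum_eq_zero fun α hα => ?_
  have h0 : α ≠ 0 := by
    rintro rfl
    exact (MvPolynomial.mem_support_iff.1 hα) (coeff_zero_of_eval hP0)
  rw [DW_const (word_ne_nil h0), mul_zero]

lemma PT_one (hP0 : MvPolynomial.eval (fun _ => (0 : ℂ)) P = 0) {χ : Eu d → ℂ} {x : Eu d}
    (h : χ =ᶠ[𝓝 x] fun _ => 1) : PT P χ x = 0 := by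
  refine Finset.sum_eq_zero fun α hα => ?_
  have h0 : α ≠ 0 := by
    rintro rfl
    exact (MvPolynomial.mem_support_iff.1 hα) (coeff_zero_of_eval hP0)
  rw [(DW_congr h _).eq_of_nhds, DW_const (word_ne_nil h0)]
  simp

lemma heat_real {ε : ℝ} (he : 0 < ε) (x : Eu d) : heat ε x =
    (((Real.pi / ε) ^ ((d:ℝ)/2) * Real.exp (-(‖x‖ ^ 2 / (4 * ε))) : ℝ) : ℂ) := by
  unfold heat
  rw [Complex.ofReal_mul, Complex.ofReal_cpow (by positivity)]
  push_cast
  rfl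

lemma heat_int_lower {r : ℝ} (hr : 0 < r) {f : Eu d → ℝ} (hf : Continuous f) (hfc : HasCompactSupport f)
    (hf0 : ∀ x, 0 ≤ f x) (hf1 : ∀ x, ‖x‖ < r → f x = 1) :
    ∃ κ : ℝ, 0 < κ ∧ ∀ ε : ℝ, 0 < ε → ε ≤ r ^ 2 → κ ≤ ‖∫ x, heat ε x * (f x : ℂ)‖ := by
  set v := volume.real (Metric.ball (0 : Eu d) 1) with hv
  have hvpos : 0 < v := by
    rw [hv, measureReal_def]
    exact ENNReal.toReal_pos (Metric.measure_ball_pos _ _ one_pos).ne' measure_ball_lt_top.ne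
  refine ⟨Real.pi ^ ((d:ℝ)/2) * Real.exp (-(1/4)) * v, by positivity, fun ε he her => ?_⟩
  have e : ∀ x : Eu d, heat ε x * (f x : ℂ) =
      (((Real.pi / ε) ^ ((d:ℝ)/2) * Real.exp (-(‖x‖ ^ 2 / (4 * ε))) * f x : ℝ) : ℂ) := by
    intro x
    rw [heat_real he, ← Complex.ofReal_mul]
  simp_rw [e]
  rw [integral_complex_ofReal, Complex.norm_real]
  refine le_trans ?_ (le_abs_self _)
  set c := (Real.pi / ε) ^ ((d:ℝ)/2) * Real.exp (-(1/4)) with hc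
  have hintg : Integrable (fun x : Eu d => (Real.pi / ε) ^ ((d:ℝ)/2) * Real.exp (-(‖x‖ ^ 2 / (4 * ε))) * f x) := by
    refine Continuous.integrable_of_hasCompactSupport ?_ hfc.mul_left
    fun_prop
  have h1 : ∫ x in Metric.ball (0 : Eu d) (√ε), c ≤ ∫ x in Metric.ball (0 : Eu d) (√ε),
      (Real.pi / ε) ^ ((d:ℝ)/2) * Real.exp (-(‖x‖ ^ 2 / (4 * ε))) * f x := by
    refine setIntegral_mono_on (integrableOn_const measure_ball_lt_top.ne) hintg.integrableOn
      measurableSet_ball fun x hx => ?_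
    have hx' : ‖x‖ < √ε := by simpa using hx
    have hsq : √ε ≤ r := by
      rw [Real.sqrt_le_left hr.le]; exact her
    rw [hf1 x (hx'.trans_le hsq), mul_one, hc]
    refine mul_le_mul_of_nonneg_left (Real.exp_le_exp.2 (neg_le_neg ?_)) (by positivity)
    rw [div_le_div_iff₀ (by positivity) (by norm_num)]
    have : ‖x‖ ^ 2 ≤ ε := by
      rw [← Real.sq_sqrt he.le]
      exact pow_le_pow_left₀ (norm_nonneg _) hx'.le 2
    linarith
  have h2 := setIntegral_le_integral (s := Metric.ball (0 : Eu d) (√ε)) hintg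
    (Eventually.of_forall fun x => mul_nonneg (by positivity) (hf0 x))
  refine le_trans (le_of_eq ?_) (h1.trans h2)
  rw [setIntegral_const, smul_eq_mul, measureReal_def,
    Measure.addHaar_ball_of_pos volume _ (Real.sqrt_pos.2 he), ENNReal.toReal_mul,
    ENNReal.toReal_ofReal (by positivity), finrank_euclideanSpace_fin, hc, hv, measureReal_def,
    Real.div_rpow Real.pi_pos.le he.le, Real.sqrt_eq_rpow, ← Real.rpow_natCast, ← Real.rpow_mul he.le]
  have : ε ^ ((d:ℝ)/2) ≠ 0 := (Real.rpow_pos_of_pos he _).ne'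
  rw [show 1 / 2 * (d:ℝ) = (d:ℝ)/2 by ring]
  field_simp

theorem not_ext (hd : 2 ≤ d) (hell : IsElliptic P) (hm : 1 ≤ P.totalDegree)
    (hP0 : MvPolynomial.eval (fun _ => (0 : ℂ)) P = 0) :
    ∃ F : Eu d → ℂ, MemCP P {0}ᶜ F ∧ ∀ r : ℝ, 0 < r → ∀ G : Eu d → ℂ,
      ContDiffOn ℝ ∞ G (Metric.ball 0 r) → ¬ EqOn G F (Metric.ball 0 r \ {0}) := by
  set i0 : Fin d := ⟨0, by omega⟩
  have : Nontrivial (Eu d) := by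
    have : Nonempty (Fin d) := ⟨i0⟩
    infer_instance
  obtain ⟨F, u, hus, hF, hloc, hPu⟩ := exists_F hell hm i0
  refine ⟨F, hF, fun r hr G hG hGF => ?_⟩
  let b : ContDiffBump (0 : Eu d) := ⟨r/4, r/2, by positivity, by linarith⟩
  set χ : Eu d → ℂ := fun x => ((b x : ℝ) : ℂ) with hχ
  have hχs : ContDiff ℝ ∞ χ := Complex.ofRealCLM.contDiff.comp b.contDiff
  have hχc : HasCompactSupport χ := b.hasCompactSupport.comp_left (g := fun t : ℝ => (t : ℂ)) (by simp)
  have hχ1 : ∀ x, ‖x‖ < r/4 → χ x = 1 := by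
    intro x hx
    have : b x = 1 := b.one_of_mem_closedBall (by simpa using hx.le)
    simp [hχ, this]
  set g := PT P χ with hg
  have hgs : ContDiff ℝ ∞ g := PT_smooth P hχs
  have hgc : HasCompactSupport g := PT_hcs P hχc
  have hg0 : ∀ x, ‖x‖ < r/4 → g x = 0 := by
    intro x hx
    refine PT_one hP0 ?_
    filter_upwards [Metric.isOpen_ball.mem_nhds (show x ∈ Metric.ball (0 : Eu d) (r/4) by simpa using hx)] with y hy
    exact hχ1 y (by simpa using hy)
  have h0g : (0 : Eu d) ∉ tsupport g := by
    rw [notMem_tsupport_iff_eventuallyEq]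
    filter_upwards [Metric.ball_mem_nhds (0 : Eu d) (show 0 < r/4 by positivity)] with y hy
    exact hg0 y (by simpa using hy)
  have hK : tsupport g ⊆ {0}ᶜ := fun x hx h => h0g (by rw [mem_singleton_iff] at h; rwa [← h])
  -- convergence
  have hlim : Tendsto (fun n => ∫ x, u n x * g x) atTop (𝓝 (∫ x, F x * g x)) := by
    obtain ⟨M, hM⟩ := IsCompact.exists_bound_of_continuousOn (s := tsupport g) hgc (hF.1.continuousOn.mono hK)
    have hun := (tendstoLocallyUniformlyOn_iff_tendstoUniformlyOn_of_compact (s := tsupport g) hgc).1 (hloc.mono hK)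
    rw [Metric.tendstoUniformlyOn_iff] at hun
    refine tendsto_integral_filter_of_dominated_convergence (fun x => (M + 1) * ‖g x‖) ?_ ?_ ?_ ?_
    · exact Eventually.of_forall fun n => ((hus n).continuous.mul hgs.continuous).aestronglyMeasurable
    · filter_upwards [hun 1 one_pos] with n hn
      refine Eventually.of_forall fun x => ?_
      by_cases hx : x ∈ tsupport g
      · rw [norm_mul]
        refine mul_le_mul_of_nonneg_right ?_ (norm_nonneg _)
        have h1 := hn x hx
        rw [dist_eq_norm] at h1
        have h2 := norm_sub_le (F x) (F x - u n x)
        rw [sub_sub_cancel] at h2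
        linarith [hM x hx]
      · simp [image_eq_zero_of_notMem_tsupport hx]
    · exact ((hgs.continuous.integrable_of_hasCompactSupport hgc).norm).const_mul _
    · refine Eventually.of_forall fun x => ?_
      by_cases hx : x ∈ tsupport g
      · exact (hloc.tendsto_at (hK hx)).mul_const _
      · simp [image_eq_zero_of_notMem_tsupport hx]
  obtain ⟨κ, hκ, hlow⟩ := heat_int_lower (d := d) (r := r/4) (by positivity) b.continuous b.hasCompactSupport
    (fun x => b.nonneg) (fun x hx => b.one_of_mem_closedBall (by simpa using hx.le))
  have hne : ‖cst P i0‖ * κ ≤ ‖∫ x, F x * g x‖ := by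
    refine ge_of_tendsto hlim.norm ?_
    have hev := es_tendsto.eventually (gt_mem_nhds (show (0:ℝ) < (r/4)^2 by positivity))
    filter_upwards [hev] with n hn
    rw [← ibp_PD P (hus n) hχs hχc]
    simp_rw [hPu, mul_assoc]
    rw [integral_const_mul, norm_mul]
    exact mul_le_mul_of_nonneg_left (hlow _ (es_pos n) hn.le) (norm_nonneg _)
  have hpos : 0 < ‖cst P i0‖ * κ := mul_pos (norm_pos_iff.2 (cst_ne hell i0)) hκ
  -- extension
  classical
  set F1 : Eu d → ℂ := Function.update F 0 (G 0) with hF1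
  have hF1F : ∀ x, x ≠ 0 → F1 x = F x := fun x hx => Function.update_of_ne hx _ _
  have hF1G : ∀ x ∈ Metric.ball (0 : Eu d) r, F1 x = G x := by
    intro x hx
    by_cases h : x = 0
    · rw [h, hF1, Function.update_self]
    · rw [hF1F x h]
      exact (hGF ⟨hx, h⟩).symm
  have hF1s : ContDiff ℝ ∞ F1 := by
    rw [contDiff_iff_contDiffAt]
    intro x
    by_cases h : x = 0
    · have hx : x ∈ Metric.ball (0 : Eu d) r := by rw [h]; exact Metric.mem_ball_self hr
      refine (hG.contDiffAt (Metric.isOpen_ball.mem_nhds hx)).congr_of_eventuallyEq ?_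
      filter_upwards [Metric.isOpen_ball.mem_nhds hx] with y hy using hF1G y hy
    · refine (hF.1.contDiffAt (isOpen_compl_singleton.mem_nhds h)).congr_of_eventuallyEq ?_
      filter_upwards [isOpen_compl_singleton.mem_nhds h] with y hy using hF1F y hy
  have hP1 : ∀ x, x ≠ 0 → PDop P F1 x = 0 := by
    intro x hx
    rw [← hF.2 x hx]
    refine (PDop_congr P ?_).eq_of_nhds
    filter_upwards [isOpen_compl_singleton.mem_nhds hx] with y hy using hF1F y hy
  have hP2 : PDop P F1 = fun _ => 0 := by
    refine Continuous.ext_on (s := {(0 : Eu d)}ᶜ) (dense_compl_singleton 0) (PDop_smooth P hF1s).continuous continuous_const ?_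
    exact fun x hx => hP1 x hx
  have h1 := ibp_PD P hF1s hχs hχc
  rw [hP2] at h1
  have h2 : ∫ x, F1 x * PT P χ x = ∫ x, F x * g x := by
    congr 1
    funext x
    by_cases h : x = 0
    · have : g x = 0 := hg0 x (by rw [h, norm_zero]; positivity)
      rw [← hg, this, mul_zero, mul_zero]
    · rw [hF1F x h]
  rw [h2] at h1
  rw [← h1] at hne
  simp only [zero_mul, integral_zero, norm_zero] at hne
  linarith

end ext
end
end Module11

section Module12
open scoped ContDiff Topology
open MeasureTheory Filter Set
noncomputable section
section roots
variable {d : ℕ}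

lemma deg_pos {P : MvPolynomial (Fin d) ℂ} (hd : 2 ≤ d) (hell : IsElliptic P)
    (hP0 : MvPolynomial.eval (fun _ => (0 : ℂ)) P = 0) : 1 ≤ P.totalDegree := by
  by_contra h
  have h0 : P.totalDegree = 0 := by omega
  have hc := MvPolynomial.totalDegree_eq_zero_iff_eq_C.1 h0
  rw [coeff_zero_of_eval hP0, map_zero] at hc
  have := hell (fun _ => 1) (fun hh => by
    have := congrFun hh ⟨0, by omega⟩
    simp at this)
  rw [hc] at this
  simp at this

def lin (ν a : Fin d → ℂ) (i : Fin d) : Polynomial ℂ :=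
  Polynomial.C (ν i) * Polynomial.X + Polynomial.C (a i)

lemma lin_mono (α : Fin d → ℕ) (ν a : Fin d → ℂ) {m : ℕ} (hα : ∑ i, α i ≤ m) :
    (∏ i, lin ν a i ^ α i).natDegree ≤ m ∧ (∏ i, lin ν a i ^ α i).coeff m =
      if ∑ i, α i = m then ∏ i, ν i ^ α i else 0 := by
  rw [← prod_word α (lin ν a), ← prod_word α ν]
  set l : List (Polynomial ℂ) := (word α).map (lin ν a) with hl
  have hll : l.length = ∑ i, α i := by rw [hl, List.length_map, length_word]
  have hdeg1 : ∀ p ∈ l, p.natDegree ≤ 1 := by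
    intro p hp
    obtain ⟨i, -, rfl⟩ := List.mem_map.1 hp
    unfold lin
    compute_degree
  have hdeg : l.prod.natDegree ≤ ∑ i, α i := by
    refine (Polynomial.natDegree_list_prod_le l).trans ?_
    rw [← hll]
    have := List.sum_le_card_nsmul (l.map Polynomial.natDegree) 1 (by
      intro x hx
      obtain ⟨p, hp, rfl⟩ := List.mem_map.1 hx
      exact hdeg1 p hp)
    simpa using this
  refine ⟨hdeg.trans hα, ?_⟩
  split_ifs with hm
  · have hc := Polynomial.coeff_list_prod_of_natDegree_le l 1 hdeg1
    rw [mul_one, hll, hm] at hc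
    rw [hc, hl, List.map_map]
    congr 2
    funext i
    simp [lin, Polynomial.coeff_C]
  · exact Polynomial.coeff_eq_zero_of_natDegree_lt (by omega)

def line (Q : MvPolynomial (Fin d) ℂ) (ν a : Fin d → ℂ) : Polynomial ℂ :=
  ∑ α ∈ Q.support, Polynomial.C (Q.coeff α) * ∏ i, lin ν a i ^ α i

lemma eval_line (Q : MvPolynomial (Fin d) ℂ) (ν a : Fin d → ℂ) (s : ℂ) :
    (line Q ν a).eval s = MvPolynomial.eval (fun i => ν i * s + a i) Q := by
  rw [MvPolynomial.eval_eq', line, Polynomial.eval_finsetSum]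
  refine Finset.sum_congr rfl fun α _ => ?_
  rw [Polynomial.eval_mul, Polynomial.eval_C, Polynomial.eval_prod]
  simp [lin]

lemma line_deg {Q : MvPolynomial (Fin d) ℂ} {m : ℕ} (hQ : Q.totalDegree ≤ m) (ν a : Fin d → ℂ) :
    (line Q ν a).natDegree ≤ m ∧
      (line Q ν a).coeff m = MvPolynomial.eval ν (MvPolynomial.homogeneousComponent m Q) := by
  constructor
  · refine Polynomial.natDegree_sum_le_of_forall_le _ _ fun α hα => ?_
    refine (Polynomial.natDegree_C_mul_le _ _).trans ?_
    exact (lin_mono (fun i => α i) ν a ((sum_le_totalDegree hα).trans hQ)).1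
  · rw [line, Polynomial.finsetSum_coeff, MvPolynomial.homogeneousComponent_apply, map_sum,
      Finset.sum_filter]
    refine Finset.sum_congr rfl fun α hα => ?_
    rw [Polynomial.coeff_C_mul, (lin_mono (fun i => α i) ν a ((sum_le_totalDegree hα).trans hQ)).2,
      Finsupp.degree_eq_sum, MvPolynomial.eval_monomial, Finsupp.prod_fintype _ _ (fun i => pow_zero _)]
    split_ifs <;> simp

lemma near_root (r : Polynomial ℂ) (x : ℂ) {t : ℝ} (ht : 0 ≤ t)
    (h : ‖r.eval x‖ < ‖r.leadingCoeff‖ * t ^ r.natDegree) : ∃ z, r.eval z = 0 ∧ ‖x - z‖ < t := by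
  by_contra hcon
  push Not at hcon
  have hr0 : r ≠ 0 := by
    rintro rfl
    simp at h
  have hs := IsAlgClosed.splits r
  have e := hs.eval_eq_prod_roots x
  rw [e, norm_mul, hs.natDegree_eq_card_roots] at h
  have key : ∀ s : Multiset ℂ, (∀ z ∈ s, t ≤ ‖x - z‖) →
      t ^ Multiset.card s ≤ ‖(s.map fun a => x - a).prod‖ := by
    intro s
    induction s using Multiset.induction with
    | empty => intro _; simp
    | cons a s ih =>
      intro hs
      rw [Multiset.card_cons, Multiset.map_cons, Multiset.prod_cons, norm_mul, pow_succ, mul_comm]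
      exact mul_le_mul (hs a (Multiset.mem_cons_self a s))
        (ih fun z hz => hs z (Multiset.mem_cons_of_mem hz)) (by positivity) (norm_nonneg _)
  have := key r.roots fun z hz => hcon z ((Polynomial.mem_roots hr0).1 hz)
  exact absurd h (not_lt.2 (mul_le_mul_of_nonneg_left this (norm_nonneg _)))

lemma exists_indep (hd : 2 ≤ d) (ν : Fin d → ℝ) : ∃ η : Fin d → ℝ, ∀ b : ℝ, (fun i => b * ν i + η i) ≠ 0 := by
  set i : Fin d := ⟨0, by omega⟩
  set j : Fin d := ⟨1, by omega⟩
  have hij : i ≠ j := by simp [i, j]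
  by_cases h : ν i = 0
  · refine ⟨fun k => if k = i then 1 else 0, fun b hb => ?_⟩
    have := congrFun hb i
    simp [h] at this
  · refine ⟨fun k => if k = j then 1 else 0, fun b hb => ?_⟩
    have h1 := congrFun hb i
    have h2 := congrFun hb j
    simp [hij, h] at h1
    simp [h1] at h2

lemma small_value {P : MvPolynomial (Fin d) ℂ} (hm : 1 ≤ P.totalDegree) {z : Fin d → ℂ}
    (hz : MvPolynomial.eval z (ppart P) = 0) : ∃ C : ℝ, 0 ≤ C ∧ ∀ τ : ℝ, 1 ≤ τ →
      ‖MvPolynomial.eval (fun i => (τ:ℂ) * z i) P‖ ≤ C * τ ^ (P.totalDegree - 1) := by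
  refine ⟨∑ k ∈ Finset.range P.totalDegree, ‖MvPolynomial.eval z (MvPolynomial.homogeneousComponent k P)‖,
    Finset.sum_nonneg fun _ _ => norm_nonneg _, fun τ hτ => ?_⟩
  have e : MvPolynomial.eval (fun i => (τ:ℂ) * z i) P = ∑ k ∈ Finset.range P.totalDegree,
      (τ:ℂ) ^ k * MvPolynomial.eval z (MvPolynomial.homogeneousComponent k P) := by
    conv_lhs => rw [← MvPolynomial.sum_homogeneousComponent P]
    rw [map_sum, Finset.sum_range_succ]
    have h1 : ∀ k, MvPolynomial.eval (fun i => (τ:ℂ) * z i) (MvPolynomial.homogeneousComponent k P) =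
        (τ:ℂ) ^ k * MvPolynomial.eval z (MvPolynomial.homogeneousComponent k P) := fun k =>
      eval_homog_smul (MvPolynomial.homogeneousComponent_isHomogeneous k P) _ _
    simp_rw [h1]
    have : MvPolynomial.eval z (MvPolynomial.homogeneousComponent P.totalDegree P) = 0 := hz
    rw [this, mul_zero, add_zero]
  rw [e, Finset.sum_mul]
  refine (norm_sum_le _ _).trans (Finset.sum_le_sum fun k hk => ?_)
  rw [norm_mul, norm_pow, Complex.norm_real, Real.norm_of_nonneg (by linarith), mul_comm]
  refine mul_le_mul_of_nonneg_left (pow_le_pow_right₀ hτ ?_) (norm_nonneg _)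
  have := Finset.mem_range.1 hk
  omega

theorem exists_zeta {P : MvPolynomial (Fin d) ℂ} (hd : 2 ≤ d) (hell : IsElliptic P) (hm : 1 ≤ P.totalDegree)
    {ν : Fin d → ℝ} (hν : ν ≠ 0) (A : ℝ) : ∃ ζ : Fin d → ℂ, MvPolynomial.eval ζ P = 0 ∧
      ∃ σ : ℝ, A ≤ σ ∧ ∀ i, (ζ i).re = σ * ν i := by
  obtain ⟨η0, hη0⟩ := exists_indep hd ν
  set c := MvPolynomial.eval (fun i => (ν i : ℂ)) (ppart P) with hcdef
  have hc : c ≠ 0 := hell ν hν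
  -- a root of the principal part with positive real part
  have hs1 : ∃ s1 : ℂ, 0 < s1.re ∧ ∃ η : Fin d → ℝ,
      MvPolynomial.eval (fun i => (ν i : ℂ) * s1 + Complex.I * η i) (ppart P) = 0 := by
    have hd1 := line_deg (ppart_homog P).totalDegree_le (fun i => (ν i : ℂ)) (fun i => Complex.I * η0 i)
    have hh : MvPolynomial.homogeneousComponent P.totalDegree (ppart P) = ppart P := by
      rw [MvPolynomial.homogeneousComponent_of_mem (ppart_homog P), if_pos rfl]
    rw [hh, ← hcdef] at hd1
    set r := line (ppart P) (fun i => (ν i : ℂ)) (fun i => Complex.I * η0 i) with hr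
    have hdeg : r.natDegree = P.totalDegree := by
      refine le_antisymm hd1.1 (Polynomial.le_natDegree_of_ne_zero ?_)
      rw [hd1.2]; exact hc
    obtain ⟨s, hs⟩ := IsAlgClosed.exists_root r (by
      intro h0
      have := Polynomial.natDegree_eq_zero_iff_degree_le_zero.2 h0.le
      omega)
    have hs' : MvPolynomial.eval (fun i => (ν i : ℂ) * s + Complex.I * η0 i) (ppart P) = 0 := by
      rw [← eval_line]; exact hs
    have hre : s.re ≠ 0 := by
      intro h0
      have e : (fun i => (ν i : ℂ) * s + Complex.I * η0 i) =
          fun i => Complex.I * ((s.im * ν i + η0 i : ℝ) : ℂ) := by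
        funext i
        have : s = Complex.I * s.im := by
          apply Complex.ext <;> simp [h0]
        rw [this]
        push_cast
        simp
        ring
      rw [e, eval_homog_smul (ppart_homog P)] at hs'
      rcases mul_eq_zero.1 hs' with h | h
      · exact Complex.I_ne_zero (pow_eq_zero_iff (by omega) |>.1 h)
      · exact hell _ (hη0 s.im) h
    rcases lt_or_gt_of_ne hre with hneg | hpos
    · refine ⟨-s, by simpa using hneg, fun i => -η0 i, ?_⟩
      have e : (fun i => (ν i : ℂ) * -s + Complex.I * ((-η0 i : ℝ) : ℂ)) =
          fun i => (-1 : ℂ) * ((ν i : ℂ) * s + Complex.I * η0 i) := by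
        funext i; push_cast; ring
      rw [e, eval_homog_smul (ppart_homog P), hs', mul_zero]
    · exact ⟨s, hpos, η0, hs'⟩
  obtain ⟨s1, hs1, η, hη⟩ := hs1
  obtain ⟨C, hC, hsm⟩ := small_value hm hη
  set ρ := s1.re / 2 with hρ
  have hρ0 : 0 < ρ := by positivity
  set D := ‖c‖ * ρ ^ P.totalDegree with hD
  have hD0 : 0 < D := mul_pos (norm_pos_iff.2 hc) (by positivity)
  set τ := max 1 (max (C / D + 1) (|A| / ρ)) with hτ
  have hτ1 : 1 ≤ τ := le_max_left _ _
  have hτ2 : C / D + 1 ≤ τ := (le_max_left _ _).trans (le_max_right _ _)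
  have hτ3 : |A| / ρ ≤ τ := (le_max_right _ _).trans (le_max_right _ _)
  have hd1 := line_deg (le_refl P.totalDegree) (fun i => (ν i : ℂ)) (fun i => τ * (Complex.I * η i))
  set r := line P (fun i => (ν i : ℂ)) (fun i => τ * (Complex.I * η i)) with hr
  have hco : r.coeff P.totalDegree = c := hd1.2
  have hdeg : r.natDegree = P.totalDegree := by
    refine le_antisymm hd1.1 (Polynomial.le_natDegree_of_ne_zero ?_)
    rw [hco]; exact hc
  have hlc : r.leadingCoeff = c := by rw [Polynomial.leadingCoeff, hdeg, hco]
  obtain ⟨z, hz, hzn⟩ := near_root r (τ * s1) (t := τ * ρ) (by positivity) (by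
    rw [hdeg, hlc, eval_line]
    have e : (fun i => (ν i : ℂ) * (τ * s1) + τ * (Complex.I * η i)) =
      fun i => (τ : ℂ) * ((ν i : ℂ) * s1 + Complex.I * η i) := by funext i; ring
    rw [e]
    refine (hsm τ hτ1).trans_lt ?_
    rw [mul_pow]
    have hp : τ ^ P.totalDegree = τ ^ (P.totalDegree - 1) * τ := by
      rw [← pow_succ]; congr 1; omega
    rw [hp]
    have h1 : C < D * τ := by
      have : C / D < τ := by linarith
      rwa [div_lt_iff₀ hD0, mul_comm] at this
    have h2 : 0 < τ ^ (P.totalDegree - 1) := by positivity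
    calc C * τ ^ (P.totalDegree - 1) < (D * τ) * τ ^ (P.totalDegree - 1) :=
          mul_lt_mul_of_pos_right h1 h2
      _ = _ := by rw [hD]; ring)
  refine ⟨fun i => (ν i : ℂ) * z + τ * (Complex.I * η i), by rw [← eval_line]; exact hz, z.re, ?_, ?_⟩
  · have h1 := (Complex.abs_re_le_norm (τ * s1 - z)).trans hzn.le
    rw [Complex.sub_re, Complex.re_ofReal_mul] at h1
    have h2 := (abs_le.1 h1).2
    have h3 : |A| ≤ τ * ρ := by rwa [div_le_iff₀ hρ0] at hτ3
    have h4 : s1.re = 2 * ρ := by rw [hρ]; ring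
    rw [h4] at h2
    linarith [le_abs_self A]
  · intro i
    simp
    ring

/-- exponential solutions -/
def ex (ζ : Fin d → ℂ) (x : Eu d) : ℂ := Complex.exp (Lk ζ x)

lemma ex_smooth (ζ : Fin d → ℂ) : ContDiff ℝ ∞ (ex ζ : Eu d → ℂ) := (Lk ζ).contDiff.cexp

lemma pderivE_ex (ζ : Fin d → ℂ) (k : Fin d) : pderivE k (ex ζ) = fun x => ζ k * ex ζ x := by
  funext x
  have h := ((Lk ζ).hasFDerivAt (x := x)).cexp
  unfold pderivE ex
  rw [h.fderiv]
  have : Lk ζ (EuclideanSpace.single k 1) = ζ k := by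
    rw [Lk_apply, Finset.sum_eq_single k (fun b _ hb => by simp [hb]) (by simp)]
    simp
  simp [this]
  ring

lemma DW_ex (ζ : Fin d → ℂ) (I : List (Fin d)) : DW I (ex ζ) = fun x => (I.map ζ).prod * ex ζ x := by
  induction I with
  | nil => simp
  | cons k I ih =>
    rw [DW_cons, ih]
    have := DW_const_mul (ex_smooth ζ) ((I.map ζ).prod) [k]
    simp only [DW_cons, DW_nil] at this
    rw [this, pderivE_ex]
    funext x
    simp
    ring

lemma ex_MemCP {P : MvPolynomial (Fin d) ℂ} {ζ : Fin d → ℂ} (h : MvPolynomial.eval ζ P = 0) (X : Set (Eu d)) :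
    MemCP P X (ex ζ) := by
  refine ⟨(ex_smooth ζ).contDiffOn, fun x _ => ?_⟩
  rw [PDop_eq]
  simp_rw [DW_ex, prod_word]
  rw [MvPolynomial.eval_eq'] at h
  simp_rw [← mul_assoc]
  rw [← Finset.sum_mul, h, zero_mul]

lemma norm_ex (ζ : Fin d → ℂ) (x : Eu d) : ‖ex ζ x‖ = Real.exp (∑ i, (ζ i).re * x i) := by
  unfold ex
  rw [Complex.norm_exp, Lk_apply, Complex.re_sum]
  congr 1
  refine Finset.sum_congr rfl fun i _ => ?_
  rw [Complex.re_ofReal_mul, mul_comm]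

lemma ex_ne (ζ : Fin d → ℂ) (x : Eu d) : ex ζ x ≠ 0 := Complex.exp_ne_zero _

end roots
end
end Module12

section Module13
open scoped ContDiff Topology
open MeasureTheory Filter Set
noncomputable section
section hull
variable {d : ℕ}

lemma punct_preconn (hd : 2 ≤ d) {r : ℝ} (hr : 0 < r) :
    IsPreconnected (Metric.ball (0 : Eu d) r \ {0}) := by
  have hrank : 1 < Module.rank ℝ (Eu d) := by
    apply Module.one_lt_rank_of_one_lt_finrank
    rw [finrank_euclideanSpace_fin]; omega
  set e := OpenPartialHomeomorph.univBall (0 : Eu d) r with he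
  have hsrc : e.source = univ := OpenPartialHomeomorph.univBall_source _ _
  have htgt : e.target = Metric.ball 0 r := OpenPartialHomeomorph.univBall_target _ hr
  have h0 : e 0 = 0 := OpenPartialHomeomorph.univBall_apply_zero _ _
  have him : Metric.ball (0 : Eu d) r \ {0} = e '' {0}ᶜ := by
    ext x
    constructor
    · rintro ⟨hx, hx0⟩
      refine ⟨e.symm x, ?_, e.right_inv (by rw [htgt]; exact hx)⟩
      intro h
      apply hx0
      rw [mem_singleton_iff] at h ⊢
      rw [← e.right_inv (show x ∈ e.target by rw [htgt]; exact hx), h, h0]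
    · rintro ⟨y, hy, rfl⟩
      refine ⟨by rw [← htgt]; exact e.map_source (by rw [hsrc]; trivial), fun h => hy ?_⟩
      rw [mem_singleton_iff] at h ⊢
      exact e.injOn (by rw [hsrc]; trivial) (by rw [hsrc]; trivial) (h.trans h0.symm)
  rw [him]
  refine (isConnected_compl_singleton_of_one_lt_rank hrank 0).isPreconnected.image _ ?_
  exact e.continuousOn.mono (by rw [hsrc]; exact subset_univ _)

variable {P : MvPolynomial (Fin d) ℂ}

lemma sing_contra (hd : 2 ≤ d) (hell : IsElliptic P) (hm : 1 ≤ P.totalDegree) {F : Eu d → ℂ}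
    (hF : MemCP P {0}ᶜ F) (hne : ∀ r : ℝ, 0 < r → ∀ G : Eu d → ℂ,
      ContDiffOn ℝ ∞ G (Metric.ball 0 r) → ¬ EqOn G F (Metric.ball 0 r \ {0}))
    {p : Eu d} (hp : p ≠ 0) {M b : ℝ} (hb : 0 < b) (hpb : ‖p‖ < (2 * b)⁻¹)
    (h : ∀ n, ‖iteratedFDeriv ℝ n F p‖ ≤ M * b ^ n * n.factorial) : False := by
  have hrad := taylorSer_radius hb h
  set s := taylorSer F p with hs
  have hpos : 0 < s.radius := lt_of_lt_of_le (by simpa using hb) hrad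
  have hG := (s.hasFPowerSeriesOnBall hpos).comp_sub p
  rw [zero_add] at hG
  set G : Eu d → ℂ := fun z => s.sum (z - p) with hGdef
  have hsub : Metric.ball (0 : Eu d) (2 * b)⁻¹ ⊆ Metric.eball p s.radius := by
    intro x hx
    refine Metric.eball_subset_eball hrad ?_
    rw [Metric.eball_ofReal, Metric.mem_ball, dist_eq_norm]
    have hx' : ‖x‖ < (2 * b)⁻¹ := by simpa using hx
    have e : b⁻¹ = (2*b)⁻¹ + (2*b)⁻¹ := by field_simp; norm_num
    rw [e]
    linarith [norm_sub_le x p]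
  have hGan : AnalyticOnNhd ℝ G (Metric.ball 0 (2 * b)⁻¹) := fun x hx => hG.analyticAt_of_mem (hsub hx)
  have hFan := CP_analytic hell hm isOpen_compl_singleton hF
  have hFs := CP_hasFPowerSeriesAt hell hm isOpen_compl_singleton hF hp
  have hev : G =ᶠ[𝓝 p] F := by
    filter_upwards [hFs.eventually_hasSum_sub, hG.hasFPowerSeriesAt.eventually_hasSum_sub] with y h1 h2
    exact h2.unique h1
  have hpm : p ∈ Metric.ball (0 : Eu d) (2 * b)⁻¹ \ {0} := ⟨by simpa using hpb, hp⟩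
  refine hne (2*b)⁻¹ (by positivity) G (fun x hx => (hGan x hx).contDiffAt.contDiffWithinAt) ?_
  exact (hGan.mono sdiff_subset).eqOn_of_preconnected_of_eventuallyEq (hFan.mono fun x hx => hx.2)
    (punct_preconn hd (by positivity)) hpm hev

lemma MemCP_translate {F : Eu d → ℂ} {X : Set (Eu d)} {b : Eu d} (hb : b ∉ X)
    (hF : MemCP P {0}ᶜ F) : MemCP P X (fun x => F (x - b)) := by
  have hne : ∀ x ∈ X, x - b ∈ ({0}ᶜ : Set (Eu d)) := by
    intro x hx h
    apply hb
    have : x = b := sub_eq_zero.1 h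
    rwa [← this]
  refine ⟨hF.1.comp (contDiff_id.sub contDiff_const).contDiffOn hne, fun x hx => ?_⟩
  rw [← hF.2 _ (hne x hx), PDop_eq, PDop_eq]
  refine Finset.sum_congr rfl fun α _ => ?_
  rw [DW_translate]

/-- the property of lying in the hull of `L` -/
def InHull (P : MvPolynomial (Fin d) ℂ) (X L : Set (Eu d)) (y : Eu d) : Prop :=
  ∃ C : ℝ, 0 ≤ C ∧ ∀ f, MemCP P X f → ∀ B : ℝ, 0 ≤ B → (∀ z ∈ L, ‖f z‖ ≤ B) → ‖f y‖ ≤ C * B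

lemma hull_coord (hd : 2 ≤ d) (hell : IsElliptic P) (hm : 1 ≤ P.totalDegree) {X L : Set (Eu d)} {R : ℝ}
    (hR : ∀ z ∈ L, ‖z‖ ≤ R) {y : Eu d} (hy : InHull P X L y) (i : Fin d) (s : ℝ) (hs : |s| = 1) :
    s * y i ≤ R := by
  obtain ⟨C, hC, h⟩ := hy
  by_contra hlt
  push Not at hlt
  have hs0 : s ≠ 0 := by rintro rfl; simp at hs
  set t := s * y i - R with ht
  have ht0 : 0 < t := by linarith
  obtain ⟨ζ, hζ, σ, hσ, hre⟩ := exists_zeta hd hell hm (ν := fun k => if k = i then s else 0)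
    (fun hh => by have := congrFun hh i; simp [hs0] at this) (C / t + 1)
  have hσ0 : 0 < σ := lt_of_lt_of_le (by positivity) hσ
  have hsum : ∀ x : Eu d, ∑ k, (ζ k).re * x k = σ * (s * x i) := by
    intro x
    rw [Finset.sum_eq_single i (fun b _ hb => by rw [hre]; simp [hb]) (by simp), hre]
    simp
    ring
  have h1 := h (ex ζ) (ex_MemCP hζ X) (Real.exp (σ * R)) (Real.exp_pos _).le (fun z hz => by
    rw [norm_ex, hsum]
    refine Real.exp_le_exp.2 (mul_le_mul_of_nonneg_left ?_ hσ0.le)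
    have h2 : s * z i ≤ |s * z i| := le_abs_self _
    rw [abs_mul, hs, one_mul] at h2
    have h3 : |z i| ≤ ‖z‖ := by
      have := PiLp.norm_apply_le z i
      simpa using this
    linarith [hR z hz])
  rw [norm_ex, hsum] at h1
  have h2 : Real.exp (σ * (s * y i)) = Real.exp (σ * t) * Real.exp (σ * R) := by
    rw [← Real.exp_add]; congr 1; rw [ht]; ring
  rw [h2] at h1
  have h3 := le_of_mul_le_mul_right h1 (Real.exp_pos _)
  have h4 := Real.add_one_le_exp (σ * t)
  have h5 : (C / t + 1) * t ≤ σ * t := mul_le_mul_of_nonneg_right hσ ht0.le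
  have h6 : (C / t + 1) * t = C + t := by field_simp
  linarith

theorem hull_compact (hd : 2 ≤ d) (hell : IsElliptic P)
    (hP0 : MvPolynomial.eval (fun _ => (0 : ℂ)) P = 0) {X L : Set (Eu d)} (hX : IsOpen X)
    (hL : IsCompact L) (hLX : L ⊆ X) :
    ∃ L' : Set (Eu d), IsCompact L' ∧ L' ⊆ X ∧ ∀ y ∈ X, InHull P X L y → y ∈ L' := by
  have hm := deg_pos hd hell hP0
  obtain ⟨F, hF, hne⟩ := not_ext hd hell hm hP0
  obtain ⟨R, hR⟩ := hL.exists_bound_of_continuousOn (f := fun x => x) continuousOn_id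
  set R1 := |R| with hR1
  have hR' : ∀ z ∈ L, ‖z‖ ≤ R1 := fun z hz => (hR z hz).trans (le_abs_self _)
  set R' := d * R1 with hR'def
  have hbd : ∀ y, InHull P X L y → ‖y‖ ≤ R' := by
    intro y hy
    have hc : ∀ i, |y i| ≤ R1 := by
      intro i
      rw [abs_le]
      have h1 := hull_coord hd hell hm hR' hy i 1 (by simp)
      have h2 := hull_coord hd hell hm hR' hy i (-1) (by simp)
      constructor <;> linarith
    have hy' : y = ∑ k, y k • EuclideanSpace.single k (1:ℝ) := by
      ext i
      simp [Pi.single_apply]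
    rw [hy']
    refine (norm_sum_le _ _).trans ?_
    have : ∀ k ∈ Finset.univ, ‖y k • EuclideanSpace.single k (1:ℝ)‖ ≤ R1 := by
      intro k _
      rw [norm_smul]
      simpa using hc k
    refine (Finset.sum_le_sum this).trans ?_
    simp [hR'def]
  obtain ⟨δ, hδ, hδX⟩ := hL.exists_thickening_subset_open hX hLX
  set K : Set (Eu d) := {x | δ ≤ ‖x‖ ∧ ‖x‖ ≤ R1 + R' + 1} with hK
  have hKc : IsCompact K := by
    refine Metric.isCompact_of_isClosed_isBounded ?_ ?_
    · exact (isClosed_le continuous_const continuous_norm).inter (isClosed_le continuous_norm continuous_const)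
    · exact (Metric.isBounded_closedBall (x := (0 : Eu d)) (r := R1 + R' + 1)).subset
        fun x hx => by simpa using hx.2
  have hK0 : K ⊆ {0}ᶜ := by
    intro x hx h
    rw [mem_singleton_iff] at h
    have := hx.1
    rw [h, norm_zero] at this
    linarith
  obtain ⟨M, a, hM, ha, hMa⟩ := compact_analytic hell hm isOpen_compl_singleton hF hKc hK0
  have hdpos : (0:ℝ) < d := by exact_mod_cast (by omega : 0 < d)
  set b0 : ℝ := d * a with hb0
  have hb0pos : 0 < b0 := by positivity
  set ρ := min 1 (2 * b0)⁻¹ with hρ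
  have hρ0 : 0 < ρ := by positivity
  refine ⟨{y | ‖y‖ ≤ R'} ∩ ⋂ b ∈ Xᶜ, {y | ρ ≤ dist y b}, ?_, ?_, ?_⟩
  · refine Metric.isCompact_of_isClosed_isBounded ?_ ?_
    · refine (isClosed_le continuous_norm continuous_const).inter (isClosed_biInter fun b _ => ?_)
      exact isClosed_le continuous_const (continuous_id.dist continuous_const)
    · exact (Metric.isBounded_closedBall (x := (0 : Eu d)) (r := R')).subset
        fun x hx => by simpa using hx.1
  · intro y hy
    by_contra hyX
    have := mem_iInter₂.1 hy.2 y hyX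
    simp at this
    linarith
  · intro y hyX hy
    refine ⟨hbd y hy, mem_iInter₂.2 fun b hb => ?_⟩
    show ρ ≤ dist y b
    by_contra hlt
    push Not at hlt
    have hyb : y - b ≠ 0 := fun h => hb (by rw [← sub_eq_zero.1 h]; exact hyX)
    have hlt' : ‖y - b‖ < ρ := by rwa [← dist_eq_norm]
    have hLK : ∀ z ∈ L, z - b ∈ K := by
      intro z hz
      constructor
      · by_contra hh
        push Not at hh
        apply hb
        apply hδX
        rw [Metric.mem_thickening_iff]
        exact ⟨z, hz, by rwa [dist_comm, dist_eq_norm]⟩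
      · have h1 := norm_sub_le z (y - (y - b))
        have h2 := norm_sub_le y (y - b)
        rw [sub_sub_cancel] at h1 h2
        have h3 := hR' z hz
        have h4 := hbd y hy
        have h5 : ρ ≤ 1 := min_le_left _ _
        linarith
    obtain ⟨C, hC, h⟩ := hy
    refine sing_contra hd hell hm hF hne hyb (M := C * M) (b := b0) hb0pos
      (hlt'.trans_le (min_le_right _ _)) fun n => ?_
    refine (norm_iteratedFDeriv_le_of_DW' isOpen_compl_singleton hF.1 n hyb
      (A := C * (M * a ^ n * n.factorial)) fun I hI => ?_).trans (le_of_eq (by rw [hb0]; ring))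
    have hmem := MemCP_translate hb (MemCP_DW isOpen_compl_singleton hF I)
    refine h _ hmem _ (by positivity) fun z hz => ?_
    have := hMa I _ (hLK z hz)
    rwa [hI] at this

end hull
end
end Module13

section Module14
open scoped ContDiff Topology
open MeasureTheory Filter Set
noncomputable section
section rankarg
variable {E : Type*} [NormedAddCommGroup E] [NormedSpace ℝ E] [FiniteDimensional ℝ E]

lemma exists_geninv (A : E →L[ℝ] E) : ∃ S : E →L[ℝ] E, ∀ x, A (S (A x)) = A x := by
  obtain ⟨s, hs⟩ := (A : E →ₗ[ℝ] E).rangeRestrict.exists_rightInverse_of_surjective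
    (LinearMap.range_rangeRestrict _)
  obtain ⟨S, hS⟩ := LinearMap.exists_extend s
  refine ⟨LinearMap.toContinuousLinearMap S, fun x => ?_⟩
  have h1 : S (A x) = s ((A : E →ₗ[ℝ] E).rangeRestrict x) := by
    rw [← hS]; rfl
  have h2 := congrArg Subtype.val (LinearMap.congr_fun hs ((A : E →ₗ[ℝ] E).rangeRestrict x))
  change A (S (A x)) = A x
  rw [h1]
  exact h2

lemma ker_eq_aux (A S T : E →L[ℝ] E) (hS : ∀ x, A (S (A x)) = A x)
    (hM : IsUnit (1 - S * A + S * T))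
    (hr : Module.finrank ℝ (T : E →ₗ[ℝ] E).range ≤ Module.finrank ℝ (A : E →ₗ[ℝ] E).range)
    (u : E) (hu : A ((1 - S * A + S * T) u) = 0) : T u = 0 := by
  set M : E →L[ℝ] E := 1 - S * A + S * T with hMdef
  have hAM : ∀ x, A (M x) = A (S (T x)) := by
    intro x
    simp [hMdef, hS]
  obtain ⟨Mu, hMu⟩ := hM
  have hsurj : Function.Surjective M := by
    intro y
    refine ⟨(↑Mu⁻¹ : E →L[ℝ] E) y, ?_⟩
    rw [← hMu]
    change ((Mu : E →L[ℝ] E) * (↑Mu⁻¹ : E →L[ℝ] E)) y = y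
    rw [Units.mul_inv]; rfl
  have hrange : ((A : E →ₗ[ℝ] E) ∘ₗ (M : E →ₗ[ℝ] E)).range = (A : E →ₗ[ℝ] E).range := by
    rw [LinearMap.range_comp_of_range_eq_top]
    exact LinearMap.range_eq_top.2 hsurj
  have hle : (T : E →ₗ[ℝ] E).ker ≤ ((A : E →ₗ[ℝ] E) ∘ₗ (M : E →ₗ[ℝ] E)).ker := by
    intro x hx
    have hx' : T x = 0 := hx
    change A (M x) = 0
    rw [hAM, hx']; simp
  have e1 := LinearMap.finrank_range_add_finrank_ker (T : E →ₗ[ℝ] E)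
  have e2 := LinearMap.finrank_range_add_finrank_ker ((A : E →ₗ[ℝ] E) ∘ₗ (M : E →ₗ[ℝ] E))
  rw [hrange] at e2
  have hk := Submodule.eq_of_le_of_finrank_le hle (by omega)
  have : u ∈ (T : E →ₗ[ℝ] E).ker := by rw [hk]; exact hu
  exact this

lemma exists_surj_fderiv {ψ : E → E} {U : Set E} (hU : IsOpen U) (hne : U.Nonempty)
    (hψ : ContDiffOn ℝ 1 ψ U) (hinj : InjOn ψ U) :
    ∃ x ∈ U, Function.Surjective (fderiv ℝ ψ x) := by
  classical
  by_contra hcon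
  push Not at hcon
  -- maximal rank point
  set rk : E → ℕ := fun x => Module.finrank ℝ (fderiv ℝ ψ x : E →ₗ[ℝ] E).range with hrk
  have hbd : ∀ x, rk x ≤ Module.finrank ℝ E := fun x => Submodule.finrank_le _
  obtain ⟨x0, hx0, hmax⟩ : ∃ x0 ∈ U, ∀ x ∈ U, rk x ≤ rk x0 := by
    have hfin : (rk '' U).Finite := (Set.finite_Iic (Module.finrank ℝ E)).subset (by
      rintro _ ⟨x, -, rfl⟩; exact hbd x)
    obtain ⟨_, ⟨x0, hx0, rfl⟩, hm⟩ := hfin.exists_maximal (hne.image rk) 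
    refine ⟨x0, hx0, fun x hx => ?_⟩
    by_contra hlt
    push Not at hlt
    exact absurd (hm ⟨x, hx, rfl⟩ hlt.le) (not_le.2 hlt)
  set A := fderiv ℝ ψ x0 with hA
  obtain ⟨S, hS⟩ := exists_geninv A
  have hker : ∃ v, v ≠ 0 ∧ A v = 0 := by
    by_contra h
    push Not at h
    apply hcon x0 hx0
    have hi : Function.Injective (A : E →ₗ[ℝ] E) := by
      rw [← LinearMap.ker_eq_bot, LinearMap.ker_eq_bot']
      intro v hv
      by_contra hv0
      exact h v hv0 hv
    exact LinearMap.injective_iff_surjective.1 hi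
  obtain ⟨v, hv0, hv⟩ := hker
  set H : E → E := fun x => x - S (A x) + S (ψ x) with hH
  have hψat : ∀ x ∈ U, HasFDerivAt ψ (fderiv ℝ ψ x) x := fun x hx =>
    ((hψ.contDiffAt (hU.mem_nhds hx)).differentiableAt (by simp)).hasFDerivAt
  have hHd : ∀ x ∈ U, HasFDerivAt H (1 - S * A + S * fderiv ℝ ψ x) x := by
    intro x hx
    have h1 := (hasFDerivAt_id (𝕜 := ℝ) x).sub ((S * A).hasFDerivAt (x := x))
    have h2 := S.hasFDerivAt.comp x (hψat x hx)
    exact h1.add h2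
  have hHc : ContDiffAt ℝ 1 H x0 := by
    have := hψ.contDiffAt (hU.mem_nhds hx0)
    exact (contDiffAt_id.sub ((S * A).contDiff.contDiffAt)).add (S.contDiff.contDiffAt.comp x0 this)
  have hM0 : (1 - S * A + S * fderiv ℝ ψ x0 : E →L[ℝ] E) = 1 := by
    rw [← hA]; simp
  have hH0 : HasFDerivAt H ((ContinuousLinearEquiv.refl ℝ E : E ≃L[ℝ] E) : E →L[ℝ] E) x0 := by
    have := hHd x0 hx0
    rw [hM0] at this
    exact this
  set G := hHc.localInverse hH0 (by simp) with hG
  have hGc : ContDiffAt ℝ 1 G (H x0) := hHc.to_localInverse hH0 (by simp)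
  have hG0 : G (H x0) = x0 := hHc.localInverse_apply_image hH0 (by simp)
  have hGr : ∀ᶠ y in 𝓝 (H x0), H (G y) = y :=
    (hHc.hasStrictFDerivAt' hH0 (by simp)).eventually_right_inverse
  have hGt : Tendsto G (𝓝 (H x0)) (𝓝 x0) := by
    have := hGc.continuousAt.tendsto
    rwa [hG0] at this
  have hcont : ContinuousAt (fun x => fderiv ℝ ψ x) x0 :=
    (hψ.continuousOn_fderiv_of_isOpen hU le_rfl).continuousAt (hU.mem_nhds hx0)
  have hMu : ∀ᶠ x in 𝓝 x0, IsUnit (1 - S * A + S * fderiv ℝ ψ x : E →L[ℝ] E) := by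
    have hc : ContinuousAt (fun x => (1 - S * A + S * fderiv ℝ ψ x : E →L[ℝ] E)) x0 :=
      continuousAt_const.add (continuousAt_const.mul hcont)
    have hnh : {M : E →L[ℝ] E | IsUnit M} ∈ 𝓝 (1 - S * A + S * fderiv ℝ ψ x0 : E →L[ℝ] E) := by
      rw [hM0]
      exact Units.isOpen.mem_nhds isUnit_one
    exact hc.eventually hnh
  have hGd : ∀ᶠ y in 𝓝 (H x0), DifferentiableAt ℝ G y :=
    (hGc.eventually (by simp)).mono fun y hy => hy.differentiableAt (by simp)
  have hall : ∀ᶠ y in 𝓝 (H x0), (H (G y) = y ∧ DifferentiableAt ℝ G y) ∧ (G y ∈ U ∧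
      IsUnit (1 - S * A + S * fderiv ℝ ψ (G y) : E →L[ℝ] E)) :=
    (hGr.and hGd).and ((hGt.eventually (hU.mem_nhds hx0)).and (hGt.eventually hMu))
  obtain ⟨ε, hε, hball⟩ := Metric.eventually_nhds_iff_ball.1 hall
  -- On the ball, ψ ∘ G has zero derivative in direction v
  set δ : ℝ := ε / (2 * ‖v‖) with hδ
  have hvn : 0 < ‖v‖ := norm_pos_iff.2 hv0
  have hδ0 : 0 < δ := by positivity
  set l : ℝ → E := fun t => H x0 + t • v with hl
  have hlm : ∀ t ∈ Icc (0 : ℝ) δ, l t ∈ Metric.ball (H x0) ε := by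
    intro t ht
    rw [Metric.mem_ball, dist_eq_norm]
    simp only [hl, add_sub_cancel_left, norm_smul, Real.norm_eq_abs, abs_of_nonneg ht.1]
    calc t * ‖v‖ ≤ δ * ‖v‖ := by gcongr; exact ht.2
      _ = ε / 2 := by rw [hδ]; field_simp
      _ < ε := by linarith
  have hld : ∀ t, HasDerivAt l v t := by
    intro t
    have := ((hasDerivAt_id t).smul_const v).const_add (H x0)
    rw [one_smul] at this
    exact this
  have hder : ∀ t ∈ Icc (0 : ℝ) δ, HasDerivAt (fun t => ψ (G (l t))) 0 t := by
    intro t ht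
    have hb := hlm t ht
    obtain ⟨⟨h1, h2⟩, h3, h4⟩ := hball _ hb
    have hGl : HasDerivAt (fun t => G (l t)) (fderiv ℝ G (l t) v) t :=
      h2.hasFDerivAt.comp_hasDerivAt t (hld t)
    have hHG : HasDerivAt (fun t => H (G (l t)))
        ((1 - S * A + S * fderiv ℝ ψ (G (l t)) : E →L[ℝ] E) (fderiv ℝ G (l t) v)) t :=
      HasFDerivAt.comp_hasDerivAt (f := fun t => G (l t)) (l := H) t (hHd _ h3) hGl
    have hev : (fun t => H (G (l t))) =ᶠ[𝓝 t] l := by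
      have : ∀ᶠ s in 𝓝 t, l s ∈ Metric.ball (H x0) ε :=
        (hld t).continuousAt.eventually (Metric.isOpen_ball.mem_nhds hb)
      filter_upwards [this] with s hs
      exact (hball _ hs).1.1
    have heq := hHG.unique ((hld t).congr_of_eventuallyEq hev)
    have := ker_eq_aux A S (fderiv ℝ ψ (G (l t))) hS h4 (hmax _ h3) _ (by rw [heq, hv])
    have hfin := (hψat _ h3).comp_hasDerivAt t hGl
    rw [this] at hfin
    exact hfin
  have hconst := constant_of_has_deriv_right_zero (f := fun t => ψ (G (l t))) (a := 0) (b := δ)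
    (fun t ht => (hder t ht).continuousAt.continuousWithinAt)
    (fun t ht => (hder t ⟨ht.1, ht.2.le⟩).hasDerivWithinAt) δ ⟨hδ0.le, le_rfl⟩
  have hδm : δ ∈ Icc (0 : ℝ) δ := ⟨hδ0.le, le_rfl⟩
  have h0m : (0 : ℝ) ∈ Icc (0 : ℝ) δ := ⟨le_rfl, hδ0.le⟩
  have hGG := hinj (hball _ (hlm _ hδm)).2.1 (hball _ (hlm _ h0m)).2.1 hconst
  have := congrArg H hGG
  rw [(hball _ (hlm _ hδm)).1.1, (hball _ (hlm _ h0m)).1.1] at this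
  simp [hl, hδ0.ne', hv0] at this

lemma image_mem_nhds_inj {ψ : E → E} {U : Set E} (hU : IsOpen U) (hne : U.Nonempty)
    (hψ : ContDiffOn ℝ 1 ψ U) (hinj : InjOn ψ U) : ∃ x ∈ U, ψ '' U ∈ 𝓝 (ψ x) := by
  obtain ⟨x, hx, hs⟩ := exists_surj_fderiv hU hne hψ hinj
  refine ⟨x, hx, ?_⟩
  have h := (hψ.contDiffAt (hU.mem_nhds hx)).hasStrictFDerivAt (by simp)
  rw [← h.map_nhds_eq_of_surj (LinearMap.range_eq_top.2 hs)]
  exact image_mem_map (hU.mem_nhds hx)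

end rankarg
end
end Module14

section Module15
open scoped ContDiff Topology
open MeasureTheory Filter Set
noncomputable section
section dens
variable {d : ℕ} {P : MvPolynomial (Fin d) ℂ} {X : Set (Eu d)} {w : Eu d → ℂ} {ψ : Eu d → Eu d}

lemma one_MemCP (hP0 : MvPolynomial.eval (fun _ => (0 : ℂ)) P = 0) (X : Set (Eu d)) :
    MemCP P X (fun _ => 1) :=
  ⟨contDiffOn_const, fun x _ => PDop_const hP0 1 x⟩

lemma w_MemCP (hP0 : MvPolynomial.eval (fun _ => (0 : ℂ)) P = 0)
    (hinv : ∀ f, MemCP P X f → MemCP P X (fun x => w x * f (ψ x))) : MemCP P X w := by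
  have := hinv _ (one_MemCP hP0 X)
  simpa using this

lemma w_dense (hell : IsElliptic P) (hm : 1 ≤ P.totalDegree) (hX : IsOpen X)
    (hwm : MemCP P X w) (hwcomp : ∀ x ∈ X, ∃ y ∈ connectedComponentIn X x, w y ≠ 0)
    {V : Set (Eu d)} (hV : IsOpen V) (hVX : V ⊆ X) (hne : V.Nonempty) :
    ∃ x ∈ V, w x ≠ 0 := by
  by_contra h
  push Not at h
  obtain ⟨x, hx⟩ := hne
  have hxX := hVX hx
  obtain ⟨y, hy, hwy⟩ := hwcomp x hxX
  have han := CP_analytic hell hm hX hwm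
  have hz : w =ᶠ[𝓝 x] 0 := by
    filter_upwards [hV.mem_nhds hx] with z hz
    exact h z hz
  exact hwy ((han.mono (connectedComponentIn_subset X x)).eqOn_zero_of_preconnected_of_eventuallyEq_zero
    isPreconnected_connectedComponentIn (mem_connectedComponentIn hxX) hz hy)

lemma psi_smooth (hd : 2 ≤ d) (hell : IsElliptic P) (hm : 1 ≤ P.totalDegree) (hX : IsOpen X)
    (hwm : MemCP P X w)
    (hinv : ∀ f, MemCP P X f → MemCP P X (fun x => w x * f (ψ x)))
    {x : Eu d} (hx : x ∈ X) (hwx : w x ≠ 0) : ContDiffAt ℝ 1 ψ x := by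
  rw [contDiffAt_euclidean]
  intro i
  have hν : (Pi.single i 1 : Fin d → ℝ) ≠ 0 := by
    intro h
    have := congrFun h i
    simp at this
  obtain ⟨ζ, hζ, σ, hσ, hre⟩ := exists_zeta hd hell hm hν 1
  have hσ0 : σ ≠ 0 := by linarith
  have hmem := hinv _ (ex_MemCP hζ X)
  have h1 : ContDiffAt ℝ 1 (fun x => w x * ex ζ (ψ x)) x :=
    (hmem.1.contDiffAt (hX.mem_nhds hx)).of_le (by exact_mod_cast le_top)
  have h2 : ContDiffAt ℝ 1 w x :=
    (hwm.1.contDiffAt (hX.mem_nhds hx)).of_le (by exact_mod_cast le_top)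
  have h3 : ContDiffAt ℝ 1 (fun x => σ⁻¹ * (Real.log ‖w x * ex ζ (ψ x)‖ - Real.log ‖w x‖)) x := by
    refine contDiffAt_const.mul (ContDiffAt.sub ?_ ?_)
    · exact (h1.norm ℝ (mul_ne_zero hwx (ex_ne _ _))).log (norm_ne_zero_iff.2 (mul_ne_zero hwx (ex_ne _ _)))
    · exact (h2.norm ℝ hwx).log (norm_ne_zero_iff.2 hwx)
  refine h3.congr_of_eventuallyEq ?_
  have hev : ∀ᶠ y in 𝓝 x, w y ≠ 0 := h2.continuousAt.eventually_ne hwx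
  filter_upwards [hev] with y hy
  have hsum : ∑ j, (ζ j).re * ψ y j = σ * ψ y i := by
    rw [Finset.sum_eq_single i]
    · rw [hre]; simp
    · intro j _ hj
      rw [hre]; simp [hj]
    · simp
  rw [norm_mul, Real.log_mul (norm_ne_zero_iff.2 hy) (norm_ne_zero_iff.2 (ex_ne _ _)), norm_ex,
    Real.log_exp, hsum]
  field_simp
  ring

lemma iter_dense (hd : 2 ≤ d) (hell : IsElliptic P) (hm : 1 ≤ P.totalDegree) (hX : IsOpen X)
    (hwm : MemCP P X w) (hwcomp : ∀ x ∈ X, ∃ y ∈ connectedComponentIn X x, w y ≠ 0)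
    (hψX : Set.MapsTo ψ X X)
    (hloc : ∀ x ∈ X, ∃ U : Set (EuclideanSpace ℝ (Fin d)),
      IsOpen U ∧ x ∈ U ∧ U ⊆ X ∧ Set.InjOn ψ U)
    (hinv : ∀ f, MemCP P X f → MemCP P X (fun x => w x * f (ψ x))) (m : ℕ) :
    ∀ V : Set (Eu d), IsOpen V → V ⊆ X → V.Nonempty →
      ∃ x ∈ V, (∏ j ∈ Finset.range m, w (ψ^[j] x)) ≠ 0 := by
  induction m with
  | zero => intro V _ _ ⟨x, hx⟩; exact ⟨x, hx, by simp⟩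
  | succ m ih =>
    intro V hV hVX hne
    obtain ⟨x, hx, hwx⟩ := w_dense hell hm hX hwm hwcomp hV hVX hne
    obtain ⟨U, hU, hxU, hUX, hinj⟩ := hloc x (hVX hx)
    have hwc : ContinuousOn w X := hwm.1.continuousOn
    set V' := (V ∩ U) ∩ (X ∩ w ⁻¹' {0}ᶜ) with hV'
    have hV'o : IsOpen V' :=
      (hV.inter hU).inter (hwc.isOpen_inter_preimage hX isOpen_compl_singleton)
    have hV'n : V'.Nonempty := ⟨x, ⟨hx, hxU⟩, hVX hx, hwx⟩
    have hsm : ContDiffOn ℝ 1 ψ V' := fun y hy =>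
      (psi_smooth hd hell hm hX hwm hinv hy.2.1 hy.2.2).contDiffWithinAt
    obtain ⟨y, hy, hyn⟩ := image_mem_nhds_inj hV'o hV'n hsm (hinj.mono fun z hz => hz.1.2)
    obtain ⟨V'', hsub, hVo, hyV⟩ := mem_nhds_iff.1 hyn
    obtain ⟨z, hz, hzw⟩ := ih V'' hVo (fun z hz => by
      obtain ⟨u, hu, rfl⟩ := hsub hz
      exact hψX hu.2.1) ⟨_, hyV⟩
    obtain ⟨u, hu, rfl⟩ := hsub hz
    refine ⟨u, hu.1.1, ?_⟩
    rw [Finset.prod_range_succ']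
    refine mul_ne_zero ?_ hu.2.2
    simpa only [Function.iterate_succ_apply] using hzw

lemma le_biSup_aux {K : Set (Eu d)} {g : Eu d → ℝ} {B : ℝ} (hB : ∀ x ∈ K, g x ≤ B)
    (h0 : ∀ x, 0 ≤ g x) {x : Eu d} (hx : x ∈ K) : g x ≤ ⨆ y ∈ K, g y := by
  have hbdd : BddAbove (Set.range fun y => ⨆ (_ : y ∈ K), g y) := by
    refine ⟨max B 0, ?_⟩
    rintro _ ⟨y, rfl⟩
    by_cases hy : y ∈ K
    · simp only [hy, ciSup_unique]
      exact (hB y hy).trans (le_max_left _ _)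
    · simp only [hy, Real.iSup_of_isEmpty]
      exact le_max_right _ _
  have h := le_ciSup hbdd x
  simpa only [hx, ciSup_unique] using h

lemma biSup_le_aux {K : Set (Eu d)} {g : Eu d → ℝ} {B : ℝ} (hB : ∀ x ∈ K, g x ≤ B)
    (h0 : 0 ≤ B) : ⨆ y ∈ K, g y ≤ B := by
  refine Real.iSup_le (fun y => ?_) h0
  exact Real.iSup_le (fun hy => hB y hy) h0

lemma iter_mapsTo (hψX : Set.MapsTo ψ X X) (m : ℕ) : Set.MapsTo (ψ^[m]) X X := hψX.iterate m

lemma iter_cont (hψ : ContinuousOn ψ X) (hψX : Set.MapsTo ψ X X) (m : ℕ) :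
    ContinuousOn (ψ^[m]) X := hψ.iterate hψX m

lemma prod_cont (hw : ContinuousOn w X) (hψ : ContinuousOn ψ X) (hψX : Set.MapsTo ψ X X) (m : ℕ) :
    ContinuousOn (fun x => ∏ j ∈ Finset.range m, w (ψ^[j] x)) X :=
  continuousOn_finsetProd _ fun j _ => hw.comp (iter_cont hψ hψX j) (iter_mapsTo hψX j)

lemma ii_imp_iii (hd : 2 ≤ d) (hell : IsElliptic P)
    (hP0 : MvPolynomial.eval (fun _ => (0 : ℂ)) P = 0) (hX : IsOpen X)
    (hw : ContinuousOn w X) (hwcomp : ∀ x ∈ X, ∃ y ∈ connectedComponentIn X x, w y ≠ 0)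
    (hψ : ContinuousOn ψ X) (hψX : Set.MapsTo ψ X X)
    (hloc : ∀ x ∈ X, ∃ U : Set (EuclideanSpace ℝ (Fin d)),
      IsOpen U ∧ x ∈ U ∧ U ⊆ X ∧ Set.InjOn ψ U)
    (hinv : ∀ f, MemCP P X f → MemCP P X (fun x => w x * f (ψ x)))
    (h : ∀ K : Set (EuclideanSpace ℝ (Fin d)), IsCompact K → K ⊆ X →
        ∃ L : Set (EuclideanSpace ℝ (Fin d)), IsCompact L ∧ L ⊆ X ∧
          ∀ m : ℕ, 1 ≤ m → ∃ γ : ℝ, 0 < γ ∧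
            ∀ f, MemCP P X f →
              (⨆ x ∈ K, ‖(∏ j ∈ Finset.range m, w (ψ^[j] x)) * f (ψ^[m] x)‖) ≤
                γ * ⨆ y ∈ L, ‖f y‖) :
    ∀ K : Set (EuclideanSpace ℝ (Fin d)), IsCompact K → K ⊆ X →
        ∃ L : Set (EuclideanSpace ℝ (Fin d)), IsCompact L ∧ L ⊆ X ∧
          ∀ m : ℕ, 1 ≤ m → ψ^[m] '' K ⊆ L := by
  have hm1 := deg_pos hd hell hP0
  have hwm := w_MemCP hP0 hinv
  intro K hK hKX
  obtain ⟨K', hK', hKK', hK'X⟩ := exists_compact_between hK hX hKX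
  obtain ⟨L, hL, hLX, hLm⟩ := h K' hK' hK'X
  obtain ⟨L', hL', hL'X, hhull⟩ := hull_compact hd hell hP0 hX hL hLX
  refine ⟨L', hL', hL'X, fun m hm => ?_⟩
  obtain ⟨γ, hγ, hest⟩ := hLm m hm
  rintro _ ⟨x, hx, rfl⟩
  by_contra hnot
  set V := interior K' ∩ (X ∩ ψ^[m] ⁻¹' L'ᶜ) with hV
  have hVo : IsOpen V := isOpen_interior.inter
    ((iter_cont hψ hψX m).isOpen_inter_preimage hX hL'.isClosed.isOpen_compl)
  obtain ⟨z, hz, hzw⟩ := iter_dense hd hell hm1 hX hwm hwcomp hψX hloc hinv m V hVo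
    (fun z hz => hz.2.1) ⟨x, hKK' hx, hKX hx, hnot⟩
  refine hz.2.2 (hhull _ (iter_mapsTo hψX m hz.2.1) ?_)
  set W := ∏ j ∈ Finset.range m, w (ψ^[j] z) with hW
  have hWn : 0 < ‖W‖ := norm_pos_iff.2 hzw
  refine ⟨γ / ‖W‖, by positivity, fun f hf B hB hfB => ?_⟩
  have hc : ContinuousOn (fun x => (∏ j ∈ Finset.range m, w (ψ^[j] x)) * f (ψ^[m] x)) X :=
    (prod_cont hw hψ hψX m).mul (hf.1.continuousOn.comp (iter_cont hψ hψX m) (iter_mapsTo hψX m))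
  obtain ⟨C, hC⟩ := hK'.exists_bound_of_continuousOn (hc.mono hK'X)
  have h1 := le_biSup_aux (g := fun x => ‖(∏ j ∈ Finset.range m, w (ψ^[j] x)) * f (ψ^[m] x)‖) hC
    (fun _ => norm_nonneg _) (interior_subset hz.1)
  have h2 : (⨆ y ∈ L, ‖f y‖) ≤ B := biSup_le_aux (g := fun y => ‖f y‖) hfB hB
  have h3 : ‖W‖ * ‖f (ψ^[m] z)‖ ≤ γ * B := by
    rw [← norm_mul]
    exact h1.trans ((hest f hf).trans (by gcongr))
  rw [div_mul_eq_mul_div, le_div_iff₀ hWn]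
  linarith

lemma iii_imp_i (hw : ContinuousOn w X)
    (hψX : Set.MapsTo ψ X X)
    (h : ∀ K : Set (EuclideanSpace ℝ (Fin d)), IsCompact K → K ⊆ X →
        ∃ L : Set (EuclideanSpace ℝ (Fin d)), IsCompact L ∧ L ⊆ X ∧
          ∀ m : ℕ, 1 ≤ m → ψ^[m] '' K ⊆ L) :
    ∀ K : Set (EuclideanSpace ℝ (Fin d)), IsCompact K → K ⊆ X →
        ∃ L : Set (EuclideanSpace ℝ (Fin d)), IsCompact L ∧ L ⊆ X ∧ ∃ γ : ℝ, 0 < γ ∧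
          ∀ m : ℕ, 1 ≤ m → ∀ f, MemCP P X f →
            (⨆ x ∈ K, ‖(∏ j ∈ Finset.range m, w (ψ^[j] x)) * f (ψ^[m] x)‖) ≤
              γ ^ m * ⨆ y ∈ L, ‖f y‖ := by
  intro K hK hKX
  obtain ⟨L, hL, hLX, hLm⟩ := h K hK hKX
  have hLK : IsCompact (L ∪ K) := hL.union hK
  have hLKX : L ∪ K ⊆ X := union_subset hLX hKX
  obtain ⟨C, hC⟩ := hLK.exists_bound_of_continuousOn (hw.mono hLKX)
  refine ⟨L ∪ K, hLK, hLKX, max C 1, by positivity, fun m hm f hf => ?_⟩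
  obtain ⟨D, hD⟩ := hLK.exists_bound_of_continuousOn (hf.1.continuousOn.mono hLKX)
  have hmem : ∀ x ∈ K, ∀ j, ψ^[j] x ∈ L ∪ K := by
    intro x hx j
    rcases Nat.eq_zero_or_pos j with rfl | hj
    · exact Or.inr hx
    · exact Or.inl (hLm j hj ⟨x, hx, rfl⟩)
  have hs0 : 0 ≤ ⨆ y ∈ L ∪ K, ‖f y‖ :=
    Real.iSup_nonneg fun y => Real.iSup_nonneg fun _ => norm_nonneg _
  refine biSup_le_aux (fun x hx => ?_) (by positivity)
  rw [norm_mul]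
  refine mul_le_mul ?_ (le_biSup_aux (g := fun y => ‖f y‖) hD (fun _ => norm_nonneg _) (hmem x hx m))
    (norm_nonneg _) (by positivity)
  rw [norm_prod]
  calc ∏ j ∈ Finset.range m, ‖w (ψ^[j] x)‖ ≤ ∏ _j ∈ Finset.range m, max C 1 :=
        Finset.prod_le_prod (fun _ _ => norm_nonneg _)
          fun j _ => (hC _ (hmem x hx j)).trans (le_max_left _ _)
    _ = max C 1 ^ m := by simp

end dens
end
end Module15

/-- For an elliptic `P` with `P(0) = 0` in `d ≥ 2` variables, a weight
`w` not vanishing identically on any connected component of `X`, and a locally injective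
continuous symbol `ψ`, the operator `C_{w,ψ}` on `C_P^∞(X)` is m-topologizable iff it is
topologizable iff `ψ` has stable orbits. -/
theorem topologizable_characterization_elliptic_kernel
    {d : ℕ} (hd : 2 ≤ d) (P : MvPolynomial (Fin d) ℂ) (hell : IsElliptic P)
    (hP0 : MvPolynomial.eval (fun _ => (0 : ℂ)) P = 0)
    (X : Set (EuclideanSpace ℝ (Fin d))) (hX : IsOpen X)
    (w : EuclideanSpace ℝ (Fin d) → ℂ) (hw : ContinuousOn w X)
    (hwcomp : ∀ x ∈ X, ∃ y ∈ connectedComponentIn X x, w y ≠ 0)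
    (ψ : EuclideanSpace ℝ (Fin d) → EuclideanSpace ℝ (Fin d))
    (hψ : ContinuousOn ψ X) (hψX : Set.MapsTo ψ X X)
    (hloc : ∀ x ∈ X, ∃ U : Set (EuclideanSpace ℝ (Fin d)),
      IsOpen U ∧ x ∈ U ∧ U ⊆ X ∧ Set.InjOn ψ U)
    (hinv : ∀ f, MemCP P X f → MemCP P X (fun x => w x * f (ψ x))) :
    -- (i) ↔ (ii)
    ((∀ K : Set (EuclideanSpace ℝ (Fin d)), IsCompact K → K ⊆ X →
        ∃ L : Set (EuclideanSpace ℝ (Fin d)), IsCompact L ∧ L ⊆ X ∧ ∃ γ : ℝ, 0 < γ ∧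
          ∀ m : ℕ, 1 ≤ m → ∀ f, MemCP P X f →
            (⨆ x ∈ K, ‖(∏ j ∈ Finset.range m, w (ψ^[j] x)) * f (ψ^[m] x)‖) ≤
              γ ^ m * ⨆ y ∈ L, ‖f y‖) ↔
      (∀ K : Set (EuclideanSpace ℝ (Fin d)), IsCompact K → K ⊆ X →
        ∃ L : Set (EuclideanSpace ℝ (Fin d)), IsCompact L ∧ L ⊆ X ∧
          ∀ m : ℕ, 1 ≤ m → ∃ γ : ℝ, 0 < γ ∧
            ∀ f, MemCP P X f →
              (⨆ x ∈ K, ‖(∏ j ∈ Finset.range m, w (ψ^[j] x)) * f (ψ^[m] x)‖) ≤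
                γ * ⨆ y ∈ L, ‖f y‖)) ∧
    -- (ii) ↔ (iii)
    ((∀ K : Set (EuclideanSpace ℝ (Fin d)), IsCompact K → K ⊆ X →
        ∃ L : Set (EuclideanSpace ℝ (Fin d)), IsCompact L ∧ L ⊆ X ∧
          ∀ m : ℕ, 1 ≤ m → ∃ γ : ℝ, 0 < γ ∧
            ∀ f, MemCP P X f →
              (⨆ x ∈ K, ‖(∏ j ∈ Finset.range m, w (ψ^[j] x)) * f (ψ^[m] x)‖) ≤
                γ * ⨆ y ∈ L, ‖f y‖) ↔
      (∀ K : Set (EuclideanSpace ℝ (Fin d)), IsCompact K → K ⊆ X →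
        ∃ L : Set (EuclideanSpace ℝ (Fin d)), IsCompact L ∧ L ⊆ X ∧
          ∀ m : ℕ, 1 ≤ m → ψ^[m] '' K ⊆ L)) := by
  have hii := fun h => ii_imp_iii (P := P) hd hell hP0 hX hw hwcomp hψ hψX hloc hinv h
  have hiii := fun h => iii_imp_i (P := P) (X := X) (w := w) (ψ := ψ) hw hψX h
  have hi : ∀ h : (∀ K : Set (EuclideanSpace ℝ (Fin d)), IsCompact K → K ⊆ X →
        ∃ L : Set (EuclideanSpace ℝ (Fin d)), IsCompact L ∧ L ⊆ X ∧ ∃ γ : ℝ, 0 < γ ∧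
          ∀ m : ℕ, 1 ≤ m → ∀ f, MemCP P X f →
            (⨆ x ∈ K, ‖(∏ j ∈ Finset.range m, w (ψ^[j] x)) * f (ψ^[m] x)‖) ≤
              γ ^ m * ⨆ y ∈ L, ‖f y‖),
      (∀ K : Set (EuclideanSpace ℝ (Fin d)), IsCompact K → K ⊆ X →
        ∃ L : Set (EuclideanSpace ℝ (Fin d)), IsCompact L ∧ L ⊆ X ∧
          ∀ m : ℕ, 1 ≤ m → ∃ γ : ℝ, 0 < γ ∧
            ∀ f, MemCP P X f →
              (⨆ x ∈ K, ‖(∏ j ∈ Finset.range m, w (ψ^[j] x)) * f (ψ^[m] x)‖) ≤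
                γ * ⨆ y ∈ L, ‖f y‖) := by
    intro h K hK hKX
    obtain ⟨L, hL, hLX, γ, hγ, hest⟩ := h K hK hKX
    exact ⟨L, hL, hLX, fun m hm => ⟨γ ^ m, pow_pos hγ m, hest m hm⟩⟩
  exact ⟨⟨hi, fun h => hiii (hii h)⟩, ⟨hii, fun h => hi (hiii h)⟩⟩

end
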